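/- Let Λ be a ring whose additive group is ℤ^d, and let p be a prime. Then the local subring zeta function of Λ at p is rational: there exist polynomials P_p, Q_p ∈ ℚ[Y] with Q_p(0) = 1 such that, as formal power series in ℚ[[Y]], (∑_{i≥0} a_{p^i}(Λ)·Y^i)·Q_p(Y) = P_p(Y). Moreover there exists N ∈ ℕ, depending only on Λ, such that for every prime p one can choose such P_p, Q_p with deg P_p ≤ N and deg Q_p ≤ N. -/

import Mathlib

/-- The number of subrings (additive subgroups closed under multiplication) of additive
index `n` in a not necessarily associative, commutative or unital ring `Λ`. -/
noncomputable def subringCount (Λ : Type*) [NonUnitalNonAssocRing Λ] (n : ℕ) : ℕ :=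
  Nat.card {S : NonUnitalSubring Λ // S.toAddSubgroup.index = n}

/-! ### Part 1 -/
namespace LSZ

open Polynomial

instance factPrimes (p : Nat.Primes) : Fact (p : ℕ).Prime := ⟨p.2⟩

section Basics

variable {p : ℕ} [Fact p.Prime]

lemma um_add_lt {a b : ℚ_[p]} {r : ℝ} (ha : ‖a‖ < r) (hb : ‖b‖ < r) : ‖a + b‖ < r :=
  (Padic.nonarchimedean a b).trans_lt (max_lt ha hb)

lemma um_add_le {a b : ℚ_[p]} {r : ℝ} (ha : ‖a‖ ≤ r) (hb : ‖b‖ ≤ r) : ‖a + b‖ ≤ r :=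
  (Padic.nonarchimedean a b).trans (max_le ha hb)

lemma um_sub_lt {a b : ℚ_[p]} {r : ℝ} (ha : ‖a‖ < r) (hb : ‖b‖ < r) : ‖a - b‖ < r := by
  rw [sub_eq_add_neg]; exact um_add_lt ha (by rwa [norm_neg])

lemma um_sub_le {a b : ℚ_[p]} {r : ℝ} (ha : ‖a‖ ≤ r) (hb : ‖b‖ ≤ r) : ‖a - b‖ ≤ r := by
  rw [sub_eq_add_neg]; exact um_add_le ha (by rwa [norm_neg])

lemma um_sum_le {ι : Type*} (s : Finset ι) (f : ι → ℚ_[p]) {r : ℝ} (hr : 0 ≤ r)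
    (h : ∀ i ∈ s, ‖f i‖ ≤ r) : ‖∑ i ∈ s, f i‖ ≤ r := by
  classical
  induction s using Finset.induction_on with
  | empty => simpa using hr
  | insert a s ha ih =>
    rw [Finset.sum_insert ha]
    exact um_add_le (h _ (by simp)) (ih fun i hi => h i (by simp [hi]))

lemma um_sum_lt {ι : Type*} (s : Finset ι) (f : ι → ℚ_[p]) {r : ℝ} (hr : 0 < r)
    (h : ∀ i ∈ s, ‖f i‖ < r) : ‖∑ i ∈ s, f i‖ < r := by
  classical
  induction s using Finset.induction_on with
  | empty => simpa using hr
  | insert a s ha ih =>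
    rw [Finset.sum_insert ha]
    exact um_add_lt (h _ (by simp)) (ih fun i hi => h i (by simp [hi]))

/-- if `‖b‖ < ‖a‖` then `‖a+b‖ = ‖a‖`. -/
lemma um_dom {a b : ℚ_[p]} (h : ‖b‖ < ‖a‖) : ‖a + b‖ = ‖a‖ := by
  rw [Padic.add_eq_max_of_ne h.ne', max_eq_left h.le]

lemma norm_eq_of_close {a b : ℚ_[p]} (h : ‖a - b‖ < ‖a‖) : ‖b‖ = ‖a‖ := by
  have : b = a + -(a - b) := by ring
  rw [this]; exact um_dom (by rwa [norm_neg])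

lemma nat_norm_le (n : ℕ) : ‖(n : ℚ_[p])‖ ≤ 1 := by
  have := Padic.norm_int_le_one (p := p) (n : ℤ)
  simpa using this

lemma nat_norm_pos {n : ℕ} (hn : n ≠ 0) : 0 < ‖(n : ℚ_[p])‖ := by
  simpa using hn

lemma p_pos : (0 : ℝ) < p := by exact_mod_cast (Fact.out : p.Prime).pos

lemma one_lt_p : (1 : ℝ) < p := by exact_mod_cast (Fact.out : p.Prime).one_lt

lemma p_ne : (p : ℚ_[p]) ≠ 0 := by exact_mod_cast (Fact.out : p.Prime).ne_zero

/-- `norm < p^(-a)` iff `norm ≤ p^(-(a+1))`. -/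
lemma norm_lt_zpow_iff (x : ℚ_[p]) (a : ℤ) : ‖x‖ < (p : ℝ) ^ (-a) ↔ ‖x‖ ≤ (p : ℝ) ^ (-(a + 1)) := by
  have h := Padic.norm_le_pow_iff_norm_lt_pow_add_one x (-(a+1))
  rw [h]; congr! 2; ring

lemma nat_norm {n : ℕ} (hn : n ≠ 0) : ‖(n : ℚ_[p])‖ = (p : ℝ) ^ (-(padicValNat p n : ℤ)) := by
  rw [Padic.norm_eq_zpow_neg_valuation (by exact_mod_cast hn), Padic.valuation_natCast]

lemma lt_nat_norm_iff {n : ℕ} (hn : n ≠ 0) (x : ℚ_[p]) :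
    ‖x‖ < ‖(n : ℚ_[p])‖ ↔ ‖x‖ ≤ (p : ℝ) ^ (-((padicValNat p n + 1 : ℕ) : ℤ)) := by
  rw [nat_norm hn, norm_lt_zpow_iff]; push_cast; rfl

/-- exponent of the level `n` at `p` -/
def lev (p n : ℕ) : ℕ := padicValNat p n + 1

noncomputable def res (n : ℕ) (y : ℚ_[p]) : ℕ :=
  if h : ‖y‖ ≤ 1 then PadicInt.appr (⟨y, h⟩ : ℤ_[p]) (lev p n) else 0

lemma res_lt (n : ℕ) (y : ℚ_[p]) : res n y < p ^ lev p n := by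
  unfold res; split_ifs with h
  · exact PadicInt.appr_lt _ _
  · exact pow_pos (Fact.out : p.Prime).pos _

lemma res_spec {n : ℕ} (hn : n ≠ 0) {y : ℚ_[p]} (hy : ‖y‖ ≤ 1) :
    ‖y - (res n y : ℚ_[p])‖ < ‖(n : ℚ_[p])‖ := by
  rw [lt_nat_norm_iff hn, res, dif_pos hy]
  have h := PadicInt.appr_spec (lev p n) (⟨y, hy⟩ : ℤ_[p])
  rw [← PadicInt.norm_le_pow_iff_mem_span_pow] at h
  rw [PadicInt.norm_def] at h
  push_cast at h
  exact h

lemma nat_eq_of_close {n : ℕ} (hn : n ≠ 0) {a b : ℕ} (ha : a < p ^ lev p n) (hb : b < p ^ lev p n)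
    (h : ‖(a : ℚ_[p]) - b‖ < ‖(n : ℚ_[p])‖) : a = b := by
  rw [lt_nat_norm_iff hn] at h
  have h' : ‖(((a : ℤ) - b : ℤ) : ℚ_[p])‖ ≤ (p : ℝ) ^ (-((padicValNat p n + 1 : ℕ) : ℤ)) := by
    simpa using h
  rw [Padic.norm_int_le_pow_iff_dvd] at h'
  have h2 : (a : ℤ) ≡ b [ZMOD (p ^ lev p n : ℕ)] := by
    rw [Int.modEq_comm, Int.modEq_iff_dvd]; simpa [lev] using h'
  have h3 : a ≡ b [MOD p ^ lev p n] := Int.natCast_modEq_iff.1 h2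
  exact Nat.ModEq.eq_of_lt_of_lt h3 ha hb

lemma res_unique {n : ℕ} (hn : n ≠ 0) {y : ℚ_[p]} {r : ℕ} (hr : r < p ^ lev p n)
    (h : ‖y - (r : ℚ_[p])‖ < ‖(n : ℚ_[p])‖) : res n y = r := by
  have hy : ‖y‖ ≤ 1 := by
    have : y = (y - r) + r := by ring
    rw [this]; exact um_add_le (h.le.trans (nat_norm_le n)) (nat_norm_le r)
  refine nat_eq_of_close hn (res_lt n y) hr ?_
  have : (res n y : ℚ_[p]) - r = (y - r) - (y - res n y) := by ring
  rw [this]; exact um_sub_lt h (res_spec hn hy)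

lemma res_congr {n : ℕ} (hn : n ≠ 0) {y z : ℚ_[p]} (hy : ‖y‖ ≤ 1)
    (h : ‖y - z‖ < ‖(n : ℚ_[p])‖) : res n y = res n z := by
  symm
  refine res_unique hn (res_lt _ _) ?_
  have : z - res n y = (y - res n y) - (y - z) := by ring
  rw [this]; exact um_sub_lt (res_spec hn hy) h

lemma close_of_res_eq {n : ℕ} (hn : n ≠ 0) {y z : ℚ_[p]} (hy : ‖y‖ ≤ 1) (hz : ‖z‖ ≤ 1)
    (h : res n y = res n z) : ‖y - z‖ < ‖(n : ℚ_[p])‖ := by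
  have : y - z = (y - res n y) - (z - res n z) := by rw [h]; ring
  rw [this]; exact um_sub_lt (res_spec hn hy) (res_spec hn hz)

lemma res_zero {n : ℕ} (hn : n ≠ 0) : res n (0 : ℚ_[p]) = 0 :=
  res_unique hn (pow_pos (Fact.out : p.Prime).pos _) (by simpa using hn)

lemma res_eq_zero_iff {n : ℕ} (hn : n ≠ 0) {y : ℚ_[p]} (hy : ‖y‖ ≤ 1) :
    res n y = 0 ↔ ‖y‖ < ‖(n : ℚ_[p])‖ := by
  constructor
  · intro h; simpa [h] using res_spec hn hy
  · intro h; rw [res_congr hn (z := 0) hy (by simpa using h), res_zero hn]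

lemma res_sum {n : ℕ} (hn : n ≠ 0) {ι : Type*} (s : Finset ι) (z : ι → ℚ_[p])
    (hz : ∀ i ∈ s, ‖z i‖ ≤ 1) :
    res n (∑ i ∈ s, z i) = res n (∑ i ∈ s, (res n (z i) : ℚ_[p])) := by
  refine res_congr hn (um_sum_le _ _ zero_le_one hz) ?_
  rw [← Finset.sum_sub_distrib]
  exact um_sum_lt _ _ (nat_norm_pos hn) fun i hi => res_spec hn (hz i hi)

/-- full angular component -/
noncomputable def ac (x : ℚ_[p]) : ℚ_[p] := x * (p : ℚ_[p]) ^ (-x.valuation)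

lemma ac_zero : ac (0 : ℚ_[p]) = 0 := by simp [ac]

lemma norm_ac {x : ℚ_[p]} (hx : x ≠ 0) : ‖ac x‖ = 1 := by
  rw [ac, norm_mul, Padic.norm_p_zpow, Padic.norm_eq_zpow_neg_valuation hx, neg_neg,
    ← zpow_add₀ p_pos.ne']; simp

lemma norm_ac_le (x : ℚ_[p]) : ‖ac x‖ ≤ 1 := by
  by_cases hx : x = 0
  · simp [hx, ac_zero]
  · exact (norm_ac hx).le

lemma ac_spec (x : ℚ_[p]) : x = ac x * (p : ℚ_[p]) ^ x.valuation := by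
  rw [ac, mul_assoc, ← zpow_add₀ p_ne]; simp

noncomputable def acr (n : ℕ) (x : ℚ_[p]) : ℕ := res n (ac x)

lemma acr_lt (n : ℕ) (x : ℚ_[p]) : acr n x < p ^ lev p n := res_lt _ _

lemma acr_spec {n : ℕ} (hn : n ≠ 0) (x : ℚ_[p]) : ‖ac x - (acr n x : ℚ_[p])‖ < ‖(n : ℚ_[p])‖ :=
  res_spec hn (norm_ac_le x)

lemma acr_zero {n : ℕ} (hn : n ≠ 0) : acr n (0 : ℚ_[p]) = 0 := by
  rw [acr, ac_zero, res_zero hn]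

lemma acr_eq_zero_iff {n : ℕ} (hn : n ≠ 0) (x : ℚ_[p]) : acr n x = 0 ↔ x = 0 := by
  constructor
  · intro h
    by_contra hx
    rw [acr, res_eq_zero_iff hn (norm_ac_le x), norm_ac hx] at h
    exact absurd (nat_norm_le n) (not_le.2 h)
  · rintro rfl; exact acr_zero hn

lemma norm_acr {n : ℕ} (hn : n ≠ 0) {x : ℚ_[p]} (hx : x ≠ 0) : ‖(acr n x : ℚ_[p])‖ = 1 := by
  have := norm_eq_of_close (a := ac x) (b := acr n x)
    ((acr_spec hn x).trans_le ((nat_norm_le n).trans (norm_ac hx).ge))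
  rw [this, norm_ac hx]

lemma valuation_eq_of_norm_eq {x y : ℚ_[p]} (hx : x ≠ 0) (h : ‖x‖ = ‖y‖) :
    x.valuation = y.valuation := by
  have hy : y ≠ 0 := by rw [← norm_pos_iff, ← h]; exact norm_pos_iff.2 hx
  rw [Padic.norm_eq_zpow_neg_valuation hx, Padic.norm_eq_zpow_neg_valuation hy] at h
  have := zpow_right_injective₀ p_pos one_lt_p.ne' h
  linarith

lemma norm_le_iff_valuation {x y : ℚ_[p]} (hx : x ≠ 0) (hy : y ≠ 0) :
    ‖x‖ ≤ ‖y‖ ↔ y.valuation ≤ x.valuation := by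
  rw [Padic.norm_eq_zpow_neg_valuation hx, Padic.norm_eq_zpow_neg_valuation hy,
    zpow_le_zpow_iff_right₀ one_lt_p]
  constructor <;> intro h <;> linarith

lemma close_rv {n : ℕ} (hn : n ≠ 0) {x y : ℚ_[p]} (h : ‖x - y‖ < ‖(n : ℚ_[p])‖ * ‖x‖) :
    x.valuation = y.valuation ∧ acr n x = acr n y := by
  have hx : x ≠ 0 := by rintro rfl; simp at h; exact absurd h (not_lt.2 (norm_nonneg _))
  have h1 : ‖y‖ = ‖x‖ := norm_eq_of_close
    (h.trans_le (mul_le_of_le_one_left (norm_nonneg _) (nat_norm_le n)))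
  have hv := valuation_eq_of_norm_eq hx h1.symm
  refine ⟨hv, res_congr hn (norm_ac_le x) ?_⟩
  rw [ac, ac, ← hv, ← sub_mul, norm_mul, Padic.norm_p_zpow]
  have : ‖x‖ = (p : ℝ) ^ (-x.valuation) := Padic.norm_eq_zpow_neg_valuation hx
  rw [this] at h
  calc ‖x - y‖ * (p : ℝ) ^ (- -x.valuation)
      < (‖(n : ℚ_[p])‖ * (p : ℝ) ^ (-x.valuation)) * (p : ℝ) ^ (- -x.valuation) :=
        mul_lt_mul_of_pos_right h (zpow_pos p_pos _)
    _ = _ := by rw [mul_assoc, ← zpow_add₀ p_pos.ne']; simp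

lemma close_of_rv {n : ℕ} (hn : n ≠ 0) {x y : ℚ_[p]} (hx : x ≠ 0)
    (hv : x.valuation = y.valuation) (ha : acr n x = acr n y) :
    ‖x - y‖ < ‖(n : ℚ_[p])‖ * ‖x‖ := by
  have h := close_of_res_eq hn (norm_ac_le x) (norm_ac_le y) ha
  have h2 : x - y = (ac x - ac y) * (p : ℚ_[p]) ^ x.valuation := by
    conv_lhs => rw [ac_spec x, ac_spec y, ← hv]
    ring
  rw [h2, norm_mul, Padic.norm_p_zpow, Padic.norm_eq_zpow_neg_valuation hx]
  exact mul_lt_mul_of_pos_right h (zpow_pos p_pos _)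

lemma nat_norm_mul_le (m n : ℕ) : ‖((m * n : ℕ) : ℚ_[p])‖ ≤ ‖(m : ℚ_[p])‖ := by
  push_cast
  rw [norm_mul]; exact mul_le_of_le_one_right (norm_nonneg _) (nat_norm_le n)

lemma nat_norm_le_of_dvd {m n : ℕ} (h : m ∣ n) : ‖(n : ℚ_[p])‖ ≤ ‖(m : ℚ_[p])‖ := by
  obtain ⟨k, rfl⟩ := h; exact nat_norm_mul_le m k

/-- reduction of level -/
lemma acr_of_dvd {m n : ℕ} (hn : n ≠ 0) (h : m ∣ n) (x : ℚ_[p]) :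
    acr m x = res m (acr n x : ℚ_[p]) := by
  have hm : m ≠ 0 := by rintro rfl; simp at h; exact hn h
  exact res_congr hm (norm_ac_le x) ((acr_spec hn x).trans_le (nat_norm_le_of_dvd h))

lemma ac_mul (x y : ℚ_[p]) : ac (x * y) = ac x * ac y := by
  by_cases hx : x = 0
  · simp [hx, ac_zero]
  by_cases hy : y = 0
  · simp [hy, ac_zero]
  rw [ac, ac, ac, Padic.valuation_mul hx hy, neg_add, zpow_add₀ p_ne]; ring

lemma ac_inv (x : ℚ_[p]) : ac x⁻¹ = (ac x)⁻¹ := by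
  rw [ac, ac, Padic.valuation_inv, mul_inv, zpow_neg, zpow_neg]

lemma acr_mul {n : ℕ} (hn : n ≠ 0) (x y : ℚ_[p]) :
    acr n (x * y) = res n ((acr n x : ℚ_[p]) * (acr n y : ℚ_[p])) := by
  refine res_congr hn (norm_ac_le _) ?_
  rw [ac_mul]
  have : ac x * ac y - (acr n x : ℚ_[p]) * acr n y =
    ac x * (ac y - acr n y) + (ac x - acr n x) * acr n y := by ring
  rw [this]
  refine um_add_lt ?_ ?_
  · rw [norm_mul]
    exact (mul_le_of_le_one_left (norm_nonneg _) (norm_ac_le x)).trans_lt (acr_spec hn y)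
  · rw [norm_mul]
    exact (mul_le_of_le_one_right (norm_nonneg _) (nat_norm_le _)).trans_lt (acr_spec hn x)

lemma acr_inv {n : ℕ} (hn : n ≠ 0) (x : ℚ_[p]) :
    acr n x⁻¹ = res n ((acr n x : ℚ_[p])⁻¹) := by
  by_cases hx : x = 0
  · subst hx; rw [inv_zero, acr_zero hn]; simp [res_zero hn]
  refine res_congr hn (norm_ac_le _) ?_
  have h0 : ac x ≠ 0 := by rw [← norm_pos_iff, norm_ac hx]; exact one_pos
  have h1 : (acr n x : ℚ_[p]) ≠ 0 := by rw [← norm_pos_iff, norm_acr hn hx]; exact one_pos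
  rw [ac_inv, inv_sub_inv h0 h1, norm_div, norm_mul, norm_ac hx, norm_acr hn hx, norm_sub_rev]
  simpa using acr_spec hn x

lemma lev_le {n : ℕ} (hn : n ≠ 0) : lev p n ≤ n := by
  have h1 : p ^ padicValNat p n ≤ n := Nat.le_of_dvd (Nat.pos_of_ne_zero hn) pow_padicValNat_dvd
  exact (Nat.lt_pow_self (Fact.out : p.Prime).one_lt).trans_le h1

lemma norm_zpow_lt {n : ℕ} (hn : n ≠ 0) {x : ℚ_[p]} (hx : ‖x‖ ≤ (p : ℝ) ^ (-(n : ℤ))) :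
    ‖x‖ < ‖(n : ℚ_[p])‖ := by
  rw [lt_nat_norm_iff hn]
  refine hx.trans ?_
  rw [zpow_le_zpow_iff_right₀ one_lt_p, neg_le_neg_iff]
  exact_mod_cast lev_le hn

lemma res_of_acr {n : ℕ} (hn : n ≠ 0) {z : ℚ_[p]} (hz : ‖z‖ ≤ 1) :
    res n z = res n ((acr n z : ℚ_[p]) * (p : ℚ_[p]) ^ (min z.valuation n)) := by
  have hv : 0 ≤ z.valuation := (Padic.norm_le_one_iff_val_nonneg z).1 hz
  refine res_congr hn hz ?_
  rcases le_total z.valuation n with h | h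
  · rw [min_eq_left h]
    have h2 : z - (acr n z : ℚ_[p]) * (p : ℚ_[p]) ^ z.valuation =
      (ac z - acr n z) * (p : ℚ_[p]) ^ z.valuation := by
      rw [sub_mul, ← ac_spec]
    rw [h2, norm_mul]
    refine (mul_le_of_le_one_right (norm_nonneg _) ?_).trans_lt (acr_spec hn z)
    rw [Padic.norm_p_zpow]
    exact zpow_le_one_of_nonpos₀ one_lt_p.le (by omega)
  · rw [min_eq_right h]
    refine um_sub_lt (norm_zpow_lt hn ?_) (norm_zpow_lt hn ?_)
    · by_cases h0 : z = 0
      · rw [h0, norm_zero]; exact (zpow_pos p_pos _).le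
      · rw [Padic.norm_eq_zpow_neg_valuation h0, zpow_le_zpow_iff_right₀ one_lt_p]; omega
    · rw [norm_mul, Padic.norm_p_zpow]
      exact mul_le_of_le_one_left (zpow_pos p_pos _).le (nat_norm_le _)

lemma rv_of_res {k M : ℕ} (hk : k ≠ 0) (hM : M ≠ 0) {y : ℚ_[p]} (hy : ‖y‖ ≤ 1)
    (hMy : ‖(M : ℚ_[p])‖ ≤ ‖y‖) :
    y.valuation = ((res (k * M) y : ℕ) : ℚ_[p]).valuation ∧
      acr k y = acr k ((res (k * M) y : ℕ) : ℚ_[p]) := by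
  refine close_rv hk ((res_spec (mul_ne_zero hk hM) hy).trans_le ?_)
  push_cast
  rw [norm_mul]
  exact mul_le_mul_of_nonneg_left hMy (norm_nonneg _)

end Basics
end LSZ

/-! ### Part 2 -/
namespace LSZ

/-- A parameter space with p-adic valued coordinate functions and a discrete label. -/
structure Base where
  Ω : Type
  pr : Ω → Nat.Primes
  I : Type
  u : I → (ω : Ω) → ℚ_[pr ω]
  S : Type
  s : Ω → S

namespace Base

section Tame

variable (B : Base)

noncomputable def V (i : B.I) (ω : B.Ω) : ℤ := (B.u i ω).valuation

/-- integer affine forms in the valuations of the coordinates -/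
def Aff : AddSubgroup (B.Ω → ℤ) := AddSubgroup.closure (insert (fun _ => 1) (Set.range B.V))

inductive Basic : (B.Ω → ℤ) → Prop
  | acr (i : B.I) (k : ℕ) (hk : k ≠ 0) : Basic (fun ω => (acr k (B.u i ω) : ℤ))
  | mod (l : B.Ω → ℤ) (hl : l ∈ B.Aff) (k : ℕ) (hk : k ≠ 0) : Basic (fun ω => l ω % k)
  | sgn (l : B.Ω → ℤ) (hl : l ∈ B.Aff) : Basic (fun ω => if 0 ≤ l ω then 1 else 0)

def Agree (F : Set (B.Ω → ℤ)) (ω ω' : B.Ω) : Prop :=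
  B.pr ω = B.pr ω' ∧ B.s ω = B.s ω' ∧ ∀ ψ ∈ F, ψ ω = ψ ω'

def TameT {T : Type*} (f : B.Ω → T) : Prop :=
  ∃ F : Set (B.Ω → ℤ), F.Finite ∧ (∀ ψ ∈ F, B.Basic ψ) ∧ ∀ ω ω', B.Agree F ω ω' → f ω = f ω'

def TameZ (g : B.Ω → ℤ) : Prop :=
  ∃ (n : ℕ) (κ : B.Ω → Fin n) (l : Fin n → B.Ω → ℤ) (D : ℤ), 0 < D ∧ B.TameT κ ∧
    (∀ k, l k ∈ B.Aff) ∧ ∀ ω, D * g ω = l (κ ω) ω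

variable {B}

lemma Agree.mono {F G : Set (B.Ω → ℤ)} (h : F ⊆ G) {ω ω' : B.Ω} (hG : B.Agree G ω ω') :
    B.Agree F ω ω' := ⟨hG.1, hG.2.1, fun ψ hψ => hG.2.2 ψ (h hψ)⟩

namespace TameT

variable {T T' : Type*}

lemma pr : B.TameT B.pr := ⟨∅, Set.finite_empty, by simp, fun _ _ h => h.1⟩

lemma label : B.TameT B.s := ⟨∅, Set.finite_empty, by simp, fun _ _ h => h.2.1⟩

lemma const (t : T) : B.TameT (fun _ => t) := ⟨∅, Set.finite_empty, by simp, fun _ _ _ => rfl⟩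

lemma basic {ψ : B.Ω → ℤ} (h : B.Basic ψ) : B.TameT ψ :=
  ⟨{ψ}, Set.finite_singleton _, by simpa using h, fun _ _ h => h.2.2 ψ rfl⟩

lemma map {f : B.Ω → T} (hf : B.TameT f) (F : T → T') : B.TameT (fun ω => F (f ω)) := by
  obtain ⟨A, h1, h2, h3⟩ := hf
  exact ⟨A, h1, h2, fun ω ω' h => by beta_reduce; rw [h3 ω ω' h]⟩

lemma det {f : B.Ω → T} (hf : B.TameT f) {g : B.Ω → T'}
    (h : ∀ ω ω', f ω = f ω' → g ω = g ω') : B.TameT g := by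
  obtain ⟨A, h1, h2, h3⟩ := hf
  exact ⟨A, h1, h2, fun ω ω' h' => h _ _ (h3 ω ω' h')⟩

lemma prod {f : B.Ω → T} {g : B.Ω → T'} (hf : B.TameT f) (hg : B.TameT g) :
    B.TameT (fun ω => (f ω, g ω)) := by
  obtain ⟨A, h1, h2, h3⟩ := hf
  obtain ⟨A', h1', h2', h3'⟩ := hg
  refine ⟨A ∪ A', h1.union h1', ?_, fun ω ω' h => ?_⟩
  · rintro ψ (h | h)
    exacts [h2 _ h, h2' _ h]
  · beta_reduce
    rw [h3 ω ω' (h.mono Set.subset_union_left), h3' ω ω' (h.mono Set.subset_union_right)]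

lemma map₂ {T'' : Type*} {f : B.Ω → T} {g : B.Ω → T'} (hf : B.TameT f) (hg : B.TameT g)
    (F : T → T' → T'') : B.TameT (fun ω => F (f ω) (g ω)) :=
  (hf.prod hg).map (fun x => F x.1 x.2)

lemma pi {ι : Type*} [Finite ι] {T : ι → Type*} {f : ∀ i, B.Ω → T i} (hf : ∀ i, B.TameT (f i)) :
    B.TameT (fun ω i => f i ω) := by
  choose A h1 h2 h3 using hf
  refine ⟨⋃ i, A i, Set.finite_iUnion h1, ?_, fun ω ω' h => ?_⟩
  · intro ψ hψ
    obtain ⟨i, hi⟩ := Set.mem_iUnion.1 hψ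
    exact h2 i _ hi
  · funext i
    exact h3 i ω ω' (h.mono (Set.subset_iUnion _ i))

lemma and {P Q : B.Ω → Prop} (hP : B.TameT P) (hQ : B.TameT Q) :
    B.TameT (fun ω => P ω ∧ Q ω) := hP.map₂ hQ (· ∧ ·)

lemma or {P Q : B.Ω → Prop} (hP : B.TameT P) (hQ : B.TameT Q) :
    B.TameT (fun ω => P ω ∨ Q ω) := hP.map₂ hQ (· ∨ ·)

lemma imp {P Q : B.Ω → Prop} (hP : B.TameT P) (hQ : B.TameT Q) :
    B.TameT (fun ω => P ω → Q ω) := hP.map₂ hQ (fun a b => a → b)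

lemma not {P : B.Ω → Prop} (hP : B.TameT P) : B.TameT (fun ω => ¬ P ω) := hP.map (¬ ·)

lemma all {ι : Type*} [Finite ι] {P : ι → B.Ω → Prop} (hP : ∀ i, B.TameT (P i)) :
    B.TameT (fun ω => ∀ i, P i ω) := (pi hP).map (fun f => ∀ i, f i)

lemma ex {ι : Type*} [Finite ι] {P : ι → B.Ω → Prop} (hP : ∀ i, B.TameT (P i)) :
    B.TameT (fun ω => ∃ i, P i ω) := (pi hP).map (fun f => ∃ i, f i)

lemma ite {P : B.Ω → Prop} [DecidablePred P] (hP : B.TameT P) {f g : B.Ω → T} (hf : B.TameT f) (hg : B.TameT g) :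
    B.TameT (fun ω => if P ω then f ω else g ω) := by
  classical
  have := (hP.prod (hf.prod hg)).map (fun x => if x.1 then x.2.1 else x.2.2)
  convert this using 2 with ω
  congr

/-- locality: on each piece of a finite tame partition -/
lemma select {ι : Type*} [Finite ι] {κ : B.Ω → ι} (hκ : B.TameT κ) {f : ι → B.Ω → T}
    (hf : ∀ i, B.TameT (f i)) : B.TameT (fun ω => f (κ ω) ω) :=
  hκ.map₂ (pi hf) (fun i F => F i)

end TameT

lemma Aff_const (c : ℤ) : (fun _ => c) ∈ B.Aff := by
  have h : (fun _ => (1 : ℤ)) ∈ B.Aff := AddSubgroup.subset_closure (Set.mem_insert _ _)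
  have := B.Aff.zsmul_mem h c
  convert this using 1
  funext ω; simp

lemma Aff_V (i : B.I) : B.V i ∈ B.Aff :=
  AddSubgroup.subset_closure (Set.mem_insert_of_mem _ ⟨i, rfl⟩)

namespace TameZ

open Classical in
lemma mk' {K : Type*} [Finite K] {g : B.Ω → ℤ} (κ : B.Ω → K) (l : K → B.Ω → ℤ) (D : ℤ) (hD : 0 < D)
    (hκ : B.TameT κ) (hl : ∀ k, l k ∈ B.Aff) (h : ∀ ω, D * g ω = l (κ ω) ω) : B.TameZ g := by
  obtain ⟨n, ⟨e⟩⟩ := Finite.exists_equiv_fin K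
  exact ⟨n, fun ω => e (κ ω), fun k => l (e.symm k), D, hD, hκ.map e, fun k => hl _,
    fun ω => by simpa using h ω⟩

lemma of_aff {l : B.Ω → ℤ} (hl : l ∈ B.Aff) : B.TameZ l :=
  mk' (K := Unit) (fun _ => ()) (fun _ => l) 1 one_pos (TameT.const _) (fun _ => hl) (by simp)

lemma const (c : ℤ) : B.TameZ (fun _ => c) := of_aff (Aff_const c)

lemma V (i : B.I) : B.TameZ (B.V i) := of_aff (Aff_V i)

/-- locality on a finite tame partition -/
lemma select' {K : Type*} [Finite K] {κ : B.Ω → K} (hκ : B.TameT κ) {g : K → B.Ω → ℤ}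
    {f : B.Ω → ℤ} (hg : ∀ k, B.TameZ (g k)) (hf : ∀ ω, f ω = g (κ ω) ω) : B.TameZ f := by
  classical
  have := Fintype.ofFinite K
  choose n κ' l D hD hκ' hl h using hg
  refine mk' (K := Σ k, Fin (n k)) (fun ω => ⟨κ ω, κ' (κ ω) ω⟩)
    (fun x => (∏ k ∈ Finset.univ.erase x.1, D k) • l x.1 x.2) (∏ k, D k)
    (Finset.prod_pos fun k _ => hD k) ?_ ?_ ?_
  · exact hκ.map₂ (TameT.pi hκ') (fun k F => (⟨k, F k⟩ : Σ k, Fin (n k)))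
  · intro x; exact B.Aff.zsmul_mem (hl _ _) _
  · intro ω
    simp only [Pi.smul_apply, smul_eq_mul]
    rw [← h, hf, ← Finset.mul_prod_erase _ _ (Finset.mem_univ (κ ω))]; ring

lemma select {K : Type*} [Finite K] {κ : B.Ω → K} (hκ : B.TameT κ) {g : K → B.Ω → ℤ}
    (hg : ∀ k, B.TameZ (g k)) : B.TameZ (fun ω => g (κ ω) ω) := select' hκ hg fun _ => rfl

lemma ite {P : B.Ω → Prop} [DecidablePred P] (hP : B.TameT P) {f g : B.Ω → ℤ} (hf : B.TameZ f) (hg : B.TameZ g) :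
    B.TameZ (fun ω => if P ω then f ω else g ω) := by
  refine select' (K := Bool) (κ := fun ω => decide (P ω)) (by
      classical
      have := hP.map (fun x => decide x)
      convert this using 2 with ω
      congr)
    (g := fun b => if b then f else g) ?_ ?_
  · intro b; cases b <;> simpa
  · intro ω; by_cases h : P ω <;> simp [h]

lemma of_tameT {g : B.Ω → ℤ} (hg : B.TameT g) {b : ℕ} (hb : ∀ ω, |g ω| ≤ b) : B.TameZ g := by
  refine mk' (K := Set.Icc (-(b : ℤ)) b) (fun ω => ⟨g ω, abs_le.1 (hb ω)⟩) (fun k _ => k.1) 1 one_pos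
    ?_ (fun k => Aff_const _) (by simp)
  exact hg.det fun ω ω' h => Subtype.ext h

lemma smul {g : B.Ω → ℤ} (hg : B.TameZ g) (c : ℤ) : B.TameZ (fun ω => c * g ω) := by
  obtain ⟨n, κ, l, D, hD, hκ, hl, h⟩ := hg
  refine mk' κ (fun k => c • l k) D hD hκ (fun k => B.Aff.zsmul_mem (hl k) c) fun ω => ?_
  simp only [Pi.smul_apply, smul_eq_mul]; rw [← h]; ring

lemma neg {g : B.Ω → ℤ} (hg : B.TameZ g) : B.TameZ (fun ω => - g ω) := by
  simpa using hg.smul (-1)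

lemma add {f g : B.Ω → ℤ} (hf : B.TameZ f) (hg : B.TameZ g) : B.TameZ (fun ω => f ω + g ω) := by
  obtain ⟨n, κ, l, D, hD, hκ, hl, h⟩ := hf
  obtain ⟨n', κ', l', D', hD', hκ', hl', h'⟩ := hg
  refine mk' (K := Fin n × Fin n') (fun ω => (κ ω, κ' ω)) (fun k => D' • l k.1 + D • l' k.2)
    (D * D') (mul_pos hD hD') (hκ.prod hκ')
    (fun k => B.Aff.add_mem (B.Aff.zsmul_mem (hl _) _) (B.Aff.zsmul_mem (hl' _) _)) fun ω => ?_
  simp only [Pi.smul_apply, smul_eq_mul, Pi.add_apply]; rw [← h, ← h']; ring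

lemma sub {f g : B.Ω → ℤ} (hf : B.TameZ f) (hg : B.TameZ g) : B.TameZ (fun ω => f ω - g ω) := by
  simpa [sub_eq_add_neg] using hf.add hg.neg

lemma sum {ι : Type*} (s : Finset ι) {f : ι → B.Ω → ℤ} (hf : ∀ i, B.TameZ (f i)) :
    B.TameZ (fun ω => ∑ i ∈ s, f i ω) := by
  classical
  induction s using Finset.induction_on with
  | empty => simpa using const (B := B) 0
  | insert a s ha ih => simpa [Finset.sum_insert ha] using (hf a).add ih

lemma of_mul {g : B.Ω → ℤ} (e : ℤ) (he : e ≠ 0) (hg : B.TameZ (fun ω => e * g ω)) : B.TameZ g := by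
  have hg' := hg.smul e
  obtain ⟨n, κ, l, D, hD, hκ, hl, h⟩ := hg'
  refine mk' κ l (D * (e * e)) (mul_pos hD (mul_self_pos.2 he)) hκ hl fun ω => ?_
  rw [← h]; ring

lemma nonneg {g : B.Ω → ℤ} (hg : B.TameZ g) : B.TameT (fun ω => 0 ≤ g ω) := by
  obtain ⟨n, κ, l, D, hD, hκ, hl, h⟩ := hg
  have h1 : B.TameT (fun ω => 0 ≤ l (κ ω) ω) := by
    refine TameT.select hκ (f := fun k ω => 0 ≤ l k ω) fun k => ?_
    refine (TameT.basic (Basic.sgn _ (hl k))).det fun ω ω' h => ?_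
    by_cases h1 : 0 ≤ l k ω <;> by_cases h2 : 0 ≤ l k ω' <;> simp [h1, h2] at h ⊢
  convert h1 using 2 with ω
  rw [← h]
  exact (mul_nonneg_iff_of_pos_left hD).symm

lemma le {f g : B.Ω → ℤ} (hf : B.TameZ f) (hg : B.TameZ g) : B.TameT (fun ω => f ω ≤ g ω) := by
  simpa using (hg.sub hf).nonneg

lemma eq {f g : B.Ω → ℤ} (hf : B.TameZ f) (hg : B.TameZ g) : B.TameT (fun ω => f ω = g ω) := by
  simpa [le_antisymm_iff] using (hf.le hg).and (hg.le hf)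

lemma mod {g : B.Ω → ℤ} (hg : B.TameZ g) (k : ℕ) (hk : k ≠ 0) : B.TameT (fun ω => g ω % k) := by
  obtain ⟨n, κ, l, D, hD, hκ, hl, h⟩ := hg
  have h1 : B.TameT (fun ω => l (κ ω) ω % ((D.toNat * k : ℕ) : ℤ)) := by
    refine TameT.select hκ (f := fun k' ω => l k' ω % ((D.toNat * k : ℕ) : ℤ)) fun k' => ?_
    exact TameT.basic (Basic.mod _ (hl k') _ (mul_ne_zero (by omega) hk))
  refine h1.det fun ω ω' hh => ?_
  rw [← h, ← h] at hh
  push_cast at hh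
  rw [Int.toNat_of_nonneg hD.le, Int.mul_emod_mul_of_pos _ _ hD, Int.mul_emod_mul_of_pos _ _ hD] at hh
  exact mul_left_cancel₀ hD.ne' hh

lemma tameT {g : B.Ω → ℤ} (hg : B.TameZ g) {b : ℕ} (hb : ∀ ω, |g ω| ≤ b) : B.TameT g := by
  have h1 := (hg.add (const b)).mod (2 * b + 1) (by omega)
  refine h1.det fun ω ω' h => ?_
  have h2 := abs_le.1 (hb ω)
  have h3 := abs_le.1 (hb ω')
  rw [Int.emod_eq_of_lt (by omega) (by omega), Int.emod_eq_of_lt (by omega) (by omega)] at h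
  omega

open Classical in
lemma min_const {g : B.Ω → ℤ} (hg : B.TameZ g) (c : ℤ) : B.TameZ (fun ω => min (g ω) c) := by
  have := ite (hg.le (const c)) hg (const c)
  convert this using 2 with ω
  split_ifs with h
  · exact min_eq_left h
  · exact min_eq_right (not_le.1 h).le

end TameZ

end Tame
end Base
end LSZ

/-! ### Part 3 -/
namespace LSZ
namespace Base

section RV

variable {B : Base}

/-- families of p-adic numbers with tame leading terms at all levels -/
def RVT (B : Base) (w : (ω : B.Ω) → ℚ_[B.pr ω]) : Prop :=
  B.TameZ (fun ω => (w ω).valuation) ∧ ∀ k : ℕ, k ≠ 0 → B.TameT (fun ω => acr k (w ω))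

namespace RVT

lemma coord (i : B.I) : B.RVT (B.u i) := by
  refine ⟨TameZ.V i, fun k hk => ?_⟩
  exact (TameT.basic (Basic.acr i k hk)).det fun ω ω' h => by exact_mod_cast h

lemma eq_zero {w : (ω : B.Ω) → ℚ_[B.pr ω]} (hw : B.RVT w) : B.TameT (fun ω => w ω = 0) := by
  have := (hw.2 1 one_ne_zero).map (fun x => x = 0)
  convert this using 2 with ω
  exact (acr_eq_zero_iff one_ne_zero _).symm

lemma select {K : Type*} [Finite K] {κ : B.Ω → K} (hκ : B.TameT κ)
    {w : K → (ω : B.Ω) → ℚ_[B.pr ω]} (hw : ∀ k, B.RVT (w k)) : B.RVT (fun ω => w (κ ω) ω) :=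
  ⟨TameZ.select hκ (g := fun k ω => (w k ω).valuation) fun k => (hw k).1,
   fun k hk => TameT.select hκ (f := fun i ω => acr k (w i ω)) fun i => (hw i).2 k hk⟩

lemma ite {P : B.Ω → Prop} [DecidablePred P] (hP : B.TameT P) {w w' : (ω : B.Ω) → ℚ_[B.pr ω]}
    (hw : B.RVT w) (hw' : B.RVT w') : B.RVT (fun ω => if P ω then w ω else w' ω) := by
  constructor
  · have := TameZ.ite hP hw.1 hw'.1
    convert this using 2 with ω
    beta_reduce
    split_ifs <;> rfl
  · intro k hk
    have := TameT.ite hP (hw.2 k hk) (hw'.2 k hk)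
    convert this using 2 with ω
    beta_reduce
    split_ifs <;> rfl

/-- functions of the prime with bounded valuation -/
lemma of_pr (f : (p : Nat.Primes) → ℚ_[p]) (b : ℕ) (hb : ∀ p, |(f p).valuation| ≤ b) :
    B.RVT (fun ω => f (B.pr ω)) :=
  ⟨TameZ.of_tameT (TameT.pr.map (fun p => (f p).valuation)) (fun ω => hb _),
   fun k _ => TameT.pr.map (fun p => acr k (f p))⟩

lemma nat (n : ℕ) : B.RVT (fun _ => (n : ℚ_[_])) := by
  refine of_pr (fun p => (n : ℚ_[p])) n fun p => ?_
  rw [Padic.valuation_natCast, Nat.abs_cast]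
  by_cases hn : n = 0
  · simp [hn]
  · have := lev_le (p := p) hn
    rw [lev] at this; exact_mod_cast (Nat.le_succ _).trans this

lemma zero : B.RVT (fun _ => (0 : ℚ_[_])) := by simpa using nat (B := B) 0

lemma one : B.RVT (fun _ => (1 : ℚ_[_])) := by simpa using nat (B := B) 1

lemma mul {w w' : (ω : B.Ω) → ℚ_[B.pr ω]} (hw : B.RVT w) (hw' : B.RVT w') :
    B.RVT (fun ω => w ω * w' ω) := by
  classical
  constructor
  · have := TameZ.ite (hw.eq_zero.or hw'.eq_zero) (TameZ.const 0) (hw.1.add hw'.1)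
    convert this using 2 with ω
    split_ifs with h
    · rcases h with h | h <;> simp [h]
    · push Not at h; exact Padic.valuation_mul h.1 h.2
  · intro k hk
    simp only [acr_mul hk]
    exact (TameT.pr.prod ((hw.2 k hk).prod (hw'.2 k hk))).map
      (fun x => res (p := x.1) k ((x.2.1 : ℚ_[x.1]) * (x.2.2 : ℚ_[x.1])))

lemma inv {w : (ω : B.Ω) → ℚ_[B.pr ω]} (hw : B.RVT w) : B.RVT (fun ω => (w ω)⁻¹) := by
  constructor
  · simpa only [Padic.valuation_inv] using hw.1.neg
  · intro k hk
    simp only [acr_inv hk]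
    exact (TameT.pr.prod (hw.2 k hk)).map (fun x => res (p := x.1) k ((x.2 : ℚ_[x.1])⁻¹))

lemma neg {w : (ω : B.Ω) → ℚ_[B.pr ω]} (hw : B.RVT w) : B.RVT (fun ω => - w ω) := by
  have : B.RVT (fun _ => (-1 : ℚ_[_])) := of_pr (fun p => (-1 : ℚ_[p])) 0 (by
    intro p
    have : ((-1 : ℚ_[p])).valuation = (1 : ℚ_[p]).valuation :=
      valuation_eq_of_norm_eq (by simp) (by simp)
    simp [this])
  simpa using this.mul hw

lemma int (n : ℤ) : B.RVT (fun _ => (n : ℚ_[_])) := by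
  obtain ⟨m, rfl | rfl⟩ := n.eq_nat_or_neg
  · simpa using nat (B := B) m
  · simpa using (nat (B := B) m).neg

lemma pow {w : (ω : B.Ω) → ℚ_[B.pr ω]} (hw : B.RVT w) (n : ℕ) : B.RVT (fun ω => w ω ^ n) := by
  induction n with
  | zero => simpa using one
  | succ n ih => simpa only [pow_succ] using ih.mul hw

lemma val_zpow {p : ℕ} [Fact p.Prime] (γ : ℤ) : ((p : ℚ_[p]) ^ γ).valuation = γ := by
  simp

lemma ac_zpow {p : ℕ} [Fact p.Prime] (γ : ℤ) : ac ((p : ℚ_[p]) ^ γ) = 1 := by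
  rw [ac, val_zpow, ← zpow_add₀ p_ne]; simp

lemma zpow_p {γ : B.Ω → ℤ} (hγ : B.TameZ γ) :
    B.RVT (fun ω => (((B.pr ω : ℕ) : ℚ_[B.pr ω])) ^ γ ω) := by
  constructor
  · simpa only [val_zpow] using hγ
  · intro k hk
    simp only [acr, ac_zpow]
    exact TameT.pr.map (fun p => res (p := p) k 1)

/-- a tame natural number (label dependent) of bounded valuation -/
lemma of_tameT_nat {f : B.Ω → ℕ} (hf : B.TameT f) {b : ℕ}
    (hb : ∀ ω, ((f ω : ℕ) : ℚ_[B.pr ω]).valuation ≤ b) : B.RVT (fun ω => (f ω : ℚ_[B.pr ω])) := by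
  constructor
  · refine TameZ.of_tameT (b := b)
      ((TameT.pr.prod hf).map (fun x => ((x.2 : ℕ) : ℚ_[x.1]).valuation)) fun ω => ?_
    have := hb ω
    rw [Padic.valuation_natCast] at this ⊢
    rwa [Nat.abs_cast]
  · intro k _
    exact (TameT.pr.prod hf).map (fun x => acr k ((x.2 : ℕ) : ℚ_[x.1]))

lemma norm_le {w w' : (ω : B.Ω) → ℚ_[B.pr ω]} (hw : B.RVT w) (hw' : B.RVT w') :
    B.TameT (fun ω => ‖w ω‖ ≤ ‖w' ω‖) := by
  have := hw.eq_zero.or (hw'.eq_zero.not.and (hw'.1.le hw.1))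
  convert this using 2 with ω
  by_cases h : w ω = 0
  · simp [h]
  by_cases h' : w' ω = 0
  · simp [h, h']
  · simp [h, h', norm_le_iff_valuation h h']

lemma norm_lt {w w' : (ω : B.Ω) → ℚ_[B.pr ω]} (hw : B.RVT w) (hw' : B.RVT w') :
    B.TameT (fun ω => ‖w ω‖ < ‖w' ω‖) := by
  simpa using (hw'.norm_le hw).not

/-- residues of sums -/
lemma res_sum {ι : Type*} [Fintype ι] {z : ι → (ω : B.Ω) → ℚ_[B.pr ω]} (hz : ∀ i, B.RVT (z i))
    (h1 : ∀ i ω, ‖z i ω‖ ≤ 1) {M : ℕ} (hM : M ≠ 0) :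
    B.TameT (fun ω => res M (∑ i, z i ω)) := by
  have key : ∀ i, B.TameT (fun ω => res M (z i ω)) := by
    intro i
    have hv : ∀ ω, 0 ≤ (z i ω).valuation := fun ω => (Padic.norm_le_one_iff_val_nonneg _).1 (h1 i ω)
    have ht : B.TameT (fun ω => min (z i ω).valuation M) := by
      refine TameZ.tameT (b := M) ((hz i).1.min_const M) fun ω => ?_
      have := hv ω
      rw [abs_le]; constructor <;> omega
    have := (TameT.pr.prod (((hz i).2 M hM).prod ht)).map
      (fun x => res (p := x.1) M ((x.2.1 : ℚ_[x.1]) * ((x.1 : ℕ) : ℚ_[x.1]) ^ x.2.2))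
    convert this using 2 with ω
    exact res_of_acr hM (h1 i ω)
  have := (TameT.pr.prod (TameT.pi key)).map
    (fun x => res (p := x.1) M (∑ i, (x.2 i : ℚ_[x.1])))
  convert this using 2 with ω
  exact LSZ.res_sum hM _ _ fun i _ => h1 i ω

lemma of_res {y : (ω : B.Ω) → ℚ_[B.pr ω]} {M : ℕ} (hM : M ≠ 0) (h1 : ∀ ω, ‖y ω‖ ≤ 1)
    (h2 : ∀ ω, y ω = 0 ∨ ‖(M : ℚ_[B.pr ω])‖ ≤ ‖y ω‖)
    (h3 : ∀ n : ℕ, n ≠ 0 → B.TameT (fun ω => res n (y ω))) : B.RVT y := by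
  have key : ∀ k : ℕ, k ≠ 0 → ∀ ω, (y ω).valuation = ((res (k * M) (y ω) : ℕ) : ℚ_[B.pr ω]).valuation ∧
      acr k (y ω) = acr k ((res (k * M) (y ω) : ℕ) : ℚ_[B.pr ω]) := by
    intro k hk ω
    rcases h2 ω with h | h
    · rw [h, res_zero (mul_ne_zero hk hM)]; simp
    · exact rv_of_res hk hM (h1 ω) h
  constructor
  · refine TameZ.of_tameT (b := M) ?_ ?_
    · have := (TameT.pr.prod (h3 (1 * M) (mul_ne_zero one_ne_zero hM))).map
        (fun x => ((x.2 : ℕ) : ℚ_[x.1]).valuation)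
      convert this using 2 with ω
      exact (key 1 one_ne_zero ω).1
    · intro ω
      rcases h2 ω with h | h
      · simp [h]
      · have h0 : y ω ≠ 0 := by
          rw [← norm_pos_iff]; exact (nat_norm_pos hM).trans_le h
        rw [norm_le_iff_valuation (by exact_mod_cast hM) h0, Padic.valuation_natCast] at h
        have h4 := (Padic.norm_le_one_iff_val_nonneg _).1 (h1 ω)
        have h5 := lev_le (p := B.pr ω) hM
        rw [lev] at h5
        rw [abs_of_nonneg h4]; omega
  · intro k hk
    have := (TameT.pr.prod (h3 (k * M) (mul_ne_zero hk hM))).map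
        (fun x => acr k ((x.2 : ℕ) : ℚ_[x.1]))
    convert this using 2 with ω
    exact (key k hk ω).2

/-- sums without cancellation -/
lemma sum {ι : Type*} [Fintype ι] {w : ι → (ω : B.Ω) → ℚ_[B.pr ω]} (hw : ∀ i, B.RVT (w i))
    {P : B.Ω → Prop} [DecidablePred P] (hP : B.TameT P) {M : ℕ} (hM : M ≠ 0)
    (h : ∀ ω, P ω → ∀ i, ‖(M : ℚ_[B.pr ω])‖ * ‖w i ω‖ ≤ ‖∑ j, w j ω‖) :
    B.RVT (fun ω => if P ω then ∑ j, w j ω else 0) := by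
  classical
  rcases isEmpty_or_nonempty ι with hι | hι
  · simpa using zero
  let G : (ι → ι → Prop) → ι := fun m =>
    if h : ∃ j, ∀ i, m i j then h.choose else Classical.arbitrary ι
  let κ : B.Ω → ι := fun ω => G (fun i j => ‖w i ω‖ ≤ ‖w j ω‖)
  have hκ : B.TameT κ :=
    (TameT.pi fun i => TameT.pi fun j => (hw i).norm_le (hw j)).map G
  have hmax : ∀ ω i, ‖w i ω‖ ≤ ‖w (κ ω) ω‖ := by
    intro ω
    have hex : ∃ j, ∀ i, ‖w i ω‖ ≤ ‖w j ω‖ := Finite.exists_max (fun i => ‖w i ω‖)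
    have : κ ω = hex.choose := dif_pos hex
    rw [this]; exact hex.choose_spec
  have hm : B.RVT (fun ω => w (κ ω) ω) := select hκ hw
  let Q : B.Ω → Prop := fun ω => P ω ∧ w (κ ω) ω ≠ 0
  have hQ : B.TameT Q := hP.and hm.eq_zero.not
  let z : ι → (ω : B.Ω) → ℚ_[B.pr ω] := fun i ω => if Q ω then w i ω * (w (κ ω) ω)⁻¹ else 0
  have hz : ∀ i, B.RVT (z i) := fun i => ite hQ ((hw i).mul hm.inv) zero
  have hz1 : ∀ i ω, ‖z i ω‖ ≤ 1 := by
    intro i ω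
    simp only [z]
    split_ifs with hq
    · rw [norm_mul, norm_inv]
      exact mul_inv_le_one_of_le₀ (hmax ω i) (norm_nonneg _)
    · simp
  have hzs : ∀ ω, Q ω → ∑ i, z i ω = (∑ i, w i ω) * (w (κ ω) ω)⁻¹ := by
    intro ω hq
    simp only [z, if_pos hq, Finset.sum_mul]
  have hzs' : ∀ ω, ¬ Q ω → ∑ i, z i ω = 0 := by
    intro ω hq
    simp only [z, if_neg hq, Finset.sum_const_zero]
  have hy : B.RVT (fun ω => ∑ i, z i ω) := by
    refine of_res hM (fun ω => um_sum_le _ _ zero_le_one fun i _ => hz1 i ω) ?_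
      fun n hn => res_sum hz hz1 hn
    intro ω
    by_cases hq : Q ω
    · right
      rw [hzs ω hq, norm_mul, norm_inv, ← div_eq_mul_inv, le_div_iff₀ (norm_pos_iff.2 hq.2)]
      exact h ω hq.1 _
    · left; exact hzs' ω hq
  have := hy.mul hm
  convert this using 2 with ω
  by_cases hq : Q ω
  · rw [hzs ω hq, if_pos hq.1, mul_assoc, inv_mul_cancel₀ hq.2, mul_one]
  · rw [hzs' ω hq, zero_mul]
    split_ifs with hp
    · have h0 : w (κ ω) ω = 0 := by
        by_contra h0; exact hq ⟨hp, h0⟩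
      refine Finset.sum_eq_zero fun i _ => ?_
      have := hmax ω i
      rw [h0, norm_zero] at this
      exact norm_le_zero_iff.1 this
    · rfl

/-- testing smallness of sums -/
lemma test {ι : Type*} [Fintype ι] {w : ι → (ω : B.Ω) → ℚ_[B.pr ω]} (hw : ∀ i, B.RVT (w i))
    {W : (ω : B.Ω) → ℚ_[B.pr ω]} (hW : B.RVT W)
    {P : B.Ω → Prop} (hP : B.TameT P) {N : ℕ} (hN : N ≠ 0)
    (h : ∀ ω, P ω → ∀ i, ‖(N : ℚ_[B.pr ω])‖ * ‖w i ω‖ ≤ ‖W ω‖) :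
    B.TameT (fun ω => P ω ∧ ‖∑ j, w j ω‖ < ‖W ω‖) := by
  classical
  let Q : B.Ω → Prop := fun ω => P ω ∧ W ω ≠ 0
  have hQ : B.TameT Q := hP.and hW.eq_zero.not
  let z : ι → (ω : B.Ω) → ℚ_[B.pr ω] := fun i ω => if Q ω then N * w i ω * (W ω)⁻¹ else 0
  have hz : ∀ i, B.RVT (z i) := fun i => ite hQ (((nat N).mul (hw i)).mul hW.inv) zero
  have hz1 : ∀ i ω, ‖z i ω‖ ≤ 1 := by
    intro i ω
    simp only [z]
    split_ifs with hq
    · rw [norm_mul, norm_inv, norm_mul]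
      exact mul_inv_le_one_of_le₀ (h ω hq.1 i) (norm_nonneg _)
    · simp
  have := hQ.and ((res_sum hz hz1 hN).map (fun x => x = 0))
  convert this using 2 with ω
  by_cases hq : Q ω
  · have e : ∑ i, z i ω = N * (∑ i, w i ω) * (W ω)⁻¹ := by
      simp only [z, if_pos hq, Finset.sum_mul, Finset.mul_sum]
    rw [res_eq_zero_iff hN (um_sum_le _ _ zero_le_one fun i _ => hz1 i ω), e, norm_mul, norm_mul,
      norm_inv, ← div_eq_mul_inv, div_lt_iff₀ (norm_pos_iff.2 hq.2),
      mul_lt_mul_iff_right₀ (nat_norm_pos hN)]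
    simp [hq, hq.1]
  · constructor
    · rintro ⟨h1, h2⟩
      exact absurd ⟨h1, fun h0 => by
        rw [h0, norm_zero] at h2; exact absurd h2 (not_lt.2 (norm_nonneg _))⟩ hq
    · rintro ⟨h1, -⟩; exact absurd h1 hq

end RVT
end RV
end Base
end LSZ

/-! ### Part 4 -/
namespace LSZ
namespace Base

section Change

/-- pull back a base along a map, with a new label -/
abbrev lift (B : Base) {X : Type} (π : X → B.Ω) {S' : Type} (s' : X → S') : Base where
  Ω := X
  pr := fun x => B.pr (π x)
  I := B.I
  u := fun i x => B.u i (π x)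
  S := S'
  s := s'

abbrev sub (B : Base) (P : B.Ω → Prop) : Base :=
  B.lift (X := {ω // P ω}) Subtype.val (fun x => B.s x.1)

/-- add a discrete label -/
abbrev withLabel (B : Base) (T : Type) : Base :=
  B.lift (X := B.Ω × T) Prod.fst (fun x => (B.s x.1, x.2))

/-- use only some of the coordinates -/
abbrev restrict (B : Base) (E : Set B.I) : Base where
  Ω := B.Ω
  pr := B.pr
  I := E
  u := fun i => B.u i
  S := B.S
  s := B.s

variable {B : Base}

lemma Basic.elim {ψ : B.Ω → ℤ} (h : B.Basic ψ) :
    (∃ i k, k ≠ 0 ∧ ψ = fun ω => (LSZ.acr k (B.u i ω) : ℤ)) ∨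
    (∃ l k, l ∈ B.Aff ∧ k ≠ 0 ∧ ψ = fun ω => l ω % (k : ℕ)) ∨
    (∃ l, l ∈ B.Aff ∧ ψ = fun ω => if 0 ≤ l ω then 1 else 0) := by
  cases h with
  | acr i k hk => exact Or.inl ⟨i, k, hk, rfl⟩
  | mod l hl k hk => exact Or.inr (Or.inl ⟨l, k, hl, hk, rfl⟩)
  | sgn l hl => exact Or.inr (Or.inr ⟨l, hl, rfl⟩)

lemma aff_lift {X : Type} (π : X → B.Ω) {S' : Type} (s' : X → S') (l : X → ℤ)
    (hl : l ∈ (B.lift π s').Aff) : ∃ l' ∈ B.Aff, l = fun x => l' (π x) := by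
  refine AddSubgroup.closure_induction (p := fun l _ => ∃ l' ∈ B.Aff, l = fun x => l' (π x))
    ?_ ?_ ?_ ?_ hl
  · rintro l (rfl | ⟨i, rfl⟩)
    · exact ⟨_, Aff_const 1, rfl⟩
    · exact ⟨B.V i, Aff_V (B := B) i, rfl⟩
  · exact ⟨0, B.Aff.zero_mem, rfl⟩
  · rintro _ _ _ _ ⟨a, ha, rfl⟩ ⟨b, hb, rfl⟩
    exact ⟨a + b, B.Aff.add_mem ha hb, rfl⟩
  · rintro _ _ ⟨a, ha, rfl⟩
    exact ⟨-a, B.Aff.neg_mem ha, rfl⟩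

lemma basic_lift {X : Type} (π : X → B.Ω) {S' : Type} (s' : X → S') (ψ : X → ℤ)
    (hψ : (B.lift π s').Basic ψ) : ∃ ψ', B.Basic ψ' ∧ ψ = fun x => ψ' (π x) := by
  rcases hψ.elim with ⟨i, k, hk, rfl⟩ | ⟨l, k, hl, hk, rfl⟩ | ⟨l, hl, rfl⟩
  · exact ⟨_, Basic.acr (B := B) i k hk, rfl⟩
  · obtain ⟨l', hl', rfl⟩ := aff_lift π s' l hl
    exact ⟨_, Basic.mod l' hl' k hk, rfl⟩
  · obtain ⟨l', hl', rfl⟩ := aff_lift π s' l hl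
    exact ⟨_, Basic.sgn l' hl', rfl⟩

lemma TameT.lift_data {X : Type} {π : X → B.Ω} {S' : Type} {s' : X → S'} {T : Type*} {f : X → T}
    (hf : (B.lift π s').TameT f) : ∃ (D : Type) (g : B.Ω → D), B.TameT g ∧
      ∀ x x', g (π x) = g (π x') → s' x = s' x' → f x = f x' := by
  obtain ⟨F, hF, hb, h⟩ := hf
  have hex : ∀ ψ : F, ∃ ψ', B.Basic ψ' ∧ ψ.1 = fun x => ψ' (π x) :=
    fun ψ => basic_lift π s' ψ.1 (hb _ ψ.2)
  choose ψ' h1 h2 using hex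
  have : Finite F := hF
  refine ⟨_, _, TameT.pr.prod (TameT.pi fun i => TameT.basic (h1 i)), ?_⟩
  intro x x' hx hs
  simp only [Prod.mk.injEq] at hx
  refine h x x' ⟨hx.1, hs, fun ψ hψ => ?_⟩
  have e := congrFun hx.2 ⟨ψ, hψ⟩
  have e2 := h2 ⟨ψ, hψ⟩
  simp only at e2
  rw [e2]; exact e

lemma TameT.curry {X : Type} {T : Type*} {f : B.Ω × X → T} (hf : (B.withLabel X).TameT f) :
    B.TameT (fun ω t => f (ω, t)) := by
  obtain ⟨D, g, hg, h⟩ := TameT.lift_data hf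
  refine (hg.prod TameT.label).det fun ω ω' e => ?_
  simp only [Prod.mk.injEq] at e
  funext t
  exact h (ω, t) (ω', t) e.1 (by simp [e.2])

lemma TameT.extend {P : B.Ω → Prop} [DecidablePred P] (hP : B.TameT P) {T : Type*}
    {f : {ω // P ω} → T} (hf : (B.sub P).TameT f) (t : T) :
    B.TameT (fun ω => if h : P ω then f ⟨ω, h⟩ else t) := by
  obtain ⟨D, g, hg, h⟩ := TameT.lift_data hf
  refine (hP.prod (hg.prod TameT.label)).det fun ω ω' e => ?_
  simp only [Prod.mk.injEq] at e
  by_cases h1 : P ω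
  · have h2 : P ω' := e.1 ▸ h1
    simp only [dif_pos h1, dif_pos h2]
    exact h ⟨ω, h1⟩ ⟨ω', h2⟩ e.2.1 e.2.2
  · have h2 : ¬ P ω' := e.1 ▸ h1
    simp only [dif_neg h1, dif_neg h2]

lemma TameZ.extend {P : B.Ω → Prop} [DecidablePred P] (hP : B.TameT P)
    {f : {ω // P ω} → ℤ} (hf : (B.sub P).TameZ f) :
    B.TameZ (fun ω => if h : P ω then f ⟨ω, h⟩ else 0) := by
  obtain ⟨n, κ, l, D, hD, hκ, hl, h⟩ := hf
  choose l' h1 h2 using fun k => aff_lift _ _ _ (hl k)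
  have hκ' := TameT.extend hP (hκ.map some) none
  refine TameZ.mk' _ (fun k : Option (Fin n) => k.elim 0 l') D hD hκ' ?_ ?_
  · rintro (_ | k)
    · exact B.Aff.zero_mem
    · exact h1 k
  · intro ω
    by_cases hp : P ω
    · simp only [dif_pos hp, Option.elim]
      rw [h ⟨ω, hp⟩, h2]
    · simp [hp]

lemma RVT.extend {P : B.Ω → Prop} [DecidablePred P] (hP : B.TameT P)
    {w : (ω : {ω // P ω}) → ℚ_[B.pr ω]} (hw : (B.sub P).RVT w) :
    B.RVT (fun ω => if h : P ω then w ⟨ω, h⟩ else 0) := by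
  constructor
  · have := TameZ.extend hP hw.1
    convert this using 2 with ω
    beta_reduce
    split_ifs
    · rfl
    · exact Padic.valuation_zero
  · intro k hk
    have := TameT.extend hP (hw.2 k hk) 0
    convert this using 2 with ω
    beta_reduce
    split_ifs
    · rfl
    · exact acr_zero hk

section comp
variable {B₁ B₂ : Base} (φ : B₁.Ω → B₂.Ω)

lemma aff_comp (hu : ∀ i, B₁.TameZ (fun ω => B₂.V i (φ ω))) (l : B₂.Ω → ℤ) (hl : l ∈ B₂.Aff) :
    B₁.TameZ (fun ω => l (φ ω)) := by
  refine AddSubgroup.closure_induction (p := fun l _ => B₁.TameZ (fun ω => l (φ ω)))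
    ?_ ?_ ?_ ?_ hl
  · rintro l (rfl | ⟨i, rfl⟩)
    · exact TameZ.const 1
    · exact hu i
  · exact TameZ.const 0
  · intro a b _ _ ha hb
    exact ha.add hb
  · intro a _ ha
    exact ha.neg

lemma TameT.comp (hpr : B₁.TameT (fun ω => B₂.pr (φ ω))) (hs : B₁.TameT (fun ω => B₂.s (φ ω)))
    (hu : ∀ i, B₁.TameZ (fun ω => B₂.V i (φ ω)))
    (ha : ∀ i k, k ≠ 0 → B₁.TameT (fun ω => acr k (B₂.u i (φ ω))))
    {T : Type*} {f : B₂.Ω → T} (hf : B₂.TameT f) : B₁.TameT (fun ω => f (φ ω)) := by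
  obtain ⟨F, hF, hb, h⟩ := hf
  have : Finite F := hF
  have key : ∀ ψ : F, B₁.TameT (fun ω => ψ.1 (φ ω)) := by
    rintro ⟨ψ, hψ⟩
    cases hb _ hψ with
    | acr i k hk => exact (ha i k hk).map (fun x => (x : ℤ))
    | mod l hl k hk => exact (aff_comp φ hu l hl).mod k hk
    | sgn l hl =>
      classical
      have := (aff_comp φ hu l hl).nonneg.map (fun p => if p then (1 : ℤ) else 0)
      convert this using 2 with ω
      simp only []
      congr
  refine (hpr.prod (hs.prod (TameT.pi key))).det fun ω ω' e => ?_
  simp only [Prod.mk.injEq] at e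
  exact h _ _ ⟨e.1, e.2.1, fun ψ hψ => congrFun e.2.2 ⟨ψ, hψ⟩⟩

lemma TameZ.comp (hpr : B₁.TameT (fun ω => B₂.pr (φ ω))) (hs : B₁.TameT (fun ω => B₂.s (φ ω)))
    (hu : ∀ i, B₁.TameZ (fun ω => B₂.V i (φ ω)))
    (ha : ∀ i k, k ≠ 0 → B₁.TameT (fun ω => acr k (B₂.u i (φ ω))))
    {f : B₂.Ω → ℤ} (hf : B₂.TameZ f) : B₁.TameZ (fun ω => f (φ ω)) := by
  obtain ⟨n, κ, l, D, hD, hκ, hl, h⟩ := hf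
  have h1 : B₁.TameZ (fun ω => l (κ (φ ω)) (φ ω)) :=
    TameZ.select (TameT.comp φ hpr hs hu ha hκ) (g := fun k ω => l k (φ ω))
      fun k => aff_comp φ hu _ (hl k)
  refine TameZ.of_mul D hD.ne' ?_
  convert h1 using 2 with ω
  exact h _

end comp

lemma TameT.lift {X : Type} (π : X → B.Ω) {S' : Type} (s' : X → S')
    (hs : (B.lift π s').TameT (fun x => B.s (π x))) {T : Type*} {f : B.Ω → T} (hf : B.TameT f) :
    (B.lift π s').TameT (fun x => f (π x)) :=
  TameT.comp (B₁ := B.lift π s') π TameT.pr hs (fun i => TameZ.V (B := B.lift π s') i)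
    (fun i k hk => (RVT.coord (B := B.lift π s') i).2 k hk) hf

lemma TameZ.lift {X : Type} (π : X → B.Ω) {S' : Type} (s' : X → S')
    (hs : (B.lift π s').TameT (fun x => B.s (π x))) {f : B.Ω → ℤ} (hf : B.TameZ f) :
    (B.lift π s').TameZ (fun x => f (π x)) :=
  TameZ.comp (B₁ := B.lift π s') π TameT.pr hs (fun i => TameZ.V (B := B.lift π s') i)
    (fun i k hk => (RVT.coord (B := B.lift π s') i).2 k hk) hf

lemma RVT.sub {P : B.Ω → Prop} {w : (ω : B.Ω) → ℚ_[B.pr ω]} (hw : B.RVT w) :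
    (B.sub P).RVT (fun ω => w ω.1) :=
  ⟨TameZ.lift _ _ (TameT.label (B := B.sub P)) hw.1,
   fun k hk => TameT.lift _ _ (TameT.label (B := B.sub P)) (hw.2 k hk)⟩

lemma RVT.withLabel {X : Type} {w : (ω : B.Ω) → ℚ_[B.pr ω]} (hw : B.RVT w) :
    (B.withLabel X).RVT (fun ω => w ω.1) :=
  ⟨TameZ.lift _ _ ((TameT.label (B := B.withLabel X)).map Prod.fst) hw.1,
   fun k hk => TameT.lift _ _ ((TameT.label (B := B.withLabel X)).map Prod.fst) (hw.2 k hk)⟩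

lemma TameT.sub {P : B.Ω → Prop} {T : Type*} {f : B.Ω → T} (hf : B.TameT f) :
    (B.sub P).TameT (fun ω => f ω.1) := TameT.lift _ _ (TameT.label (B := B.sub P)) hf

lemma TameT.withLabel {X : Type} {T : Type*} {f : B.Ω → T} (hf : B.TameT f) :
    (B.withLabel X).TameT (fun ω => f ω.1) :=
  TameT.lift _ _ ((TameT.label (B := B.withLabel X)).map Prod.fst) hf

lemma TameZ.withLabel {X : Type} {f : B.Ω → ℤ} (hf : B.TameZ f) :
    (B.withLabel X).TameZ (fun ω => f ω.1) :=
  TameZ.lift _ _ ((TameT.label (B := B.withLabel X)).map Prod.fst) hf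

lemma aff_restrict_mono {E E' : Set B.I} (h : E ⊆ E') {l : B.Ω → ℤ}
    (hl : l ∈ (B.restrict E).Aff) : l ∈ (B.restrict E').Aff := by
  refine AddSubgroup.closure_mono ?_ hl
  rintro l (rfl | ⟨i, rfl⟩)
  · exact Or.inl rfl
  · exact Or.inr ⟨⟨i.1, h i.2⟩, rfl⟩

lemma basic_restrict_mono {E E' : Set B.I} (h : E ⊆ E') {ψ : B.Ω → ℤ}
    (hψ : (B.restrict E).Basic ψ) : (B.restrict E').Basic ψ := by
  rcases hψ.elim with ⟨i, k, hk, rfl⟩ | ⟨l, k, hl, hk, rfl⟩ | ⟨l, hl, rfl⟩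
  · exact Basic.acr (B := B.restrict E') ⟨i.1, h i.2⟩ k hk
  · exact Basic.mod (B := B.restrict E') l (aff_restrict_mono h hl) k hk
  · exact Basic.sgn (B := B.restrict E') l (aff_restrict_mono h hl)

lemma aff_restrict {l : B.Ω → ℤ} (hl : l ∈ B.Aff) :
    ∃ E : Set B.I, E.Finite ∧ l ∈ (B.restrict E).Aff := by
  refine AddSubgroup.closure_induction
    (p := fun (l : B.Ω → ℤ) _ => ∃ E : Set B.I, E.Finite ∧ l ∈ (B.restrict E).Aff) ?_ ?_ ?_ ?_ hl
  · rintro l (rfl | ⟨i, rfl⟩)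
    · exact ⟨∅, Set.finite_empty, Aff_const _⟩
    · exact ⟨{i}, Set.finite_singleton _, Aff_V (B := B.restrict {i}) ⟨i, rfl⟩⟩
  · exact ⟨∅, Set.finite_empty, AddSubgroup.zero_mem _⟩
  · rintro _ _ _ _ ⟨a, ha, ha'⟩ ⟨b, hb, hb'⟩
    exact ⟨a ∪ b, ha.union hb, AddSubgroup.add_mem _
      (aff_restrict_mono Set.subset_union_left ha') (aff_restrict_mono Set.subset_union_right hb')⟩
  · rintro _ _ ⟨a, ha, ha'⟩
    exact ⟨a, ha, AddSubgroup.neg_mem _ ha'⟩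

lemma basic_restrict {l : B.Ω → ℤ} (hl : B.Basic l) :
    ∃ E : Set B.I, E.Finite ∧ (B.restrict E).Basic l := by
  cases hl with
  | acr i k hk =>
    exact ⟨{i}, Set.finite_singleton _, Basic.acr (B := B.restrict {i}) ⟨i, rfl⟩ k hk⟩
  | mod l hl k hk =>
    obtain ⟨E, h1, h2⟩ := aff_restrict hl
    exact ⟨E, h1, Basic.mod (B := B.restrict E) l h2 k hk⟩
  | sgn l hl =>
    obtain ⟨E, h1, h2⟩ := aff_restrict hl
    exact ⟨E, h1, Basic.sgn (B := B.restrict E) l h2⟩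

lemma TameT.restrict_mono {E E' : Set B.I} (h : E ⊆ E') {T : Type*} {f : B.Ω → T}
    (hl : (B.restrict E).TameT f) : (B.restrict E').TameT f := by
  obtain ⟨F, hF, hb, h'⟩ := hl
  exact ⟨F, hF, fun ψ hψ => basic_restrict_mono h (hb ψ hψ), h'⟩

lemma TameZ.restrict_mono {E E' : Set B.I} (h : E ⊆ E') {f : B.Ω → ℤ}
    (hl : (B.restrict E).TameZ f) : (B.restrict E').TameZ f := by
  obtain ⟨n, κ, l, D, hD, hκ, hl, h'⟩ := hl
  exact ⟨n, κ, l, D, hD, TameT.restrict_mono h hκ, fun k => aff_restrict_mono h (hl k), h'⟩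

lemma TameT.restrict {T : Type*} {f : B.Ω → T} (hf : B.TameT f) :
    ∃ E : Set B.I, E.Finite ∧ (B.restrict E).TameT f := by
  obtain ⟨F, hF, hb, h⟩ := hf
  have : Finite F := hF
  choose E h1 h2 using fun ψ : F => basic_restrict (hb ψ.1 ψ.2)
  exact ⟨⋃ ψ, E ψ, Set.finite_iUnion h1, F, hF,
    fun ψ hψ => basic_restrict_mono (Set.subset_iUnion _ ⟨ψ, hψ⟩) (h2 ⟨ψ, hψ⟩), h⟩

lemma TameZ.restrict {f : B.Ω → ℤ} (hf : B.TameZ f) :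
    ∃ E : Set B.I, E.Finite ∧ (B.restrict E).TameZ f := by
  obtain ⟨n, κ, l, D, hD, hκ, hl, h⟩ := hf
  obtain ⟨E, hE, hκ'⟩ := hκ.restrict
  choose E' h1 h2 using fun k => aff_restrict (hl k)
  exact ⟨E ∪ ⋃ k, E' k, hE.union (Set.finite_iUnion h1), n, κ, l, D, hD,
    TameT.restrict_mono Set.subset_union_left hκ',
    fun k => aff_restrict_mono ((Set.subset_iUnion _ k).trans Set.subset_union_right) (h2 k), h⟩

end Change
end Base
end LSZ

/-! ### Part 5 -/
namespace LSZ
open Polynomial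

section NC
variable {p : ℕ} [Fact p.Prime]

lemma taylor_sum {R : Type*} [CommRing R] (f : R[X]) {D : ℕ} (hD : f.natDegree ≤ D) (c s : R) :
    f.eval (c + s) = ∑ i ∈ Finset.range (D + 1), (hasseDeriv i f).eval c * s ^ i := by
  have h : f.eval (c + s) = (taylor c f).eval s := by rw [taylor_eval, add_comm]
  rw [h, eval_eq_sum_range' (n := D + 1) (by rw [natDegree_taylor]; omega)]
  simp only [taylor_coeff]

/-- all Taylor terms at `c` on radius `r` are bounded by `A` -/
def Bd (f : ℚ_[p][X]) (c : ℚ_[p]) (r A : ℝ) : Prop :=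
  ∀ j, ‖(hasseDeriv j f).eval c‖ * r ^ j ≤ A

lemma Bd.nonneg {f : ℚ_[p][X]} {c : ℚ_[p]} {r A : ℝ} (h : Bd f c r A) : 0 ≤ A := by
  have := h 0
  simp at this
  exact (norm_nonneg _).trans this

lemma hasse_hasse_eval (f : ℚ_[p][X]) (i j : ℕ) (c : ℚ_[p]) :
    (hasseDeriv j (hasseDeriv i f)).eval c = ((j + i).choose j : ℚ_[p]) * (hasseDeriv (j + i) f).eval c := by
  have := congrArg (fun L => (L f).eval c) (hasseDeriv_comp (R := ℚ_[p]) j i)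
  simpa using this

lemma norm_hasse_hasse_le (f : ℚ_[p][X]) (i j : ℕ) (c : ℚ_[p]) :
    ‖(hasseDeriv j (hasseDeriv i f)).eval c‖ ≤ ‖(hasseDeriv (j + i) f).eval c‖ := by
  rw [hasse_hasse_eval, norm_mul]
  exact mul_le_of_le_one_left (norm_nonneg _) (nat_norm_le _)

lemma Bd.hasse {f : ℚ_[p][X]} {c : ℚ_[p]} {r A : ℝ} (hr : 0 < r) (h : Bd f c r A) (i : ℕ) :
    Bd (hasseDeriv i f) c r (A / r ^ i) := by
  intro j
  rw [le_div_iff₀ (pow_pos hr _), mul_assoc, ← pow_add]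
  exact (mul_le_mul_of_nonneg_right (norm_hasse_hasse_le f i j c) (pow_pos hr _).le).trans (h (j + i))

lemma Bd.eval_le {f : ℚ_[p][X]} {c : ℚ_[p]} {r A : ℝ} (h : Bd f c r A)
    {y : ℚ_[p]} (hy : ‖y‖ ≤ r) : ‖f.eval (c + y)‖ ≤ A := by
  rw [taylor_sum f le_rfl]
  refine um_sum_le _ _ h.nonneg fun i _ => ?_
  rw [norm_mul, norm_pow]
  exact (mul_le_mul_of_nonneg_left (pow_le_pow_left₀ (norm_nonneg _) hy i) (norm_nonneg _)).trans (h i)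

lemma Bd.move {f : ℚ_[p][X]} {c : ℚ_[p]} {r A : ℝ} (hr : 0 < r) (h : Bd f c r A)
    {y : ℚ_[p]} (hy : ‖y‖ ≤ r) : Bd f (c + y) r A := by
  intro i
  have := (h.hasse hr i).eval_le hy
  rwa [le_div_iff₀ (pow_pos hr _)] at this

lemma hasse_one_eval (f : ℚ_[p][X]) (c : ℚ_[p]) : (hasseDeriv 1 f).eval c = (derivative f).eval c := by
  rw [hasseDeriv_one]

lemma newton {f : ℚ_[p][X]} {t : ℚ_[p]} {r A : ℝ} (h : Bd f t r A)
    {y : ℚ_[p]} (hy : ‖y‖ ≤ r) :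
    ‖f.eval (t + y) - f.eval t - (derivative f).eval t * y‖ * r ^ 2 ≤ A * ‖y‖ ^ 2 := by
  have hr : 0 ≤ r := (norm_nonneg _).trans hy
  have e : f.eval (t + y) - f.eval t - (derivative f).eval t * y =
      ∑ i ∈ Finset.range f.natDegree, (hasseDeriv (i + 2) f).eval t * y ^ (i + 2) := by
    rw [taylor_sum f (D := f.natDegree + 1) (by omega), Finset.sum_range_succ', Finset.sum_range_succ']
    simp [hasseDeriv_one]
  rcases hr.eq_or_lt with h0 | h0
  · rw [← h0]; simp
    exact mul_nonneg h.nonneg (by positivity)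
  rw [e, ← le_div_iff₀ (pow_pos h0 _)]
  refine um_sum_le _ _ (div_nonneg (mul_nonneg h.nonneg (by positivity)) (by positivity)) fun i _ => ?_
  rw [le_div_iff₀ (pow_pos h0 _), norm_mul, norm_pow, pow_add]
  have h1 := h (i + 2)
  have h2 : ‖y‖ ^ i ≤ r ^ i := pow_le_pow_left₀ (norm_nonneg _) hy i
  rw [pow_add] at h1
  calc ‖(hasseDeriv (i + 2) f).eval t‖ * (‖y‖ ^ i * ‖y‖ ^ 2) * r ^ 2
      = ‖(hasseDeriv (i + 2) f).eval t‖ * r ^ 2 * ‖y‖ ^ 2 * ‖y‖ ^ i := by ring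
    _ ≤ ‖(hasseDeriv (i + 2) f).eval t‖ * r ^ 2 * ‖y‖ ^ 2 * r ^ i := by gcongr
    _ = ‖(hasseDeriv (i + 2) f).eval t‖ * (r ^ i * r ^ 2) * ‖y‖ ^ 2 := by ring
    _ ≤ A * ‖y‖ ^ 2 := by gcongr

/-- dominance of the linear term -/
lemma newton_eq {f : ℚ_[p][X]} {t : ℚ_[p]} {r A : ℝ} (h : Bd f t r A)
    {y : ℚ_[p]} (hy : ‖y‖ ≤ r) (hs : A * ‖y‖ < ‖(derivative f).eval t‖ * r ^ 2) :
    ‖f.eval (t + y) - f.eval t‖ = ‖(derivative f).eval t‖ * ‖y‖ := by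
  by_cases hy0 : y = 0
  · simp [hy0]
  have hyp : 0 < ‖y‖ := norm_pos_iff.2 hy0
  have hr : 0 < r := hyp.trans_le hy
  have h1 := newton h hy
  have h2 : ‖f.eval (t + y) - f.eval t - (derivative f).eval t * y‖ < ‖(derivative f).eval t * y‖ := by
    rw [norm_mul]
    have : A * ‖y‖ ^ 2 < ‖(derivative f).eval t‖ * ‖y‖ * r ^ 2 := by nlinarith
    exact lt_of_mul_lt_mul_right (h1.trans_lt this) (by positivity)
  have h3 := um_dom h2
  rw [norm_mul] at h3
  rw [← h3]; congr 1; ring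

lemma hensel_zero {F : ℤ_[p][X]} (h : ‖F.eval 0‖ < ‖(derivative F).eval 0‖ ^ 2) :
    ∃ z : ℤ_[p], F.eval z = 0 ∧ ‖z‖ < ‖(derivative F).eval 0‖ := by
  have := hensels_lemma (F := F) (a := (0 : ℤ_[p])) (by simpa only [Polynomial.coe_aeval_eq_eval] using h)
  obtain ⟨z, h1, h2, -⟩ := this
  refine ⟨z, by simpa only [Polynomial.coe_aeval_eq_eval] using h1, by simpa only [Polynomial.coe_aeval_eq_eval, sub_zero] using h2⟩

lemma coe_eval_map (F : ℤ_[p][X]) (z : ℤ_[p]) :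
    ((F.eval z : ℤ_[p]) : ℚ_[p]) = (F.map (PadicInt.Coe.ringHom (p := p))).eval (z : ℚ_[p]) := by
  have := Polynomial.eval_map_apply (f := PadicInt.Coe.ringHom (p := p)) (p := F) z
  exact this.symm

lemma henselK {f : ℚ_[p][X]} {t s a : ℚ_[p]} (hs : s ≠ 0) (ha : a ≠ 0) (h : Bd f t ‖s‖ ‖a‖)
    (hh : ‖f.eval t‖ * ‖a‖ < (‖(derivative f).eval t‖ * ‖s‖) ^ 2) :
    ∃ ξ, f.eval ξ = 0 ∧ ‖ξ - t‖ < ‖s‖ ∧ ‖(derivative f).eval t‖ * ‖ξ - t‖ = ‖f.eval t‖ := by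
  have hsp := norm_pos_iff.2 hs
  have hap := norm_pos_iff.2 ha
  set g : ℚ_[p][X] := C a⁻¹ * (taylor t f).comp (C s * X) with hg
  have hgc : ∀ i, ‖g.coeff i‖ ≤ 1 := by
    intro i
    rw [hg, coeff_C_mul, comp_C_mul_X_coeff, taylor_coeff, norm_mul, norm_inv, norm_mul, norm_pow]
    rw [inv_mul_le_iff₀ hap]; simpa using h i
  have hl : g ∈ lifts (PadicInt.Coe.ringHom (p := p)) := by
    rw [lifts_iff_coeff_lifts]
    intro n
    exact ⟨⟨g.coeff n, hgc n⟩, rfl⟩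
  obtain ⟨F, hF⟩ := (mem_lifts g).1 hl
  have hFe : ∀ z : ℤ_[p], ((F.eval z : ℤ_[p]) : ℚ_[p]) = a⁻¹ * f.eval (t + s * z) := by
    intro z
    have : ((F.eval z : ℤ_[p]) : ℚ_[p]) = (F.map (PadicInt.Coe.ringHom (p := p))).eval (z : ℚ_[p]) := by
      exact coe_eval_map _ _
    rw [this, hF, hg, eval_mul, eval_C, eval_comp, taylor_eval]
    simp [add_comm]
  have hFd : (((derivative F).eval 0 : ℤ_[p]) : ℚ_[p]) = a⁻¹ * ((derivative f).eval t * s) := by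
    have : (((derivative F).eval 0 : ℤ_[p]) : ℚ_[p]) =
        ((derivative F).map (PadicInt.Coe.ringHom (p := p))).eval ((0 : ℤ_[p]) : ℚ_[p]) := by
      exact coe_eval_map _ _
    rw [this, ← derivative_map, hF, hg]
    simp [derivative_comp, taylor_apply]
    left; ring
  have hn0 : ‖F.eval 0‖ = ‖a‖⁻¹ * ‖f.eval t‖ := by
    rw [PadicInt.norm_def, hFe]; simp
  have hn1 : ‖(derivative F).eval 0‖ = ‖a‖⁻¹ * (‖(derivative f).eval t‖ * ‖s‖) := by
    rw [PadicInt.norm_def, hFd]; simp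
  obtain ⟨z, hz, hz'⟩ := hensel_zero (F := F) (by
    rw [hn0, hn1, mul_pow, ← div_lt_iff₀' (by positivity)]
    have : ‖a‖⁻¹ * ‖f.eval t‖ / ‖a‖⁻¹ ^ 2 = ‖f.eval t‖ * ‖a‖ := by field_simp
    rw [this]; exact hh)
  rw [hn1] at hz'
  have hz1 : ‖(z : ℚ_[p])‖ = ‖z‖ := (PadicInt.norm_def).symm
  have hd : ‖(derivative f).eval t‖ * ‖s‖ ≤ ‖a‖ := by
    have := h 1; rwa [hasse_one_eval, pow_one] at this
  have hroot : f.eval (t + s * z) = 0 := by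
    have := hFe z
    rw [hz] at this
    simpa [ha] using this.symm
  have hlt : ‖z‖ < 1 := hz'.trans_le (by rw [inv_mul_le_iff₀ hap]; simpa using hd)
  refine ⟨t + s * z, hroot, ?_, ?_⟩
  · rw [add_sub_cancel_left, norm_mul, hz1]
    exact mul_lt_of_lt_one_right hsp hlt
  · have := newton_eq h (y := s * z) (by rw [norm_mul, hz1]; exact mul_le_of_le_one_right hsp.le hlt.le)
      (by
        rw [norm_mul, hz1]
        rw [inv_mul_eq_div, lt_div_iff₀ hap] at hz'
        nlinarith)
    rw [hroot, zero_sub, norm_neg] at this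
    rw [this, add_sub_cancel_left]

/-- exponents in the non-cancellation bound -/
def ncE : ℕ → ℕ
  | 0 => 0
  | m + 1 => 2 + 2 * ncE m

lemma ncE_mono : Monotone ncE := monotone_nat_of_le_succ fun n => by simp only [ncE]; omega

def ncM (D : ℕ) : ℕ := D.factorial ^ ncE D

lemma ncM_ne (D : ℕ) : ncM D ≠ 0 := pow_ne_zero _ (Nat.factorial_ne_zero _)

/-- non-cancellation -/
lemma nc {f : ℚ_[p][X]} {D : ℕ} (hD : f.natDegree ≤ D) {c t : ℚ_[p]}
    (hroot : ∀ i < D, hasseDeriv i f ≠ 0 → ∀ ξ, (hasseDeriv i f).eval ξ = 0 → ‖t - c‖ ≤ ‖t - ξ‖)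
    (j : ℕ) : ‖(ncM D : ℚ_[p])‖ * ‖(hasseDeriv j f).eval c * (t - c) ^ j‖ ≤ ‖f.eval t‖ := by
  by_cases hs : t - c = 0
  · rcases j.eq_zero_or_pos with rfl | hj
    · have : t = c := sub_eq_zero.1 hs
      rw [this]; simp
      exact mul_le_of_le_one_left (norm_nonneg _) (nat_norm_le _)
    · rw [hs, zero_pow hj.ne']; simp
  have hsp := norm_pos_iff.2 hs
  -- maximal term at t
  obtain ⟨i0, hi0, hmax⟩ := Finset.exists_max_image (Finset.range (D + 1))
    (fun i => ‖(hasseDeriv i f).eval t * (t - c) ^ i‖) ⟨0, by simp⟩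
  set a := (hasseDeriv i0 f).eval t * (t - c) ^ i0 with ha
  have hbd : Bd f t ‖t - c‖ ‖a‖ := by
    intro i
    by_cases hi : i ≤ D
    · have := hmax i (by simp; omega)
      rwa [norm_mul, norm_pow] at this
    · have : hasseDeriv i f = 0 := hasseDeriv_eq_zero_of_lt_natDegree _ _ (by omega)
      rw [this]; simp
  have hbdc : Bd f c ‖t - c‖ ‖a‖ := by
    have := hbd.move hsp (y := c - t) (by rw [norm_sub_rev])
    simpa using this
  have step : ∀ i < D, ‖((i + 1 : ℕ) : ℚ_[p])‖ ^ 2 *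
      ‖(hasseDeriv (i + 1) f).eval t * (t - c) ^ (i + 1)‖ ^ 2 ≤
      ‖(hasseDeriv i f).eval t * (t - c) ^ i‖ * ‖a‖ := by
    intro i hi
    by_contra hcon
    push Not at hcon
    have ha0 : a ≠ 0 := by
      intro h0
      have := hmax (i + 1) (by simp; omega)
      rw [h0, norm_zero] at this
      have h1 : (hasseDeriv (i + 1) f).eval t * (t - c) ^ (i + 1) = 0 := norm_le_zero_iff.1 this
      rw [h1, h0] at hcon; simp at hcon
    have hder : (derivative (hasseDeriv i f)).eval t = ((i + 1 : ℕ) : ℚ_[p]) * (hasseDeriv (i + 1) f).eval t := by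
      rw [← hasse_one_eval, hasse_hasse_eval, add_comm 1 i]; simp
    have hA : Bd (hasseDeriv i f) t ‖t - c‖ ‖a / (t - c) ^ i‖ := by
      rw [norm_div, norm_pow]; exact hbd.hasse hsp i
    obtain ⟨ξ, h1, h2, -⟩ := henselK hs (div_ne_zero ha0 (pow_ne_zero i hs)) hA (by
      rw [hder, norm_mul, norm_div, norm_pow, ← mul_div_assoc, div_lt_iff₀ (by positivity)]
      rw [norm_mul ((hasseDeriv i f).eval t) _, norm_mul ((hasseDeriv (i+1) f).eval t) _, norm_pow (t-c) i, norm_pow (t-c) (i+1)] at hcon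
      have e : (‖((i + 1 : ℕ) : ℚ_[p])‖ * ‖(hasseDeriv (i + 1) f).eval t‖ * ‖t - c‖) ^ 2 * ‖t - c‖ ^ i * ‖t - c‖ ^ i =
        ‖((i + 1 : ℕ) : ℚ_[p])‖ ^ 2 * (‖(hasseDeriv (i + 1) f).eval t‖ * ‖t - c‖ ^ (i + 1)) ^ 2 := by ring
      rw [← e] at hcon
      have hp : 0 < ‖t - c‖ ^ i := by positivity
      refine lt_of_mul_lt_mul_right (a := ‖t - c‖ ^ i) ?_ hp.le
      calc _ = ‖(hasseDeriv i f).eval t‖ * ‖t - c‖ ^ i * ‖a‖ := by ring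
        _ < _ := hcon)
    have hne : hasseDeriv i f ≠ 0 := by
      intro h0
      rw [h0] at hder
      simp only [derivative_zero, eval_zero] at hder
      have : ‖((i + 1 : ℕ) : ℚ_[p])‖ ^ 2 * ‖(hasseDeriv (i + 1) f).eval t * (t - c) ^ (i + 1)‖ ^ 2 = 0 := by
        rw [norm_mul, mul_pow, ← mul_assoc, ← mul_pow, ← norm_mul, ← hder]; simp
      rw [this] at hcon
      exact absurd hcon (not_lt.2 (by positivity))
    have := hroot i hi hne ξ h1
    rw [norm_sub_rev ξ t] at h2
    linarith
  have hfac : ∀ i < D, ‖(D.factorial : ℚ_[p])‖ ≤ ‖((i + 1 : ℕ) : ℚ_[p])‖ := fun i hi =>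
    nat_norm_le_of_dvd (Nat.dvd_factorial (by omega) (by omega))
  have main : ∀ m ≤ i0, ‖(D.factorial : ℚ_[p])‖ ^ ncE m * ‖a‖ ≤
      ‖(hasseDeriv (i0 - m) f).eval t * (t - c) ^ (i0 - m)‖ := by
    intro m
    induction m with
    | zero => intro _; simp [ncE, ha]
    | succ m ih =>
      intro hm
      have ih' := ih (by omega)
      have hiD : i0 - (m + 1) < D := by simp at hi0; omega
      have st := step _ hiD
      rw [show i0 - (m + 1) + 1 = i0 - m by omega] at st
      rcases (norm_nonneg a).eq_or_lt with h0 | h0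
      · rw [← h0, mul_zero]; exact norm_nonneg _
      have hf := hfac _ hiD
      rw [show i0 - (m + 1) + 1 = i0 - m by omega] at hf
      refine le_of_mul_le_mul_right (a := ‖a‖) ?_ h0
      refine le_trans ?_ st
      have e : ‖(D.factorial : ℚ_[p])‖ ^ ncE (m + 1) * ‖a‖ * ‖a‖ =
        ‖(D.factorial : ℚ_[p])‖ ^ 2 * (‖(D.factorial : ℚ_[p])‖ ^ ncE m * ‖a‖) ^ 2 := by
        simp only [ncE]; ring
      rw [e]
      gcongr
  have fin := main i0 le_rfl
  rw [Nat.sub_self] at fin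
  simp only [hasseDeriv_zero', pow_zero, mul_one] at fin
  refine le_trans ?_ fin
  rw [ncM, Nat.cast_pow, norm_pow, norm_mul, norm_pow]
  have hi0' : i0 ≤ D := by simp at hi0; omega
  have := pow_le_pow_of_le_one (norm_nonneg (D.factorial : ℚ_[p])) (nat_norm_le _) (ncE_mono hi0')
  exact mul_le_mul this (hbdc j) (by positivity) (by positivity)

end NC
end LSZ

/-! ### Part 6 -/
namespace LSZ
open Polynomial

section Alg

lemma hasse_map {R S : Type*} [CommRing R] [CommRing S] (φ : R →+* S) (i : ℕ) (f : R[X]) :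
    hasseDeriv i (f.map φ) = (hasseDeriv i f).map φ := by
  ext n
  simp [hasseDeriv_coeff]

lemma pseudo_div {R : Type*} [CommRing R] (h : R[X]) (hk : 1 ≤ h.natDegree) (g : R[X]) :
    ∃ (e : ℕ) (q r : R[X]), C h.leadingCoeff ^ e * g = q * h + r ∧ r.natDegree < h.natDegree := by
  induction hn : g.natDegree using Nat.strong_induction_on generalizing g with
  | _ n ih =>
    by_cases hlt : g.natDegree < h.natDegree
    · exact ⟨0, 0, g, by simp, hlt⟩
    push Not at hlt
    set g' := C h.leadingCoeff * g - C g.leadingCoeff * X ^ (n - h.natDegree) * h with hg'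
    have h1 : g'.natDegree ≤ n := by
      refine (natDegree_sub_le _ _).trans (max_le ?_ ?_)
      · exact (natDegree_C_mul_le _ _).trans hn.le
      · refine (natDegree_mul_le).trans ?_
        have := natDegree_C_mul_X_pow_le g.leadingCoeff (n - h.natDegree)
        omega
    have h2 : g'.coeff n = 0 := by
      rw [hg', coeff_sub, coeff_C_mul, mul_assoc, coeff_C_mul]
      have : (X ^ (n - h.natDegree) * h).coeff n = h.leadingCoeff := by
        have e : n = h.natDegree + (n - h.natDegree) := by omega
        conv_lhs => rw [e]
        rw [show h.natDegree + (n - h.natDegree) - h.natDegree = n - h.natDegree by omega]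
        rw [coeff_X_pow_mul]
        rfl
      rw [this, ← hn]
      simp only [leadingCoeff]; ring
    have h3 : g'.natDegree < n := by
      refine lt_of_le_of_ne h1 fun e => ?_
      have : g'.leadingCoeff = 0 := by rw [leadingCoeff, e, h2]
      rw [leadingCoeff_eq_zero] at this
      rw [this] at e; simp at e; omega
    obtain ⟨e, q, r, h4, h5⟩ := ih _ h3 g' rfl
    refine ⟨e + 1, q + C h.leadingCoeff ^ e * (C g.leadingCoeff * X ^ (n - h.natDegree)), r, ?_, h5⟩
    rw [pow_succ]
    have : C h.leadingCoeff * g = g' + C g.leadingCoeff * X ^ (n - h.natDegree) * h := by rw [hg']; ring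
    rw [mul_assoc, this, mul_add, h4]; ring

lemma two_max {p : ℕ} [Fact p.Prime] {k : ℕ} (x : ℕ → ℚ_[p]) (h0 : ∑ i ∈ Finset.range (k + 1), x i = 0)
    (hk : x k ≠ 0) : ∃ i j, i < j ∧ j ≤ k ∧ x i ≠ 0 ∧ x j ≠ 0 ∧ ‖x i‖ = ‖x j‖ := by
  obtain ⟨i0, hi0, hmax⟩ := Finset.exists_max_image (Finset.range (k + 1)) (fun i => ‖x i‖) ⟨0, by simp⟩
  have hne : x i0 ≠ 0 := by
    rw [← norm_pos_iff]
    exact (norm_pos_iff.2 hk).trans_le (hmax k (by simp))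
  have : ∃ j ∈ Finset.range (k + 1), j ≠ i0 ∧ ‖x j‖ = ‖x i0‖ := by
    by_contra hcon
    push Not at hcon
    rw [← Finset.add_sum_erase _ _ hi0] at h0
    have h1 : ‖∑ i ∈ (Finset.range (k + 1)).erase i0, x i‖ < ‖x i0‖ := by
      refine um_sum_lt _ _ (norm_pos_iff.2 hne) fun i hi => ?_
      rw [Finset.mem_erase] at hi
      exact lt_of_le_of_ne (hmax i hi.2) (hcon i hi.2 hi.1)
    have := um_dom h1
    rw [h0, norm_zero] at this
    exact hne (norm_eq_zero.1 this.symm)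
  obtain ⟨j, hj, hne', he⟩ := this
  have hj0 : x j ≠ 0 := by rw [← norm_pos_iff, he]; exact norm_pos_iff.2 hne
  simp only [Finset.mem_range] at hi0 hj
  rcases lt_or_gt_of_ne hne' with hl | hl
  · exact ⟨j, i0, hl, by omega, hj0, hne, he⟩
  · exact ⟨i0, j, hl, by omega, hne, hj0, he.symm⟩

end Alg

section Pt
variable {p : ℕ} [Fact p.Prime]

/-- the modulus for linearization -/
def linM (k : ℕ) : ℕ := ncM k * k.factorial

lemma linM_ne (k : ℕ) : linM k ≠ 0 := mul_ne_zero (ncM_ne k) (Nat.factorial_ne_zero k)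

lemma lin {f : ℚ_[p][X]} {k : ℕ} (hk : f.natDegree = k) (hk1 : 1 ≤ k) {c s : ℚ_[p]} (hs : s ≠ 0)
    (hroot : ∀ i, 1 ≤ i → hasseDeriv i f ≠ 0 → ∀ ξ, (hasseDeriv i f).eval ξ = 0 → ‖s‖ ≤ ‖c + s - ξ‖) :
    ∃ A : ℚ_[p], A ≠ 0 ∧ (∀ j, 1 ≤ j → ‖(hasseDeriv j f).eval c * s ^ j‖ ≤ ‖A‖) ∧
      (∃ j, 1 ≤ j ∧ j ≤ k ∧ A = (hasseDeriv j f).eval c * s ^ j) ∧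
      ‖(linM k : ℚ_[p])‖ * ‖A‖ ≤ ‖(derivative f).eval (c + s) * s‖ := by
  obtain ⟨i0, hi0, hmax⟩ := Finset.exists_max_image (Finset.Icc 1 k)
    (fun i => ‖(hasseDeriv i f).eval c * s ^ i‖) ⟨k, by simp [hk1]⟩
  have hf0 : f ≠ 0 := by rintro rfl; simp at hk; omega
  have hkk : (hasseDeriv k f).eval c * s ^ k ≠ 0 := by
    refine mul_ne_zero ?_ (pow_ne_zero _ hs)
    have : hasseDeriv k f = C f.leadingCoeff := by
      rw [← hk, hasseDeriv_natDegree_eq_C]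
    rw [this, eval_C]; exact leadingCoeff_ne_zero.2 hf0
  simp only [Finset.mem_Icc] at hi0 hmax
  refine ⟨(hasseDeriv i0 f).eval c * s ^ i0, ?_, ?_, ⟨i0, hi0.1, hi0.2, rfl⟩, ?_⟩
  · rw [← norm_pos_iff]
    exact (norm_pos_iff.2 hkk).trans_le (hmax k ⟨hk1, le_rfl⟩)
  · intro j hj
    by_cases hjk : j ≤ k
    · exact hmax j ⟨hj, hjk⟩
    · rw [hasseDeriv_eq_zero_of_lt_natDegree _ _ (by omega)]; simp; positivity
  · have hd : ∀ i (x : ℚ_[p]), (hasseDeriv i (derivative f)).eval x = ((i + 1 : ℕ) : ℚ_[p]) * (hasseDeriv (i + 1) f).eval x := by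
      intro i x
      rw [← hasseDeriv_one, hasse_hasse_eval]
      congr 2; rw [Nat.choose_symm_add]; simp
    have := nc (f := derivative f) (D := k) ((natDegree_derivative_le f).trans (by omega)) (c := c) (t := c + s)
      (by
        intro i _ hne ξ hξ
        rw [add_sub_cancel_left]
        rw [hd] at hξ
        refine hroot (i + 1) (by omega) ?_ ξ ?_
        · intro h0
          apply hne
          apply Polynomial.funext
          intro x
          rw [hd, h0]; simp
        · exact (mul_eq_zero.1 hξ).resolve_left (by exact_mod_cast (Nat.succ_ne_zero i)))
      (i0 - 1)
    rw [hd, add_sub_cancel_left, show i0 - 1 + 1 = i0 by omega] at this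
    have hfac : ‖(k.factorial : ℚ_[p])‖ ≤ ‖(i0 : ℚ_[p])‖ :=
      nat_norm_le_of_dvd (Nat.dvd_factorial (by omega) (by omega))
    have e : s ^ i0 = s ^ (i0 - 1) * s := by rw [← pow_succ]; congr 1; omega
    rw [e, linM]
    push_cast
    simp only [norm_mul] at this ⊢
    calc ‖(ncM k : ℚ_[p])‖ * ‖(k.factorial : ℚ_[p])‖ * (‖(hasseDeriv i0 f).eval c‖ * (‖s ^ (i0 - 1)‖ * ‖s‖))
        ≤ ‖(ncM k : ℚ_[p])‖ * ‖(i0 : ℚ_[p])‖ * (‖(hasseDeriv i0 f).eval c‖ * (‖s ^ (i0 - 1)‖ * ‖s‖)) := by gcongr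
      _ = ‖(ncM k : ℚ_[p])‖ * (‖(i0 : ℚ_[p])‖ * ‖(hasseDeriv i0 f).eval c‖ * ‖s ^ (i0 - 1)‖) * ‖s‖ := by ring
      _ ≤ _ := by gcongr

/-- if `‖f_0‖ ≤` the others, everything is bounded -/
lemma lin_bd {f : ℚ_[p][X]} {c s A : ℚ_[p]} (hA : ∀ j, 1 ≤ j → ‖(hasseDeriv j f).eval c * s ^ j‖ ≤ ‖A‖)
    (h0 : ‖f.eval c‖ ≤ ‖A‖) : Bd f c ‖s‖ ‖A‖ := by
  intro j
  rcases j.eq_zero_or_pos with rfl | hj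
  · simpa using h0
  · have := hA j hj
    rwa [norm_mul, norm_pow] at this

/-- a root near `c+s` bounds `f c` -/
lemma lin_zero {f : ℚ_[p][X]} {c s A : ℚ_[p]} (hA : ∀ j, 1 ≤ j → ‖(hasseDeriv j f).eval c * s ^ j‖ ≤ ‖A‖)
    {s' : ℚ_[p]} (hs' : ‖s'‖ = ‖s‖) (hξ : f.eval (c + s') = 0) : ‖f.eval c‖ ≤ ‖A‖ := by
  rw [taylor_sum f le_rfl, Finset.sum_range_succ'] at hξ
  simp only [hasseDeriv_zero', pow_zero, mul_one] at hξ
  rw [← norm_neg, ← eq_neg_of_add_eq_zero_left hξ]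
  refine um_sum_le _ _ (norm_nonneg _) fun i _ => ?_
  have := hA (i + 1) (by omega)
  rwa [norm_mul, norm_pow, ← hs', ← norm_pow, ← norm_mul] at this

/-- key estimate around a point `c + s` which is near a root `c + s'` -/
lemma lin_close {f : ℚ_[p][X]} {k : ℕ} (hk : f.natDegree = k) (hk1 : 1 ≤ k) {c s s' : ℚ_[p]} (hs : s ≠ 0)
    (hroot : ∀ i, 1 ≤ i → hasseDeriv i f ≠ 0 → ∀ ξ, (hasseDeriv i f).eval ξ = 0 → ‖s‖ ≤ ‖c + s - ξ‖)
    (hξ : f.eval (c + s') = 0) (hcl : ‖s - s'‖ < ‖(linM k : ℚ_[p])‖ * ‖s‖) :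
    (derivative f).eval (c + s) ≠ 0 ∧ ‖f.eval (c + s)‖ = ‖(derivative f).eval (c + s)‖ * ‖s' - s‖ := by
  obtain ⟨A, hA0, hA, -, hl⟩ := lin hk hk1 hs hroot
  have hsp := norm_pos_iff.2 hs
  have hAp := norm_pos_iff.2 hA0
  have hcl' : ‖s - s'‖ < ‖s‖ := hcl.trans_le (mul_le_of_le_one_left hsp.le (nat_norm_le _))
  have hss : ‖s'‖ = ‖s‖ := norm_eq_of_close hcl'
  have hb := (lin_bd hA (lin_zero hA hss hξ)).move hsp (y := s) le_rfl
  have hd : (derivative f).eval (c + s) ≠ 0 := by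
    intro h0
    rw [h0, zero_mul, norm_zero] at hl
    exact absurd hl (not_le.2 (mul_pos (nat_norm_pos (linM_ne k)) hAp))
  refine ⟨hd, ?_⟩
  have := newton_eq hb (y := s' - s) (by rw [norm_sub_rev]; exact hcl'.le) (by
    rw [norm_sub_rev]
    rw [norm_mul] at hl
    calc ‖A‖ * ‖s - s'‖ < ‖A‖ * (‖(linM k : ℚ_[p])‖ * ‖s‖) := by gcongr
      _ = (‖(linM k : ℚ_[p])‖ * ‖A‖) * ‖s‖ := by ring
      _ ≤ (‖(derivative f).eval (c + s)‖ * ‖s‖) * ‖s‖ := by gcongr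
      _ = _ := by ring)
  rw [← this, show c + s + (s' - s) = c + s' by ring, hξ, zero_sub, norm_neg]

/-- existence of a root near `c+s` -/
lemma lin_exists {f : ℚ_[p][X]} {k n : ℕ} (hk : f.natDegree = k) (hk1 : 1 ≤ k) {c s : ℚ_[p]} (hs : s ≠ 0)
    (hroot : ∀ i, 1 ≤ i → hasseDeriv i f ≠ 0 → ∀ ξ, (hasseDeriv i f).eval ξ = 0 → ‖s‖ ≤ ‖c + s - ξ‖)
    (hn : linM k ∣ n)
    (h0 : ∃ j, 1 ≤ j ∧ ‖f.eval c‖ ≤ ‖(hasseDeriv j f).eval c * s ^ j‖)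
    (h1 : ‖f.eval (c + s)‖ < ‖(n : ℚ_[p])‖ * ‖(derivative f).eval (c + s) * s‖) :
    ∃ s', f.eval (c + s') = 0 ∧ ‖s - s'‖ < ‖(n : ℚ_[p])‖ * ‖s‖ := by
  obtain ⟨A, hA0, hA, -, hl⟩ := lin hk hk1 hs hroot
  obtain ⟨j, hj, hj'⟩ := h0
  have hsp := norm_pos_iff.2 hs
  have hAp := norm_pos_iff.2 hA0
  have hb := (lin_bd hA (hj'.trans (hA j hj))).move hsp (y := s) le_rfl
  have hnM : ‖(n : ℚ_[p])‖ ≤ ‖(linM k : ℚ_[p])‖ := nat_norm_le_of_dvd hn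
  rw [norm_mul] at h1 hl
  obtain ⟨ξ, h2, h3, h4⟩ := henselK hs hA0 hb (by
    calc ‖f.eval (c + s)‖ * ‖A‖ < (‖(n : ℚ_[p])‖ * (‖(derivative f).eval (c + s)‖ * ‖s‖)) * ‖A‖ := by gcongr
      _ ≤ (‖(linM k : ℚ_[p])‖ * (‖(derivative f).eval (c + s)‖ * ‖s‖)) * ‖A‖ := by gcongr
      _ = (‖(linM k : ℚ_[p])‖ * ‖A‖) * (‖(derivative f).eval (c + s)‖ * ‖s‖) := by ring
      _ ≤ (‖(derivative f).eval (c + s)‖ * ‖s‖) * (‖(derivative f).eval (c + s)‖ * ‖s‖) := by gcongr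
      _ = _ := by ring)
  refine ⟨ξ - c, by simpa using h2, ?_⟩
  rw [show s - (ξ - c) = -(ξ - (c + s)) by ring, norm_neg]
  rw [← h4] at h1
  have : ‖(derivative f).eval (c + s)‖ * ‖ξ - (c + s)‖ < ‖(derivative f).eval (c + s)‖ * (‖(n : ℚ_[p])‖ * ‖s‖) := by
    calc _ < _ := h1
      _ = _ := by ring
  exact lt_of_mul_lt_mul_left this (norm_nonneg _)

lemma near_transfer {s s' d : ℚ_[p]} (h : ‖s‖ ≤ ‖s + d‖) (hcl : ‖s - s'‖ < ‖s‖) : ‖s'‖ ≤ ‖s' + d‖ ∧ s' + d ≠ 0 := by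
  have hss := norm_eq_of_close hcl
  have : ‖s' + d‖ = ‖s + d‖ := by
    apply norm_eq_of_close
    rw [show s + d - (s' + d) = s - s' by ring]
    exact hcl.trans_le h
  rw [hss, this]
  refine ⟨h, ?_⟩
  rw [← norm_pos_iff, this]
  exact ((norm_nonneg _).trans_lt hcl).trans_le h

end Pt

end LSZ

/-! ### Part 7 -/
namespace LSZ
open Polynomial

namespace Base
variable {B : Base}

lemma TameZ.ediv {f : B.Ω → ℤ} (hf : B.TameZ f) (e : ℕ) (he : e ≠ 0) : B.TameZ (fun ω => f ω / e) := by
  refine TameZ.of_mul e (by exact_mod_cast he) ?_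
  have h1 : B.TameZ (fun ω => f ω % e) := by
    refine TameZ.of_tameT (hf.mod e he) (b := e) fun ω => ?_
    have := Int.emod_nonneg (f ω) (b := (e : ℤ)) (by exact_mod_cast he)
    have := Int.emod_lt_of_pos (f ω) (b := (e : ℤ)) (by omega)
    rw [abs_le]; constructor <;> omega
  have := hf.sub h1
  convert this using 2 with ω
  have := Int.emod_add_mul_ediv (f ω) e
  linarith

lemma RVT.close_test {s d : (ω : B.Ω) → ℚ_[B.pr ω]} (hs : B.RVT s) (hd : B.RVT d) :
    B.TameT (fun ω => ‖s ω‖ ≤ ‖s ω + d ω‖) := by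
  have h := RVT.test (ι := Bool) (w := fun i ω => if i then s ω else d ω) (W := s)
    (by intro i; cases i <;> simpa) hs (hd.norm_le hs) (N := 1) one_ne_zero (by
      intro ω h i; cases i <;> simp <;> exact h)
  have := h.not
  convert this using 2 with ω
  simp only [Fintype.sum_bool, not_and, not_lt]
  simp only [if_true, Bool.false_eq_true, if_false]
  constructor
  · intro h _; exact h
  · intro h
    by_cases h1 : ‖d ω‖ ≤ ‖s ω‖
    · exact h h1
    · rw [add_comm, um_dom (not_le.1 h1)]; exact (not_le.1 h1).le

/-- sum without cancellation -/
lemma RVT.add_of {s d : (ω : B.Ω) → ℚ_[B.pr ω]} (hs : B.RVT s) (hd : B.RVT d)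
    (h : ∀ ω, ‖s ω‖ ≤ ‖s ω + d ω‖) : B.RVT (fun ω => s ω + d ω) := by
  classical
  have := RVT.sum (ι := Bool) (w := fun i ω => if i then s ω else d ω) (P := fun _ => True)
    (by intro i; cases i <;> simpa) (TameT.const _) (M := 1) one_ne_zero (by
      intro ω _ i; 
      have h1 := h ω
      cases i
      · simp
        have : d ω = (s ω + d ω) - s ω := by ring
        rw [this]
        simpa using um_sub_le (le_refl ‖s ω + d ω‖) h1
      · simpa)
  simpa using this

lemma RVT.sub_of {w1 w2 : (ω : B.Ω) → ℚ_[B.pr ω]} (h1 : B.RVT w1) (h2 : B.RVT w2) {M : ℕ} (hM : M ≠ 0)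
    (h : ∀ ω, ‖w1 ω - w2 ω‖ < ‖(M : ℚ_[B.pr ω])‖ * ‖w1 ω‖ → w1 ω = w2 ω) :
    B.RVT (fun ω => w1 ω - w2 ω) := by
  classical
  set P : B.Ω → Prop := fun ω => ¬ ((w1 ω).valuation = (w2 ω).valuation ∧ acr M (w1 ω) = acr M (w2 ω)) with hP
  have hPT : B.TameT P := ((h1.1.eq h2.1).and ((h1.2 M hM).map₂ (h2.2 M hM) (· = ·))).not
  have h3 : ∀ ω, P ω → ‖(M : ℚ_[B.pr ω])‖ * ‖w1 ω‖ ≤ ‖w1 ω - w2 ω‖ := by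
    intro ω hω
    by_contra hc
    exact hω (close_rv hM (not_le.1 hc))
  have h4 : ∀ ω, P ω → ‖(M : ℚ_[B.pr ω])‖ * ‖w2 ω‖ ≤ ‖w1 ω - w2 ω‖ := by
    intro ω hω
    by_contra hc
    rw [norm_sub_rev] at hc
    have := close_rv hM (not_le.1 hc)
    exact hω ⟨this.1.symm, this.2.symm⟩
  have := RVT.sum (ι := Bool) (w := fun i ω => if i then w1 ω else - w2 ω) (P := P)
    (by intro i; cases i <;> simp [h1, h2.neg]) hPT hM (by
      intro ω hω i
      cases i
      · simpa [sub_eq_add_neg] using h4 ω hω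
      · simpa [sub_eq_add_neg] using h3 ω hω)
  convert this using 2 with ω
  split_ifs with hp
  · simp [sub_eq_add_neg]
  · rw [hP] at hp
    push Not at hp
    rw [sub_eq_zero]
    by_cases hw : w1 ω = 0
    · have := hp.2
      rw [hw, acr_zero hM] at this
      rw [hw, eq_comm]; exact (acr_eq_zero_iff hM _).1 this.symm
    · exact h ω (close_of_rv hM hw hp.1 hp.2)

/-- leading terms of polynomial values close to the nearest center -/
lemma RVT.eval {f : (ω : B.Ω) → ℚ_[B.pr ω][X]} {D : ℕ} (hD : ∀ ω, (f ω).natDegree ≤ D)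
    {c s : (ω : B.Ω) → ℚ_[B.pr ω]} (hs : B.RVT s)
    (hc : ∀ i, B.RVT (fun ω => (hasseDeriv i (f ω)).eval (c ω)))
    {P : B.Ω → Prop} [DecidablePred P] (hP : B.TameT P)
    (hroot : ∀ ω, P ω → ∀ i, hasseDeriv i (f ω) ≠ 0 → ∀ ξ, (hasseDeriv i (f ω)).eval ξ = 0 →
      ‖s ω‖ ≤ ‖c ω + s ω - ξ‖) :
    B.RVT (fun ω => if P ω then (f ω).eval (c ω + s ω) else 0) := by
  have e : ∀ ω, (f ω).eval (c ω + s ω) = ∑ i : Fin (D + 1), (hasseDeriv i.1 (f ω)).eval (c ω) * s ω ^ i.1 := by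
    intro ω
    rw [taylor_sum _ (hD ω), Finset.sum_range]
  have := RVT.sum (ι := Fin (D + 1)) (w := fun i ω => (hasseDeriv i.1 (f ω)).eval (c ω) * s ω ^ i.1)
    (fun i => (hc i.1).mul (hs.pow i.1)) hP (ncM_ne D) (by
      intro ω hω j
      rw [← e]
      have := nc (hD ω) (c := c ω) (t := c ω + s ω) (by
        intro i _ hne ξ hξ
        rw [add_sub_cancel_left]
        exact hroot ω hω i hne ξ hξ) j.1
      rwa [add_sub_cancel_left] at this)
  simpa only [e] using this

/-- a nat-valued label which is a unit -/
lemma RVT.unit_nat {f : B.Ω → ℕ} (hf : B.TameT f) (h : ∀ ω, ‖((f ω : ℕ) : ℚ_[B.pr ω])‖ = 1) :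
    B.RVT (fun ω => (f ω : ℚ_[B.pr ω])) := by
  refine RVT.of_tameT_nat hf (b := 0) fun ω => ?_
  have : ((f ω : ℕ) : ℚ_[B.pr ω]) ≠ 0 := by
    intro h0; have := h ω; rw [h0] at this; simp at this
  have h1 : ((f ω : ℕ) : ℚ_[B.pr ω]).valuation = (1 : ℚ_[B.pr ω]).valuation :=
    valuation_eq_of_norm_eq this (by rw [h ω]; simp)
  rw [h1]; simp

section centers

variable {A : Type} [CommRing A] (ev : ∀ ω, A →+* ℚ_[B.pr ω])

/-- centers for `H` with tame data for `G` -/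
structure Ctr {ι : Type} (c : ι → (ω : B.Ω) → ℚ_[B.pr ω]) (H G : Set A[X]) : Prop where
  root : ∀ h ∈ H, ∀ ω, h.map (ev ω) ≠ 0 → ∀ ξ, (h.map (ev ω)).eval ξ = 0 → ∃ a, c a ω = ξ
  diff : ∀ a b, B.RVT (fun ω => c a ω - c b ω)
  val : ∀ g ∈ G, ∀ a, B.RVT (fun ω => (g.map (ev ω)).eval (c a ω))

/-- `c a` is a nearest center to `c a + s` -/
def Near {ι : Type} (c : ι → (ω : B.Ω) → ℚ_[B.pr ω]) (a : ι) (ω : B.Ω) (s : ℚ_[B.pr ω]) : Prop :=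
  ∀ b, ‖s‖ ≤ ‖s + (c a ω - c b ω)‖

/-- extending centers by new points -/
lemma Ctr.extend {ι : Type} {c : ι → (ω : B.Ω) → ℚ_[B.pr ω]} {H G : Set A[X]} {h : A[X]}
    (hev : ∀ a, B.RVT (fun ω => ev ω a))
    (hk1 : 1 ≤ h.natDegree) {H1 G1 : Set A[X]} (hC : Ctr ev c H1 G1)
    (hH : H ⊆ H1) (hG : G ⊆ G1)
    (hhasse : ∀ i, 1 ≤ i → i ≤ h.natDegree → hasseDeriv i h ∈ H1)
    (hlead : h.eraseLead ∈ H1)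
    (hrem : ∀ g ∈ G, ∃ (e : ℕ) (q r : A[X]), C h.leadingCoeff ^ e * g = q * h + r ∧
      r.natDegree < h.natDegree ∧ (∀ i, i ≤ h.natDegree → hasseDeriv i r ∈ H1 ∧ hasseDeriv i r ∈ G1))
    {X : Type} (s : ι → X → (ω : B.Ω) → ℚ_[B.pr ω]) (hs : ∀ a x, B.RVT (s a x))
    (hnear : ∀ a x ω, Near c a ω (s a x ω))
    (hroot : ∀ a x ω, s a x ω ≠ 0 → ev ω h.leadingCoeff ≠ 0 ∧ (h.map (ev ω)).eval (c a ω + s a x ω) = 0)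
    (x0 : X) (hx0 : ∀ a ω, s a x0 ω = 0)
    (hall : ∀ ω, ev ω h.leadingCoeff ≠ 0 → ∀ ξ, (h.map (ev ω)).eval ξ = 0 → ∃ a x, c a ω + s a x ω = ξ) :
    Ctr ev (fun (y : ι × X) ω => c y.1 ω + s y.1 y.2 ω) (insert h H) G := by
  classical
  have hcov : ∀ h ∈ H1, ∀ ω, h.map (ev ω) ≠ 0 → ∀ ξ, (h.map (ev ω)).eval ξ = 0 → ∀ a s, Near c a ω s →
      ‖s‖ ≤ ‖c a ω + s - ξ‖ := by
    intro h hh ω hne ξ hξ a s hn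
    obtain ⟨b, rfl⟩ := hC.root h hh ω hne ξ hξ
    have := hn b
    rwa [show s + (c a ω - c b ω) = c a ω + s - c b ω by ring] at this
  have hdeg : ∀ ω, ev ω h.leadingCoeff ≠ 0 → (h.map (ev ω)).natDegree = h.natDegree := fun ω hω =>
    natDegree_map_of_leadingCoeff_ne_zero _ hω
  have hcov' : ∀ ω a s, Near c a ω s → ∀ i, 1 ≤ i → hasseDeriv i (h.map (ev ω)) ≠ 0 →
      ∀ ξ, (hasseDeriv i (h.map (ev ω))).eval ξ = 0 → ‖s‖ ≤ ‖c a ω + s - ξ‖ := by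
    intro ω a s hn i hi hne ξ hξ
    have hik : i ≤ h.natDegree := by
      by_contra hc
      exact hne (hasseDeriv_eq_zero_of_lt_natDegree _ _ (lt_of_le_of_lt (natDegree_map_le) (not_le.1 hc)))
    rw [hasse_map] at hne hξ
    exact hcov _ (hhasse i hi hik) ω hne ξ hξ a s hn
  refine ⟨?_, ?_, ?_⟩
  · rintro h' (rfl | hh') ω hne ξ hξ
    · by_cases hl : ev ω h'.leadingCoeff = 0
      · have e : h'.map (ev ω) = h'.eraseLead.map (ev ω) := by
          have := congrArg (Polynomial.map (ev ω)) (eraseLead_add_C_mul_X_pow h')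
          rw [Polynomial.map_add, Polynomial.map_mul, map_C, hl, C_0, zero_mul, add_zero] at this
          exact this.symm
        rw [e] at hne hξ
        obtain ⟨a, ha⟩ := hC.root _ hlead ω hne ξ hξ
        exact ⟨(a, x0), by simp [hx0, ha]⟩
      · obtain ⟨a, x, hx⟩ := hall ω hl ξ hξ
        exact ⟨(a, x), hx⟩
    · obtain ⟨a, ha⟩ := hC.root _ (hH hh') ω hne ξ hξ
      exact ⟨(a, x0), by simp [hx0, ha]⟩
  · rintro ⟨a, x⟩ ⟨b, y⟩
    have h2 : B.RVT (fun ω => s b y ω + (c b ω - c a ω)) := (hs b y).add_of (hC.diff b a) fun ω => hnear b y ω a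
    have := (hs a x).sub_of h2 (linM_ne h.natDegree) (by
      intro ω hcl
      have hs0 : s a x ω ≠ 0 := by
        intro h0; rw [h0] at hcl; simp at hcl; exact absurd hcl (not_lt.2 (norm_nonneg _))
      obtain ⟨hl, hr⟩ := hroot a x ω hs0
      have hcl' : ‖s a x ω - (s b y ω + (c b ω - c a ω))‖ < ‖s a x ω‖ :=
        hcl.trans_le (mul_le_of_le_one_left (norm_nonneg _) (nat_norm_le _))
      have hsy : s b y ω ≠ 0 := by
        intro h0
        have := (near_transfer (hnear a x ω b) hcl').2
        rw [h0] at this; apply this; ring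
      have hr2 := (hroot b y ω hsy).2
      rw [show c b ω + s b y ω = c a ω + (s b y ω + (c b ω - c a ω)) by ring] at hr2
      obtain ⟨h3, h4⟩ := lin_close (hdeg ω hl) hk1 hs0 (hcov' ω a _ (hnear a x ω)) hr2 hcl
      rw [hr, norm_zero] at h4
      have h5 := (mul_eq_zero.1 h4.symm).resolve_left (norm_ne_zero_iff.2 h3)
      exact (sub_eq_zero.1 (norm_eq_zero.1 h5)).symm)
    convert this using 2 with ω
    ring
  · rintro g hg ⟨a, x⟩
    obtain ⟨e, q, r, h1, h2, h3⟩ := hrem g hg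
    have hP : B.TameT (fun ω => ¬ s a x ω = 0) := (hs a x).eq_zero.not
    have hr := RVT.eval (f := fun ω => r.map (ev ω)) (D := h.natDegree)
      (fun ω => natDegree_map_le.trans h2.le) (c := c a) (s := s a x) (hs a x) (by
        intro i
        by_cases hi : i ≤ h.natDegree
        · simpa only [hasse_map] using hC.val _ (h3 i hi).2 a
        · have : ∀ ω, hasseDeriv i (r.map (ev ω)) = 0 := fun ω =>
            hasseDeriv_eq_zero_of_lt_natDegree _ _ (lt_of_le_of_lt natDegree_map_le (by omega))
          simp only [this, eval_zero]; exact RVT.zero)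
      hP (by
        intro ω hω i hne ξ hξ
        have hi : i ≤ h.natDegree := by
          by_contra hc
          exact hne (hasseDeriv_eq_zero_of_lt_natDegree _ _ (lt_of_le_of_lt natDegree_map_le (by omega)))
        rw [hasse_map] at hne hξ
        exact hcov _ (h3 i hi).1 ω hne ξ hξ a _ (hnear a x ω))
    have := RVT.ite (hs a x).eq_zero (hC.val g (hG hg) a) (((hev h.leadingCoeff).pow e).inv.mul hr)
    convert this using 2 with ω
    beta_reduce
    split_ifs with h0 
    · simp [h0]
    · obtain ⟨hl, hr⟩ := hroot a x ω h0
      have := congrArg (fun f => (f.map (ev ω)).eval (c a ω + s a x ω)) h1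
      simp only [Polynomial.map_mul, Polynomial.map_pow, map_C, eval_mul, eval_pow, eval_C, Polynomial.map_add,
        eval_add, hr, mul_zero, zero_add] at this
      rw [← this, inv_mul_cancel_left₀ (pow_ne_zero _ hl)]

end centers
end Base
end LSZ

/-! ### Part 8 -/
namespace LSZ
open Polynomial

namespace Base
variable {B : Base}

section centers
variable {A : Type} [CommRing A] (ev : ∀ ω, A →+* ℚ_[B.pr ω])

lemma Near.tame {ι : Type} [Finite ι] {c : ι → (ω : B.Ω) → ℚ_[B.pr ω]}
    (hd : ∀ a b, B.RVT (fun ω => c a ω - c b ω)) (a : ι) {s : (ω : B.Ω) → ℚ_[B.pr ω]} (hs : B.RVT s) :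
    B.TameT (fun ω => Near c a ω (s ω)) :=
  TameT.all fun b => hs.close_test (hd a b)

lemma roots_at {ι : Type} [Finite ι] {c : ι → (ω : B.Ω) → ℚ_[B.pr ω]} {h : A[X]}
    (hev : ∀ a, B.RVT (fun ω => ev ω a)) (hk1 : 1 ≤ h.natDegree)
    (hd : ∀ a b, B.RVT (fun ω => c a ω - c b ω))
    (hval : ∀ i a, B.RVT (fun ω => (hasseDeriv i (h.map (ev ω))).eval (c a ω)))
    (hcov : ∀ ω a s, Near c a ω s → ∀ i, 1 ≤ i → hasseDeriv i (h.map (ev ω)) ≠ 0 →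
      ∀ ξ, (hasseDeriv i (h.map (ev ω))).eval ξ = 0 → ‖s‖ ≤ ‖c a ω + s - ξ‖)
    (a : ι) {γ : B.Ω → ℤ} (hγ : B.TameZ γ) :
    ∃ s : Fin h.natDegree → (ω : B.Ω) → ℚ_[B.pr ω], (∀ l, B.RVT (s l)) ∧
      (∀ l ω, Near c a ω (s l ω)) ∧
      (∀ l ω, s l ω ≠ 0 → ev ω h.leadingCoeff ≠ 0 ∧ (h.map (ev ω)).eval (c a ω + s l ω) = 0) ∧
      (∀ ω s', s' ≠ 0 → ev ω h.leadingCoeff ≠ 0 → Near c a ω s' → (h.map (ev ω)).eval (c a ω + s') = 0 →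
        s'.valuation = γ ω → ∃ l, s l ω = s') := by
  classical
  set k := h.natDegree with hk
  have hdeg : ∀ ω, ev ω h.leadingCoeff ≠ 0 → (h.map (ev ω)).natDegree = k := fun ω hω =>
    natDegree_map_of_leadingCoeff_ne_zero _ hω
  let R : (ω : B.Ω) → Set ℚ_[B.pr ω] := fun ω => {s' | s' ≠ 0 ∧ ev ω h.leadingCoeff ≠ 0 ∧ Near c a ω s' ∧
    (h.map (ev ω)).eval (c a ω + s') = 0 ∧ s'.valuation = γ ω}
  let Sig : ℕ → B.Ω → Set ℕ := fun n ω => {σ | ∃ s' ∈ R ω, acr n s' = σ}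
  have hM := linM_ne k
  have inj : ∀ ω, ∀ s' ∈ R ω, ∀ s'' ∈ R ω, acr (linM k) s' = acr (linM k) s'' → s' = s'' := by
    intro ω s' h1 s'' h2 e
    have hcl := close_of_rv hM h1.1 (h1.2.2.2.2.trans h2.2.2.2.2.symm) e
    obtain ⟨h3, h4⟩ := lin_close (hdeg ω h1.2.1) hk1 h1.1 (hcov ω a s' h1.2.2.1) h2.2.2.2.1 hcl
    rw [h1.2.2.2.1, norm_zero] at h4
    have h5 := (mul_eq_zero.1 h4.symm).resolve_left (norm_ne_zero_iff.2 h3)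
    exact (sub_eq_zero.1 (norm_eq_zero.1 h5)).symm
  -- finiteness
  have hfin : ∀ ω, (R ω).Finite ∧ (R ω).ncard ≤ k := by
    intro ω
    by_cases hl : ev ω h.leadingCoeff = 0
    · have : R ω = ∅ := by
        ext s'; simp only [Set.mem_empty_iff_false, iff_false]; exact fun hs' => hs'.2.1 hl
      rw [this]; simp
    have hne : h.map (ev ω) ≠ 0 := by
      intro h0; have := hdeg ω hl; rw [h0] at this; simp at this; omega
    have hinj : Set.InjOn (fun s' => c a ω + s') (R ω) := fun _ _ _ _ e => add_left_cancel e
    have hmaps : ∀ s' ∈ R ω, c a ω + s' ∈ ((h.map (ev ω)).roots.toFinset : Set ℚ_[B.pr ω]) := by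
      intro s' hs'
      simp only [Finset.mem_coe, Multiset.mem_toFinset, mem_roots hne, IsRoot]
      exact hs'.2.2.2.1
    refine ⟨Set.Finite.of_injOn hmaps hinj (Finset.finite_toSet _), ?_⟩
    refine (Set.ncard_le_ncard_of_injOn _ hmaps hinj (Finset.finite_toSet _)).trans ?_
    rw [Set.ncard_coe_finset]
    exact (Multiset.toFinset_card_le _).trans ((card_roots' _).trans (hdeg ω hl).le)
  have hSfin : ∀ n ω, (Sig n ω).Finite ∧ (Sig n ω).ncard ≤ k := by
    intro n ω
    have : Sig n ω = (fun s' => acr n s') '' R ω := by ext; simp [Sig]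
    rw [this]
    exact ⟨(hfin ω).1.image _, (Set.ncard_image_le (hfin ω).1).trans (hfin ω).2⟩
  -- tameness
  have tame : ∀ n, n ≠ 0 → linM k ∣ n → B.TameT (Sig n) := by
    intro n hn hdvd
    let B' := B.withLabel ℕ
    let valid : B'.Ω → Prop := fun x => x.2 < (B.pr x.1 : ℕ) ^ lev (B.pr x.1) n ∧ ‖((x.2 : ℕ) : ℚ_[B.pr x.1])‖ = 1
    have hvalid : B'.TameT valid := by
      have h2 : B'.TameT (fun x => x.2) := (TameT.label (B := B')).map Prod.snd
      exact (TameT.pr (B := B')).map₂ h2 (fun q σ => σ < (q : ℕ) ^ lev q n ∧ ‖((σ : ℕ) : ℚ_[q])‖ = 1)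
    let σ' : B'.Ω → ℕ := fun x => if valid x then x.2 else 1
    have hσ' : B'.TameT σ' := TameT.ite hvalid ((TameT.label (B := B')).map Prod.snd) (TameT.const 1)
    have hσ1 : ∀ x : B'.Ω, ‖((σ' x : ℕ) : ℚ_[B'.pr x])‖ = 1 := by
      intro x
      simp only [σ']
      split_ifs with hx
      · exact hx.2
      · simp
    let s : (x : B'.Ω) → ℚ_[B'.pr x] := fun x => (B.pr x.1 : ℚ_[B.pr x.1]) ^ γ x.1 * (σ' x : ℚ_[B.pr x.1])
    have hs : B'.RVT s := (RVT.zpow_p hγ.withLabel).mul (RVT.unit_nat hσ' hσ1)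
    have hsne : ∀ x, s x ≠ 0 := by
      intro x
      refine mul_ne_zero (zpow_ne_zero _ p_ne) ?_
      intro h0
      have := hσ1 x
      change ‖((σ' x : ℕ) : ℚ_[B.pr x.1])‖ = 1 at this
      rw [h0] at this; simp at this
    have hsval : ∀ x, (s x).valuation = γ x.1 := by
      intro x
      have : ‖s x‖ = ‖(B.pr x.1 : ℚ_[B.pr x.1]) ^ γ x.1‖ := by
        have h1 := hσ1 x
        change ‖((σ' x : ℕ) : ℚ_[B.pr x.1])‖ = 1 at h1
        simp only [s, norm_mul, h1, mul_one]
      rw [valuation_eq_of_norm_eq (hsne x) this, RVT.val_zpow]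
    have hsacr : ∀ x, valid x → acr n (s x) = x.2 := by
      intro x hx
      have e : σ' x = x.2 := if_pos hx
      rw [acr, ac, hsval]
      have : s x * (B.pr x.1 : ℚ_[B.pr x.1]) ^ (-γ x.1) = (x.2 : ℚ_[B.pr x.1]) := by
        simp only [s, e]
        rw [mul_right_comm, ← zpow_add₀ p_ne]; simp
      refine (congrArg (res n) this).trans ?_
      refine res_unique hn hx.1 ?_
      rw [sub_self, norm_zero]; exact nat_norm_pos hn
    let P : B'.Ω → Prop := fun x => valid x ∧ ev x.1 h.leadingCoeff ≠ 0 ∧ Near c a x.1 (s x) ∧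
      ∃ j : Fin k, ‖(hasseDeriv 0 (h.map (ev x.1))).eval (c a x.1)‖ ≤
        ‖(hasseDeriv (j.1 + 1) (h.map (ev x.1))).eval (c a x.1) * s x ^ (j.1 + 1)‖
    have hP : B'.TameT P := by
      refine hvalid.and (((hev _).eq_zero.not.withLabel).and (TameT.and ?_ (TameT.ex fun j => ?_)))
      · exact Near.tame (B := B') (c := fun b x => c b x.1) (fun a b => (hd a b).withLabel) a hs
      · exact RVT.norm_le (B := B') (hval 0 a).withLabel ((hval _ a).withLabel.mul (hs.pow _))
    have hder : ∀ (ω : B.Ω) i (x : ℚ_[B.pr ω]), (hasseDeriv i (derivative (h.map (ev ω)))).eval x =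
        ((i + 1 : ℕ) : ℚ_[B.pr ω]) * (hasseDeriv (i + 1) (h.map (ev ω))).eval x := by
      intro ω i x
      rw [← hasseDeriv_one, hasse_hasse_eval]
      congr 2; rw [Nat.choose_symm_add]; simp
    have hD := RVT.eval (B := B') (f := fun x => derivative (h.map (ev x.1))) (D := k)
      (fun x => (natDegree_derivative_le _).trans ((Nat.sub_le _ _).trans natDegree_map_le))
      (c := fun x => c a x.1) (s := s) hs (by
        intro i
        simp only [hder]
        exact (RVT.nat (i + 1)).mul (hval (i + 1) a).withLabel) hP (by
        intro x hx i hne ξ hξ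
        rw [hder] at hξ
        refine hcov x.1 a _ hx.2.2.1 (i + 1) (by omega) ?_ ξ ?_
        · intro h0
          apply hne
          apply Polynomial.funext
          intro y
          have := hder x.1 i y
          rw [h0] at this
          simpa using this
        · exact (mul_eq_zero.1 hξ).resolve_left (Nat.cast_ne_zero.2 (Nat.succ_ne_zero i)))
    have hW := ((RVT.nat (B := B') n).mul hD).mul hs
    have hT := RVT.test (B := B') (ι := Fin (k + 1))
      (w := fun j x => (hasseDeriv j.1 (h.map (ev x.1))).eval (c a x.1) * s x ^ j.1)
      (fun j => (hval j.1 a).withLabel.mul (hs.pow _)) hW hP (N := linM k * n) (mul_ne_zero hM hn) (by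
        intro x hx j
        obtain ⟨A', hA0, hA, -, hl⟩ := lin (hdeg x.1 hx.2.1) hk1 (hsne x) (hcov x.1 a _ hx.2.2.1)
        have hj : ‖(hasseDeriv j.1 (h.map (ev x.1))).eval (c a x.1) * s x ^ j.1‖ ≤ ‖A'‖ := by
          rcases Nat.eq_zero_or_pos j.1 with h0 | h0
          · obtain ⟨j', hj'⟩ := hx.2.2.2
            rw [h0, pow_zero, mul_one]
            exact hj'.trans (hA _ (by omega))
          · exact hA _ h0
        beta_reduce
        rw [if_pos hx, mul_assoc, norm_mul (n : ℚ_[B.pr x.1]), Nat.cast_mul, norm_mul (linM k : ℚ_[B.pr x.1])]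
        calc _ ≤ ‖(linM k : ℚ_[B.pr x.1])‖ * ‖(n : ℚ_[B.pr x.1])‖ * ‖A'‖ := by gcongr
          _ = ‖(n : ℚ_[B.pr x.1])‖ * (‖(linM k : ℚ_[B.pr x.1])‖ * ‖A'‖) := by ring
          _ ≤ _ := by gcongr)
    have hc := (TameT.curry hT).map (fun (f : ℕ → Prop) => {σ | f σ})
    refine (congrArg B.TameT ?_).mp hc
    refine Eq.symm ?_
    funext ω
    ext σ
    have hsum : ∀ x : B'.Ω, ∑ j : Fin (k + 1), (hasseDeriv j.1 (h.map (ev x.1))).eval (c a x.1) * s x ^ j.1 =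
        (h.map (ev x.1)).eval (c a x.1 + s x) := by
      intro x
      rw [taylor_sum _ (D := k) natDegree_map_le, Finset.sum_range]
    change σ ∈ Sig n ω ↔ (P (ω, σ) ∧ _)
    rw [hsum]
    constructor
    · rintro ⟨s', hs', rfl⟩
      have hv : valid (ω, acr n s') := ⟨acr_lt _ _, norm_acr hn hs'.1⟩
      have hrv := hsacr _ hv
      have hcl : ‖s' - s (ω, acr n s')‖ < ‖(n : ℚ_[B.pr ω])‖ * ‖s'‖ :=
        close_of_rv hn hs'.1 (hs'.2.2.2.2.trans (hsval (ω, acr n s')).symm) hrv.symm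
      have hcl1 : ‖s' - s (ω, acr n s')‖ < ‖s'‖ := hcl.trans_le (mul_le_of_le_one_left (norm_nonneg _) (nat_norm_le _))
      have hss := norm_eq_of_close hcl1
      have hnear : Near c a ω (s (ω, acr n s')) := fun b => (near_transfer (hs'.2.2.1 b) hcl1).1
      have hcl2 : ‖s (ω, acr n s') - s'‖ < ‖(linM k : ℚ_[B.pr ω])‖ * ‖s (ω, acr n s')‖ := by
        rw [norm_sub_rev, hss]
        exact hcl.trans_le (mul_le_mul_of_nonneg_right (nat_norm_le_of_dvd hdvd) (norm_nonneg _))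
      obtain ⟨h3, h4⟩ := lin_close (hdeg ω hs'.2.1) hk1 (hsne (ω, acr n s')) (hcov ω a _ hnear) hs'.2.2.2.1 hcl2
      obtain ⟨A', hA0, hA, ⟨j, hj1, hj2, hj⟩, -⟩ := lin (hdeg ω hs'.2.1) hk1 (hsne (ω, acr n s')) (hcov ω a _ hnear)
      have hz := lin_zero hA hss.symm hs'.2.2.2.1
      have hPx : P (ω, acr n s') := by
        refine ⟨hv, hs'.2.1, hnear, ⟨j - 1, by omega⟩, ?_⟩
        simp only [show j - 1 + 1 = j by omega]
        rw [← hj]; simpa using hz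
      refine ⟨hPx, ?_⟩
      change ‖_‖ < ‖_‖
      rw [if_pos hPx]
      refine h4.trans_lt ?_
      rw [norm_mul, norm_mul]
      rw [norm_sub_rev] at hcl
      rw [norm_sub_rev] at hcl
      change _ < ‖(n : ℚ_[B.pr ω])‖ * ‖(derivative (h.map (ev ω))).eval (c a ω + s (ω, acr n s'))‖ * ‖s (ω, acr n s')‖
      rw [hss]
      have := mul_lt_mul_of_pos_left hcl (norm_pos_iff.2 h3)
      calc _ < _ := this
        _ = _ := by ring
    · rintro ⟨hPx, hlt⟩
      change ‖_‖ < ‖_‖ at hlt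
      rw [if_pos hPx, mul_assoc, norm_mul (n : ℚ_[B.pr ω])] at hlt
      obtain ⟨j, hj⟩ := hPx.2.2.2
      obtain ⟨s', h1, h2⟩ := lin_exists (hdeg ω hPx.2.1) hk1 (hsne (ω, σ)) (hcov ω a _ hPx.2.2.1) hdvd
        ⟨j.1 + 1, by omega, by simpa using hj⟩ hlt
      have hcl1 : ‖s (ω, σ) - s'‖ < ‖s (ω, σ)‖ := h2.trans_le (mul_le_of_le_one_left (norm_nonneg _) (nat_norm_le _))
      have hss := norm_eq_of_close hcl1
      have hrv := close_rv hn h2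
      refine ⟨s', ⟨?_, hPx.2.1, fun b => (near_transfer (hPx.2.2.1 b) hcl1).1, h1, ?_⟩, ?_⟩
      · rw [← norm_pos_iff, hss]; exact norm_pos_iff.2 (hsne _)
      · rw [← hrv.1, hsval]
      · rw [← hrv.2]; exact hsacr _ hPx.1
  -- enumeration
  let en : Set ℕ → Fin k → ℕ := fun T' l => Nat.nth (· ∈ T') l.1
  have hen : ∀ T' : Set ℕ, T'.Finite → T'.ncard ≤ k → ∀ σ ∈ T', ∃ l, en T' l = σ := by
    intro T' hf hcard σ hσ
    obtain ⟨n, hn, e⟩ := Nat.exists_lt_card_finite_nth_eq (p := (· ∈ T')) hf hσ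
    rw [Set.ncard_eq_toFinset_card _ hf] at hcard
    exact ⟨⟨n, hn.trans_le hcard⟩, e⟩
  let s : Fin k → (ω : B.Ω) → ℚ_[B.pr ω] := fun l ω =>
    if hl : ∃ s' ∈ R ω, acr (linM k) s' = en (Sig (linM k) ω) l then hl.choose else 0
  have hsR : ∀ l ω, s l ω ≠ 0 → s l ω ∈ R ω := by
    intro l ω hne
    simp only [s] at hne ⊢
    split_ifs at hne ⊢ with hl
    · exact hl.choose_spec.1
    · exact absurd rfl hne
  refine ⟨s, ?_, ?_, ?_, ?_⟩
  · intro l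
    have hv0 : B.TameT (fun ω => en (Sig (linM k) ω) l ∈ Sig (linM k) ω) :=
      (tame _ hM dvd_rfl).map (fun T' => en T' l ∈ T')
    refine ⟨?_, ?_⟩
    · have := TameZ.ite hv0 hγ (TameZ.const 0)
      convert this using 2 with ω
      simp only [s, Sig, Set.mem_ofPred_eq]
      split_ifs with hl
      · exact hl.choose_spec.1.2.2.2.2
      · simp
    · intro n hn
      have hT := tame (linM k * n) (mul_ne_zero hM hn) (dvd_mul_right _ _)
      let F : Nat.Primes → Set ℕ → Set ℕ → ℕ := fun q S1 S2 =>
        if hx : en S1 l ∈ S1 ∧ ∃ τ ∈ S2, res (linM k) (τ : ℚ_[q]) = en S1 l then res n (hx.2.choose : ℚ_[q]) else 0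
      have := ((TameT.pr (B := B)).prod ((tame _ hM dvd_rfl).prod hT)).map (fun x => F x.1 x.2.1 x.2.2)
      convert this using 2 with ω
      simp only [F]
      by_cases hl : ∃ s' ∈ R ω, acr (linM k) s' = en (Sig (linM k) ω) l
      · have e : s l ω = hl.choose := by simp only [s]; rw [dif_pos hl]
        have hspec := hl.choose_spec
        rw [← e] at hspec
        have hx : en (Sig (linM k) ω) l ∈ Sig (linM k) ω ∧ ∃ τ ∈ Sig (linM k * n) ω,
            res (linM k) (τ : ℚ_[B.pr ω]) = en (Sig (linM k) ω) l := by
          refine ⟨hl, acr (linM k * n) (s l ω), ⟨s l ω, hspec.1, rfl⟩, ?_⟩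
          rw [← acr_of_dvd (mul_ne_zero hM hn) (dvd_mul_right _ _)]; exact hspec.2
        rw [dif_pos hx]
        obtain ⟨⟨s'', h1, h2⟩, h3⟩ := hx.2.choose_spec
        have : s'' = s l ω := by
          refine inj ω _ h1 _ hspec.1 ?_
          rw [hspec.2, ← h3, ← h2, ← acr_of_dvd (mul_ne_zero hM hn) (dvd_mul_right _ _)]
        rw [← h2, this, ← acr_of_dvd (mul_ne_zero hM hn) (dvd_mul_left _ _)]
      · rw [dif_neg (fun hx => hl hx.1)]
        have : s l ω = 0 := by simp only [s]; rw [dif_neg hl]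
        rw [this, acr_zero hn]
  · intro l ω
    by_cases h0 : s l ω = 0
    · intro b; rw [h0]; simp
    · exact (hsR l ω h0).2.2.1
  · intro l ω hne
    have := hsR l ω hne
    exact ⟨this.2.1, this.2.2.2.1⟩
  · intro ω s' h1 h2 h3 h4 h5
    have hs' : s' ∈ R ω := ⟨h1, h2, h3, h4, h5⟩
    obtain ⟨l, hl⟩ := hen _ (hSfin (linM k) ω).1 (hSfin (linM k) ω).2 (acr (linM k) s') ⟨s', hs', rfl⟩
    refine ⟨l, ?_⟩
    have hx : ∃ s' ∈ R ω, acr (linM k) s' = en (Sig (linM k) ω) l := ⟨s', hs', hl.symm⟩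
    have e : s l ω = hx.choose := by simp only [s]; rw [dif_pos hx]
    rw [e]
    exact inj ω _ hx.choose_spec.1 _ hs' (hx.choose_spec.2.trans hl)

end centers
end Base
end LSZ

/-! ### Part 9 -/
namespace LSZ
open Polynomial

lemma hasse_top_ne {R : Type*} [CommRing R] [IsDomain R] {f : R[X]} {k : ℕ} (hk : f.natDegree = k) (hf : f ≠ 0)
    (c : R) : (hasseDeriv k f).eval c ≠ 0 := by
  rw [← taylor_coeff]
  have h1 : (taylor c f).natDegree = k := by rw [natDegree_taylor, hk]
  rw [← h1]
  have h2 : taylor c f ≠ 0 := by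
    intro h0
    exact hf (taylor_injective c (by simpa using h0))
  exact leadingCoeff_ne_zero.2 h2

namespace Base
variable {B : Base}

section centers
variable {A : Type} [CommRing A] (ev : ∀ ω, A →+* ℚ_[B.pr ω])

lemma exists_near {ι : Type} [Finite ι] [Nonempty ι] (c : ι → (ω : B.Ω) → ℚ_[B.pr ω]) (ω : B.Ω) (ξ : ℚ_[B.pr ω]) :
    ∃ a, Near c a ω (ξ - c a ω) := by
  obtain ⟨a, ha⟩ := Finite.exists_min (fun a => ‖ξ - c a ω‖)
  refine ⟨a, fun b => ?_⟩
  rw [show ξ - c a ω + (c a ω - c b ω) = ξ - c b ω by ring]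
  exact ha b

lemma roots_all {ι : Type} [Finite ι] [Nonempty ι] {c : ι → (ω : B.Ω) → ℚ_[B.pr ω]} {h : A[X]}
    (hev : ∀ a, B.RVT (fun ω => ev ω a)) (hk1 : 1 ≤ h.natDegree)
    (hd : ∀ a b, B.RVT (fun ω => c a ω - c b ω))
    (hval : ∀ i a, B.RVT (fun ω => (hasseDeriv i (h.map (ev ω))).eval (c a ω)))
    (hcov : ∀ ω a s, Near c a ω s → ∀ i, 1 ≤ i → hasseDeriv i (h.map (ev ω)) ≠ 0 →
      ∀ ξ, (hasseDeriv i (h.map (ev ω))).eval ξ = 0 → ‖s‖ ≤ ‖c a ω + s - ξ‖) :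
    ∃ (X : Type) (_ : Finite X) (x0 : X) (s : ι → X → (ω : B.Ω) → ℚ_[B.pr ω]), (∀ a x, B.RVT (s a x)) ∧
      (∀ a x ω, Near c a ω (s a x ω)) ∧
      (∀ a x ω, s a x ω ≠ 0 → ev ω h.leadingCoeff ≠ 0 ∧ (h.map (ev ω)).eval (c a ω + s a x ω) = 0) ∧
      (∀ a ω, s a x0 ω = 0) ∧
      (∀ ω, ev ω h.leadingCoeff ≠ 0 → ∀ ξ, (h.map (ev ω)).eval ξ = 0 → ∃ a x, c a ω + s a x ω = ξ) := by
  classical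
  set k := h.natDegree with hk
  let γ : ι → Fin (k + 1) × Fin (k + 1) → B.Ω → ℤ := fun a ij ω =>
    (((hasseDeriv ij.1.1 (h.map (ev ω))).eval (c a ω)).valuation -
      ((hasseDeriv ij.2.1 (h.map (ev ω))).eval (c a ω)).valuation) / ((ij.2.1 - ij.1.1 - 1 + 1 : ℕ) : ℤ)
  have hγ : ∀ a ij, B.TameZ (γ a ij) := fun a ij =>
    TameZ.ediv ((hval _ a).1.sub (hval _ a).1) _ (by omega)
  choose s h1 h2 h3 h4 using fun a ij => roots_at ev hev hk1 hd hval hcov a (hγ a ij)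
  let s' : ι → Option ((Fin (k + 1) × Fin (k + 1)) × Fin k) → (ω : B.Ω) → ℚ_[B.pr ω] := fun a x =>
    match x with
    | none => fun _ => 0
    | some y => s a y.1 y.2
  refine ⟨Option ((Fin (k + 1) × Fin (k + 1)) × Fin k), inferInstance, none, s', ?_, ?_, ?_, fun _ _ => rfl, ?_⟩
  · rintro a (_ | x)
    · exact RVT.zero
    · exact h1 a x.1 x.2
  · rintro a (_ | x) ω
    · intro b; simp [s']
    · exact h2 a x.1 x.2 ω
  · rintro a (_ | x) ω hne
    · exact absurd rfl hne
    · exact h3 a x.1 x.2 ω hne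
  · intro ω hl ξ hξ
    obtain ⟨a, ha⟩ := exists_near c ω ξ
    refine ⟨a, ?_⟩
    by_cases h0 : ξ - c a ω = 0
    · exact ⟨none, by simp only [s']; rw [add_zero]; exact (sub_eq_zero.1 h0).symm⟩
    have hdeg : (h.map (ev ω)).natDegree = k := natDegree_map_of_leadingCoeff_ne_zero _ hl
    have hne : h.map (ev ω) ≠ 0 := by
      intro h0; rw [h0] at hdeg; simp at hdeg; omega
    have hev0 : (h.map (ev ω)).eval (c a ω + (ξ - c a ω)) = 0 := by rw [add_sub_cancel]; exact hξ
    have hsum := hev0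
    rw [taylor_sum _ hdeg.le] at hsum
    obtain ⟨i, j, hij, hjk, hxi, hxj, hn⟩ := two_max
      (fun i => (hasseDeriv i (h.map (ev ω))).eval (c a ω) * (ξ - c a ω) ^ i) hsum
      (mul_ne_zero (hasse_top_ne hdeg hne _) (pow_ne_zero _ h0))
    have hv := valuation_eq_of_norm_eq hxi hn
    have hi := left_ne_zero_of_mul hxi
    have hj := left_ne_zero_of_mul hxj
    rw [Padic.valuation_mul hi (pow_ne_zero _ h0), Padic.valuation_mul hj (pow_ne_zero _ h0),
      Padic.valuation_pow, Padic.valuation_pow] at hv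
    obtain ⟨l, hl'⟩ := h4 a (⟨i, by omega⟩, ⟨j, by omega⟩) ω (ξ - c a ω) h0 hl ha hev0 (by
      simp only [γ]
      rw [show j - i - 1 + 1 = j - i by omega]
      refine (Int.ediv_eq_of_eq_mul_right (by omega) ?_).symm
      push_cast [hij.le]
      linarith)
    exact ⟨some ((⟨i, by omega⟩, ⟨j, by omega⟩), l), by simp only [s']; rw [hl']; ring⟩

lemma Ctr.mono {ι : Type} {c : ι → (ω : B.Ω) → ℚ_[B.pr ω]} {H G H' G' : Set A[X]} (hC : Ctr ev c H G)
    (hH : H' ⊆ H) (hG : G' ⊆ G) : Ctr ev c H' G' :=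
  ⟨fun h hh => hC.root h (hH hh), hC.diff, fun g hg => hC.val g (hG hg)⟩

/-- existence of centers -/
def HasCtr (H G : Set A[X]) : Prop :=
  ∃ (ι : Type) (_ : Finite ι) (_ : Nonempty ι) (c : ι → (ω : B.Ω) → ℚ_[B.pr ω]), Ctr ev c H G

lemma HasCtr.step (hev : ∀ a, B.RVT (fun ω => ev ω a)) {h : A[X]} (hk1 : 1 ≤ h.natDegree) (T L : Set A[X])
    (hT : T.Finite) (hL : L.Finite) (hLd : ∀ g ∈ L, g.natDegree < h.natDegree)
    (IH : ∀ L : Set A[X], L.Finite → (∀ g ∈ L, g.natDegree < h.natDegree) → ∀ G : Set A[X], G.Finite →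
      HasCtr ev (L ∪ T) G) (G : Set A[X]) (hG : G.Finite) : HasCtr ev (insert h (L ∪ T)) G := by
  classical
  choose e q r he hr using fun g => pseudo_div h hk1 g
  let D : Set A[X] := (fun x : ℕ × A[X] => hasseDeriv x.1 (r x.2)) '' (Set.Iic h.natDegree ×ˢ G)
  have hD : D.Finite := ((Set.finite_Iic _).prod hG).image _
  let L' : Set A[X] := L ∪ ((fun i => hasseDeriv i h) '' (Set.Icc 1 h.natDegree) ∪ ({h.eraseLead} ∪ D))
  have hL' : L'.Finite := hL.union (((Set.finite_Icc _ _).image _).union ((Set.finite_singleton _).union hD))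
  have hL'd : ∀ g ∈ L', g.natDegree < h.natDegree := by
    rintro g (hg | ⟨i, hi, rfl⟩ | hg | ⟨⟨i, g'⟩, -, rfl⟩)
    · exact hLd g hg
    · have := natDegree_hasseDeriv_le h i
      have := hi.1
      show (hasseDeriv i h).natDegree < _
      omega
    · rw [Set.mem_singleton_iff.1 hg]
      have := eraseLead_natDegree_le h
      omega
    · exact ((natDegree_hasseDeriv_le _ _).trans (Nat.sub_le _ _)).trans_lt (hr g')
  let G1 : Set A[X] := G ∪ ((fun i => hasseDeriv i h) '' (Set.Iic h.natDegree) ∪ D)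
  have hG1 : G1.Finite := hG.union (((Set.finite_Iic _).image _).union hD)
  obtain ⟨ι, hι, hι', c, hC⟩ := IH L' hL' hL'd G1 hG1
  have hmemH : ∀ i, 1 ≤ i → i ≤ h.natDegree → hasseDeriv i h ∈ L' ∪ T := fun i h1 h2 =>
    Or.inl (Or.inr (Or.inl ⟨i, ⟨h1, h2⟩, rfl⟩))
  have hval : ∀ i a, B.RVT (fun ω => (hasseDeriv i (h.map (ev ω))).eval (c a ω)) := by
    intro i a
    by_cases hi : i ≤ h.natDegree
    · simpa only [hasse_map] using hC.val _ (Or.inr (Or.inl ⟨i, hi, rfl⟩)) a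
    · have : ∀ ω, hasseDeriv i (h.map (ev ω)) = 0 := fun ω =>
        hasseDeriv_eq_zero_of_lt_natDegree _ _ (lt_of_le_of_lt natDegree_map_le (by omega))
      simp only [this, eval_zero]; exact RVT.zero
  have hcov : ∀ ω a s, Near c a ω s → ∀ i, 1 ≤ i → hasseDeriv i (h.map (ev ω)) ≠ 0 →
      ∀ ξ, (hasseDeriv i (h.map (ev ω))).eval ξ = 0 → ‖s‖ ≤ ‖c a ω + s - ξ‖ := by
    intro ω a s hn i hi hne ξ hξ
    have hik : i ≤ h.natDegree := by
      by_contra hc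
      exact hne (hasseDeriv_eq_zero_of_lt_natDegree _ _ (lt_of_le_of_lt (natDegree_map_le) (not_le.1 hc)))
    rw [hasse_map] at hne hξ
    obtain ⟨b, rfl⟩ := hC.root _ (hmemH i hi hik) ω hne ξ hξ
    have := hn b
    rwa [show s + (c a ω - c b ω) = c a ω + s - c b ω by ring] at this
  obtain ⟨X, hX, x0, s, h1, h2, h3, h4, h5⟩ := roots_all ev hev hk1 hC.diff hval hcov
  refine ⟨ι × X, inferInstance, ⟨(hι'.some, x0)⟩, _, Ctr.extend ev hev hk1 hC ?_ Set.subset_union_left hmemH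
    (Or.inl (Or.inr (Or.inr (Or.inl rfl)))) ?_ s h1 h2 h3 x0 h4 h5⟩
  · rintro g (hg | hg)
    · exact Or.inl (Or.inl hg)
    · exact Or.inr hg
  · intro g hg
    refine ⟨e g, q g, r g, he g, hr g, fun i hi => ?_⟩
    have : hasseDeriv i (r g) ∈ D := ⟨(i, g), ⟨hi, hg⟩, rfl⟩
    exact ⟨Or.inl (Or.inr (Or.inr (Or.inr this))), Or.inr (Or.inr this)⟩

theorem hasCtr_aux (hev : ∀ a, B.RVT (fun ω => ev ω a)) (k : ℕ) : ∀ L : Set A[X], L.Finite →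
    (∀ g ∈ L, g.natDegree < k) → ∀ G : Set A[X], G.Finite → HasCtr ev L G := by
  induction k with
  | zero =>
    intro L hL hLd G hG
    refine ⟨Unit, inferInstance, inferInstance, fun _ _ => 0, ?_, ?_, ?_⟩
    · intro h hh; exact absurd (hLd h hh) (by omega)
    · intro a b; simpa using RVT.zero
    · intro g hg a
      have := hev (g.coeff 0)
      simpa [← coeff_zero_eq_eval_zero] using this
  | succ k ih =>
    have key : ∀ T : Set A[X], T.Finite → (∀ g ∈ T, g.natDegree = k) → ∀ L : Set A[X], L.Finite →
        (∀ g ∈ L, g.natDegree < k) → ∀ G : Set A[X], G.Finite → HasCtr ev (L ∪ T) G := by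
      intro T hT
      induction T, hT using Set.Finite.induction_on with
      | empty => 
        intro _ L hL hLd G hG
        simpa using ih L hL hLd G hG
      | @insert h T hh hT ihT =>
        intro hTd L hL hLd G hG
        have hk := hTd h (Set.mem_insert _ _)
        have ihT' := ihT (fun g hg => hTd g (Set.mem_insert_of_mem _ hg))
        have e : L ∪ insert h T = insert h (L ∪ T) := Set.union_insert
        rw [e]
        rcases Nat.eq_zero_or_pos k with h0 | h0
        · obtain ⟨ι, h1, h2, c, hC⟩ := ihT' L hL hLd G hG
          refine ⟨ι, h1, h2, c, ?_, hC.diff, hC.val⟩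
          rintro g (rfl | hg)
          · intro ω hne ξ hξ
            obtain ⟨a, ha⟩ := natDegree_eq_zero.1 (hk.trans h0)
            rw [← ha] at hne hξ
            simp only [map_C, eval_C] at hne hξ
            rw [hξ] at hne; simp at hne
          · exact hC.root g hg
        · exact HasCtr.step ev hev (by omega) T L hT hL (by rwa [hk]) (by rwa [hk]) G hG
    intro L hL hLd G hG
    have e : L = {g ∈ L | g.natDegree < k} ∪ {g ∈ L | g.natDegree = k} := by
      ext g; simp only [Set.mem_union, Set.mem_ofPred_eq]
      constructor
      · intro hg; have := hLd g hg; rcases Nat.lt_or_ge g.natDegree k with h | h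
        · exact Or.inl ⟨hg, h⟩
        · exact Or.inr ⟨hg, by omega⟩
      · rintro (h | h) <;> exact h.1
    rw [e]
    exact key _ (hL.subset (Set.sep_subset _ _)) (fun g hg => hg.2) _ (hL.subset (Set.sep_subset _ _))
      (fun g hg => hg.2) G hG

theorem hasCtr (hev : ∀ a, B.RVT (fun ω => ev ω a)) (H G : Set A[X]) (hH : H.Finite) (hG : G.Finite) :
    HasCtr ev H G := by
  obtain ⟨k, hk⟩ := (hH.image natDegree).bddAbove
  exact hasCtr_aux ev hev (k + 1) H hH (fun g hg => Nat.lt_succ_of_le (hk ⟨g, hg, rfl⟩)) G hG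

end centers
end Base
end LSZ

/-! ### Part 10 -/
namespace LSZ
open Polynomial

section padic
variable {p : ℕ} [Fact p.Prime]

lemma cell_const {f : ℚ_[p][X]} {D : ℕ} (hD : f.natDegree ≤ D) {c s s' : ℚ_[p]} (hs : s ≠ 0)
    (hroot : ∀ i, hasseDeriv i f ≠ 0 → ∀ ξ, (hasseDeriv i f).eval ξ = 0 → ‖s‖ ≤ ‖c + s - ξ‖)
    {n : ℕ} (hn : n ≠ 0) (hcl : ‖s - s'‖ < ‖((ncM D * n : ℕ) : ℚ_[p])‖ * ‖s‖) :
    (f.eval (c + s)).valuation = (f.eval (c + s')).valuation ∧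
      ∀ k, k ∣ n → acr k (f.eval (c + s)) = acr k (f.eval (c + s')) := by
  have hnc : ∀ j, ‖(ncM D : ℚ_[p])‖ * ‖(hasseDeriv j f).eval c * s ^ j‖ ≤ ‖f.eval (c + s)‖ := by
    intro j
    have := nc hD (c := c) (t := c + s) (by
      intro i _ hne ξ hξ
      rw [add_sub_cancel_left]; exact hroot i hne ξ hξ) j
    rwa [add_sub_cancel_left] at this
  have hM : 0 < ‖(ncM D : ℚ_[p])‖ := nat_norm_pos (ncM_ne D)
  have hnn : 0 < ‖(n : ℚ_[p])‖ := nat_norm_pos hn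
  by_cases h0 : f.eval (c + s) = 0
  · have hz : ∀ j, (hasseDeriv j f).eval c = 0 := by
      intro j
      have h1 := hnc j
      rw [h0, norm_zero] at h1
      have h2 : ‖(hasseDeriv j f).eval c * s ^ j‖ ≤ 0 := by
        by_contra hcon
        exact absurd h1 (not_le.2 (mul_pos hM (not_le.1 hcon)))
      exact (mul_eq_zero.1 (norm_le_zero_iff.1 h2)).resolve_right (pow_ne_zero _ hs)
    have : f.eval (c + s') = 0 := by
      rw [taylor_sum f hD]; simp [hz]
    rw [h0, this]; simp
  · have hlt : ‖s - s'‖ < ‖s‖ := hcl.trans_le (mul_le_of_le_one_left (norm_nonneg _) (nat_norm_le _))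
    have hss := norm_eq_of_close hlt
    have key : ‖f.eval (c + s) - f.eval (c + s')‖ < ‖(n : ℚ_[p])‖ * ‖f.eval (c + s)‖ := by
      rw [taylor_sum f hD c s', taylor_sum f hD c s, ← Finset.sum_sub_distrib, ← taylor_sum f hD c s]
      refine um_sum_lt _ _ (mul_pos hnn (norm_pos_iff.2 h0)) fun j _ => ?_
      rw [← mul_sub]
      rcases Nat.eq_zero_or_pos j with rfl | hj
      · simp only [pow_zero, sub_self, mul_zero, norm_zero]
        exact mul_pos hnn (norm_pos_iff.2 h0)
      by_cases hz : (hasseDeriv j f).eval c = 0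
      · rw [hz, zero_mul, norm_zero]; exact mul_pos hnn (norm_pos_iff.2 h0)
      have hpow : ‖s ^ j - s' ^ j‖ ≤ ‖s - s'‖ * ‖s‖ ^ (j - 1) := by
        rw [← geom_sum₂_mul, norm_mul, mul_comm]
        refine mul_le_mul_of_nonneg_left ?_ (norm_nonneg _)
        refine um_sum_le _ _ (by positivity) fun i hi => ?_
        rw [norm_mul, norm_pow, norm_pow, hss, ← pow_add]
        have := Finset.mem_range.1 hi
        rw [show i + (j - 1 - i) = j - 1 by omega]
      have hz' := norm_pos_iff.2 hz
      have hsp := norm_pos_iff.2 hs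
      calc ‖(hasseDeriv j f).eval c * (s ^ j - s' ^ j)‖
          ≤ ‖(hasseDeriv j f).eval c‖ * (‖s - s'‖ * ‖s‖ ^ (j - 1)) := by
            rw [norm_mul]; gcongr
        _ < ‖(hasseDeriv j f).eval c‖ * (‖((ncM D * n : ℕ) : ℚ_[p])‖ * ‖s‖ * ‖s‖ ^ (j - 1)) := by
            gcongr
        _ = ‖(n : ℚ_[p])‖ * (‖(ncM D : ℚ_[p])‖ * ‖(hasseDeriv j f).eval c * s ^ j‖) := by
            rw [Nat.cast_mul, norm_mul, norm_mul, norm_pow]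
            obtain ⟨j', rfl⟩ : ∃ j', j = j' + 1 := ⟨j - 1, by omega⟩
            rw [add_tsub_cancel_right, pow_succ]; ring
        _ ≤ _ := by gcongr; exact hnc j
    refine ⟨(close_rv hn key).1, fun k hk => ?_⟩
    refine (close_rv (ne_zero_of_dvd_ne_zero hn hk) (key.trans_le ?_)).2
    exact mul_le_mul_of_nonneg_right (nat_norm_le_of_dvd hk) (norm_nonneg _)

lemma unit_nat_ne {σ : ℕ} (hσ : ‖(σ : ℚ_[p])‖ = 1) : (σ : ℚ_[p]) ≠ 0 := by
  intro h0; rw [h0] at hσ; simp at hσ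

lemma val_zpow_mul {γ : ℤ} {σ : ℕ} (hσ : ‖(σ : ℚ_[p])‖ = 1) :
    ((p : ℚ_[p]) ^ γ * (σ : ℚ_[p])).valuation = γ := by
  have h1 : ‖(p : ℚ_[p]) ^ γ * (σ : ℚ_[p])‖ = ‖(p : ℚ_[p]) ^ γ‖ := by rw [norm_mul, hσ, mul_one]
  rw [valuation_eq_of_norm_eq (mul_ne_zero (zpow_ne_zero _ p_ne) (unit_nat_ne hσ)) h1, Padic.valuation_zpow,
    Padic.valuation_p, mul_one]

lemma acr_zpow_mul {n : ℕ} (hn : n ≠ 0) {γ : ℤ} {σ : ℕ} (hσ : ‖(σ : ℚ_[p])‖ = 1) (hlt : σ < p ^ lev p n) :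
    acr n ((p : ℚ_[p]) ^ γ * (σ : ℚ_[p])) = σ := by
  rw [acr, ac, val_zpow_mul hσ, mul_right_comm, ← zpow_add₀ p_ne]
  simp only [add_neg_cancel, zpow_zero, one_mul]
  refine res_unique hn hlt ?_
  rw [sub_self, norm_zero]; exact nat_norm_pos hn

end padic

namespace Base
variable {B : Base}

lemma aff_local {E : Set B.I} {l : B.Ω → ℤ} (hl : l ∈ (B.restrict E).Aff) {ω ω' : B.Ω}
    (h : ∀ i ∈ E, (B.u i ω).valuation = (B.u i ω').valuation) : l ω = l ω' := by
  refine AddSubgroup.closure_induction (p := fun (l : B.Ω → ℤ) _ => l ω = l ω') ?_ ?_ ?_ ?_ hl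
  · rintro l (rfl | ⟨i, rfl⟩)
    · rfl
    · exact h i.1 i.2
  · rfl
  · intro f g _ _ h1 h2; simp [h1, h2]
  · intro f _ h1; simp [h1]

/-- agreement up to level n on coordinates in E -/
def Loc (B : Base) (E : Set B.I) (n : ℕ) (ω ω' : B.Ω) : Prop :=
  B.pr ω = B.pr ω' ∧ B.s ω = B.s ω' ∧ ∀ i ∈ E, (B.u i ω).valuation = (B.u i ω').valuation ∧
    ∀ k, k ∣ n → acr k (B.u i ω) = acr k (B.u i ω')

lemma Loc.of_dvd {E : Set B.I} {n n' : ℕ} (h : n ∣ n') {ω ω' : B.Ω} (hl : B.Loc E n' ω ω') : B.Loc E n ω ω' :=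
  ⟨hl.1, hl.2.1, fun i hi => ⟨(hl.2.2 i hi).1, fun k hk => (hl.2.2 i hi).2 k (hk.trans h)⟩⟩

lemma TameT.local {E : Set B.I} {T : Type*} {f : B.Ω → T} (hf : (B.restrict E).TameT f) :
    ∃ n, n ≠ 0 ∧ ∀ ω ω', B.Loc E n ω ω' → f ω = f ω' := by
  obtain ⟨F, hF, hb, h⟩ := hf
  have : Finite F := hF
  have := Fintype.ofFinite F
  have key : ∀ ψ : F, ∃ n, n ≠ 0 ∧ ∀ ω ω', B.Loc E n ω ω' → ψ.1 ω = ψ.1 ω' := by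
    intro ψ
    obtain ⟨ψ, hψ⟩ := ψ
    rcases (hb ψ hψ).elim with ⟨i, k, hk, rfl⟩ | ⟨l, k, hl, hk, rfl⟩ | ⟨l, hl, rfl⟩
    · refine ⟨k, hk, fun ω ω' hl => ?_⟩
      have := (hl.2.2 i.1 i.2).2 k dvd_rfl
      simpa using this
    · refine ⟨1, one_ne_zero, fun ω ω' hl' => ?_⟩
      simp only [aff_local hl (fun i hi => (hl'.2.2 i hi).1)]
    · refine ⟨1, one_ne_zero, fun ω ω' hl' => ?_⟩
      simp only [aff_local hl (fun i hi => (hl'.2.2 i hi).1)]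
  choose n hn hl using key
  refine ⟨∏ ψ, n ψ, Finset.prod_ne_zero_iff.2 fun ψ _ => hn ψ, fun ω ω' hloc => ?_⟩
  refine h ω ω' ⟨hloc.1, hloc.2.1, fun ψ hψ => ?_⟩
  exact hl ⟨ψ, hψ⟩ ω ω' (hloc.of_dvd (Finset.dvd_prod_of_mem _ (Finset.mem_univ _)))

lemma TameZ.local {E : Set B.I} {f : B.Ω → ℤ} (hf : (B.restrict E).TameZ f) :
    ∃ n, n ≠ 0 ∧ ∀ ω ω', B.Loc E n ω ω' → f ω = f ω' := by
  obtain ⟨k, κ, l, D, hD, hκ, hl, h⟩ := hf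
  obtain ⟨n, hn, hloc⟩ := hκ.local
  refine ⟨n, hn, fun ω ω' hω => ?_⟩
  have h1 := h ω
  rw [hloc ω ω' hω, aff_local (hl _) (fun i hi => (hω.2.2 i hi).1), ← h ω'] at h1
  exact mul_left_cancel₀ hD.ne' h1

section own
variable {N : ℕ} (c : Fin N → (ω : B.Ω) → ℚ_[B.pr ω]) (L : ℕ)

/-- the ball of radius L p^γ around c_a + p^γ σ is owned by c_a -/
def Own (a : Fin N) (ω : B.Ω) (γ : ℤ) (σ : ℕ) : Prop :=
  (σ < (B.pr ω : ℕ) ^ lev (B.pr ω) L ∧ ‖(σ : ℚ_[B.pr ω])‖ = 1) ∧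
  Near c a ω (((B.pr ω : ℕ) : ℚ_[B.pr ω]) ^ γ * σ) ∧
  ∀ b, b < a → ‖((B.pr ω : ℕ) : ℚ_[B.pr ω]) ^ γ * σ‖ < ‖c a ω - c b ω‖

variable {c L}

lemma Own.ne {a : Fin N} {ω : B.Ω} {γ : ℤ} {σ : ℕ} (h : Own c L a ω γ σ) :
    ((B.pr ω : ℕ) : ℚ_[B.pr ω]) ^ γ * σ ≠ 0 :=
  mul_ne_zero (zpow_ne_zero _ p_ne) (unit_nat_ne h.1.2)

lemma own_exists (hL : L ≠ 0) (hN : 0 < N) (ω : B.Ω) (t : ℚ_[B.pr ω]) (ht : ∀ a, t ≠ c a ω) :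
    ∃ a γ σ, Own c L a ω γ σ ∧
      ‖((B.pr ω : ℕ) : ℚ_[B.pr ω]) ^ γ * σ - (t - c a ω)‖ <
        ‖(L : ℚ_[B.pr ω])‖ * ‖((B.pr ω : ℕ) : ℚ_[B.pr ω]) ^ γ * σ‖ := by
  classical
  have : Nonempty (Fin N) := ⟨⟨0, hN⟩⟩
  let M : Finset (Fin N) := Finset.univ.filter fun a => Near c a ω (t - c a ω)
  have hM : M.Nonempty := by
    obtain ⟨a, ha⟩ := exists_near c ω t
    exact ⟨a, by simpa [M] using ha⟩
  let a := M.min' hM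
  have ha : Near c a ω (t - c a ω) := by
    have := M.min'_mem hM
    exact (Finset.mem_filter.1 this).2
  have hmin : ∀ b, b < a → ¬ Near c b ω (t - c b ω) := by
    intro b hb hnear
    have := M.min'_le b (by simpa [M] using hnear)
    exact absurd hb (not_lt.2 this)
  set s' := t - c a ω with hs'
  have hne : s' ≠ 0 := sub_ne_zero.2 (ht a)
  have hσ : ‖((acr L s' : ℕ) : ℚ_[B.pr ω])‖ = 1 := norm_acr hL hne
  have hcl := close_of_rv hL hne (val_zpow_mul (γ := s'.valuation) hσ).symm
    (acr_zpow_mul hL (γ := s'.valuation) hσ (acr_lt _ _)).symm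
  have hcl1 := hcl.trans_le (mul_le_of_le_one_left (norm_nonneg _) (nat_norm_le _))
  have hss := norm_eq_of_close hcl1
  refine ⟨a, s'.valuation, acr L s', ⟨⟨acr_lt _ _, hσ⟩, fun b => (near_transfer (ha b) hcl1).1, ?_⟩, ?_⟩
  · intro b hb
    rw [hss]
    by_contra hcon
    push Not at hcon
    apply hmin b hb
    intro b'
    have h1 : ‖t - c b ω‖ ≤ ‖s'‖ := by
      rw [show t - c b ω = s' + (c a ω - c b ω) by rw [hs']; ring]
      exact um_add_le le_rfl hcon
    refine h1.trans ((ha b').trans_eq ?_)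
    rw [hs']; congr 1; ring
  · rw [norm_sub_rev, hss]; exact hcl

lemma own_unique (hL : L ≠ 0) {ω : B.Ω} {t : ℚ_[B.pr ω]} {a a' : Fin N} {γ γ' : ℤ} {σ σ' : ℕ}
    (h : Own c L a ω γ σ) (h' : Own c L a' ω γ' σ')
    (hb : ‖((B.pr ω : ℕ) : ℚ_[B.pr ω]) ^ γ * σ - (t - c a ω)‖ <
        ‖(L : ℚ_[B.pr ω])‖ * ‖((B.pr ω : ℕ) : ℚ_[B.pr ω]) ^ γ * σ‖)
    (hb' : ‖((B.pr ω : ℕ) : ℚ_[B.pr ω]) ^ γ' * σ' - (t - c a' ω)‖ <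
        ‖(L : ℚ_[B.pr ω])‖ * ‖((B.pr ω : ℕ) : ℚ_[B.pr ω]) ^ γ' * σ'‖) : a = a' ∧ γ = γ' ∧ σ = σ' := by
  have key : ∀ {a : Fin N} {γ : ℤ} {σ : ℕ}, Own c L a ω γ σ →
      ‖((B.pr ω : ℕ) : ℚ_[B.pr ω]) ^ γ * σ - (t - c a ω)‖ <
        ‖(L : ℚ_[B.pr ω])‖ * ‖((B.pr ω : ℕ) : ℚ_[B.pr ω]) ^ γ * σ‖ →
      (∀ b, ‖t - c a ω‖ ≤ ‖t - c b ω‖) ∧ (∀ b, b < a → ‖t - c a ω‖ < ‖t - c b ω‖) := by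
    intro a γ σ h hb
    have hcl1 := hb.trans_le (mul_le_of_le_one_left (norm_nonneg _) (nat_norm_le _))
    have hss := norm_eq_of_close hcl1
    refine ⟨fun b => ?_, fun b hb' => ?_⟩
    · have := (near_transfer (h.2.1 b) hcl1).1
      rwa [show t - c a ω + (c a ω - c b ω) = t - c b ω by ring] at this
    · have h3 := h.2.2 b hb'
      rw [← hss] at h3
      have := um_dom h3
      rw [show c a ω - c b ω + (t - c a ω) = t - c b ω by ring] at this
      rw [this]; exact h3
  have k1 := key h hb
  have k2 := key h' hb'
  have ha : a = a' := by
    rcases lt_trichotomy a a' with hlt | he | hlt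
    · exact absurd (k2.2 a hlt) (not_lt.2 (k1.1 a'))
    · exact he
    · exact absurd (k1.2 a' hlt) (not_lt.2 (k2.1 a))
  subst ha
  have r1 := close_rv hL hb
  have r2 := close_rv hL hb'
  refine ⟨rfl, ?_, ?_⟩
  · rw [← val_zpow_mul (γ := γ) h.1.2, ← val_zpow_mul (γ := γ') h'.1.2, r1.1, r2.1]
  · rw [← acr_zpow_mul hL (γ := γ) h.1.2 h.1.1, ← acr_zpow_mul hL (γ := γ') h'.1.2 h'.1.1, r1.2, r2.2]

end own
end Base
end LSZ

/-! ### Part 11 -/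
namespace LSZ
open Polynomial

namespace Base

/-- evaluation of integer polynomials at a p-adic point -/
noncomputable abbrev mev {m : ℕ} {p : ℕ} [Fact p.Prime] (x : Fin m → ℚ_[p]) : MvPolynomial (Fin m) ℤ →+* ℚ_[p] :=
  MvPolynomial.eval₂Hom (Int.castRingHom _) x

lemma mev_cons {m : ℕ} {p : ℕ} [Fact p.Prime] (t : ℚ_[p]) (x : Fin m → ℚ_[p]) (f : MvPolynomial (Fin (m + 1)) ℤ) :
    mev (Fin.cons t x : Fin (m + 1) → ℚ_[p]) f = ((MvPolynomial.finSuccEquiv ℤ m f).map (mev x)).eval t := by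
  have : mev (Fin.cons t x : Fin (m + 1) → ℚ_[p]) = ((evalRingHom t).comp (mapRingHom (mev x))).comp
      (MvPolynomial.finSuccEquiv ℤ m : MvPolynomial (Fin (m + 1)) ℤ →+* _) := by
    refine MvPolynomial.ringHom_ext (fun r => ?_) (fun i => ?_)
    · simp
    · refine Fin.cases ?_ (fun j => ?_) i
      · simp [MvPolynomial.finSuccEquiv_X_zero]
      · simp [MvPolynomial.finSuccEquiv_X_succ]
  rw [this]; rfl

/-- the concrete parameter spaces -/
noncomputable abbrev BB (m q : ℕ) (S : Type) : Base where
  Ω := (p : Nat.Primes) × ((Fin m → ℚ_[p]) × (Fin q → ℤ) × S)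
  pr := fun ω => ω.1
  I := MvPolynomial (Fin m) ℤ ⊕ Fin q
  u := fun i ω => Sum.elim (fun f => mev ω.2.1 f) (fun j => ((ω.1 : ℕ) : ℚ_[ω.1]) ^ ω.2.2.1 j) i
  S := S
  s := fun ω => ω.2.2.2

variable {m q : ℕ} {S : Type}

abbrev fg (ω : (BB m (q + 1) (S × ℕ)).Ω) : (BB m q S).Ω := ⟨ω.1, ω.2.1, Fin.tail ω.2.2.1, ω.2.2.2.1⟩

abbrev addc (ω : (BB m q S).Ω) (t : ℚ_[ω.1]) : (BB (m + 1) q S).Ω := ⟨ω.1, Fin.cons t ω.2.1, ω.2.2.1, ω.2.2.2⟩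

lemma fg_tameT {T : Type*} {f : (BB m q S).Ω → T} (hf : (BB m q S).TameT f) :
    (BB m (q + 1) (S × ℕ)).TameT (fun ω => f (fg ω)) := by
  refine TameT.comp (B₁ := BB m (q + 1) (S × ℕ)) (B₂ := BB m q S) fg TameT.pr
    ((TameT.label (B := BB m (q + 1) (S × ℕ))).map Prod.fst) ?_ ?_ hf
  · rintro (f | j)
    · exact (RVT.coord (B := BB m (q + 1) (S × ℕ)) (Sum.inl f)).1
    · exact (RVT.coord (B := BB m (q + 1) (S × ℕ)) (Sum.inr j.succ)).1
  · rintro (f | j)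
    · exact (RVT.coord (B := BB m (q + 1) (S × ℕ)) (Sum.inl f)).2
    · exact (RVT.coord (B := BB m (q + 1) (S × ℕ)) (Sum.inr j.succ)).2

lemma fg_tameZ {f : (BB m q S).Ω → ℤ} (hf : (BB m q S).TameZ f) :
    (BB m (q + 1) (S × ℕ)).TameZ (fun ω => f (fg ω)) := by
  refine TameZ.comp (B₁ := BB m (q + 1) (S × ℕ)) (B₂ := BB m q S) fg TameT.pr
    ((TameT.label (B := BB m (q + 1) (S × ℕ))).map Prod.fst) ?_ ?_ hf
  · rintro (f | j)
    · exact (RVT.coord (B := BB m (q + 1) (S × ℕ)) (Sum.inl f)).1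
    · exact (RVT.coord (B := BB m (q + 1) (S × ℕ)) (Sum.inr j.succ)).1
  · rintro (f | j)
    · exact (RVT.coord (B := BB m (q + 1) (S × ℕ)) (Sum.inl f)).2
    · exact (RVT.coord (B := BB m (q + 1) (S × ℕ)) (Sum.inr j.succ)).2

lemma fg_rvt {w : (ω : (BB m q S).Ω) → ℚ_[ω.1]} (hw : (BB m q S).RVT w) :
    (BB m (q + 1) (S × ℕ)).RVT (fun ω => w (fg ω)) := ⟨fg_tameZ hw.1, fun k hk => fg_tameT (hw.2 k hk)⟩

/-- the last discrete coordinate is tame -/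
lemma gam_tameZ (j : Fin q) : (BB m q S).TameZ (fun ω => ω.2.2.1 j) := by
  have := (RVT.coord (B := BB m q S) (Sum.inr j)).1
  simpa [RVT.val_zpow] using this

section cells
variable {N : ℕ} (c : Fin N → (ω : (BB m q S).Ω) → ℚ_[ω.1]) (L : ℕ)

abbrev OwnP (a : Fin N) (ω : (BB m (q + 1) (S × ℕ)).Ω) : Prop :=
  Own (B := BB m q S) c L a (fg ω) (ω.2.2.1 0) ω.2.2.2.2

noncomputable abbrev pt (a : Fin N) (ω : (BB m (q + 1) (S × ℕ)).Ω) : (BB (m + 1) q S).Ω :=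
  addc (fg ω) (c a (fg ω) + ((ω.1 : ℕ) : ℚ_[ω.1]) ^ ω.2.2.1 0 * (ω.2.2.2.2 : ℚ_[ω.1]))

end cells

theorem cells (E : Set (MvPolynomial (Fin (m + 1)) ℤ)) (hE : E.Finite) (n : ℕ) (hn : n ≠ 0) :
    ∃ (N : ℕ) (c : Fin N → (ω : (BB m q S).Ω) → ℚ_[ω.1]) (L : ℕ), 0 < N ∧ L ≠ 0 ∧
      (∀ a, (BB m (q + 1) (S × ℕ)).TameT (OwnP c L a)) ∧
      (∀ a, ∀ i ∈ Sum.inl '' E ∪ Set.range Sum.inr, ((BB m (q + 1) (S × ℕ)).sub (OwnP c L a)).RVT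
        (fun ω => (BB (m + 1) q S).u i (pt c a ω.1))) ∧
      (∀ a ω γ σ, Own (B := BB m q S) c L a ω γ σ → ∀ t : ℚ_[ω.1],
        ‖((ω.1 : ℕ) : ℚ_[ω.1]) ^ γ * (σ : ℚ_[ω.1]) - (t - c a ω)‖ <
          ‖(L : ℚ_[ω.1])‖ * ‖((ω.1 : ℕ) : ℚ_[ω.1]) ^ γ * (σ : ℚ_[ω.1])‖ →
        (BB (m + 1) q S).Loc (Sum.inl '' E ∪ Set.range Sum.inr) n
          (addc ω (c a ω + ((ω.1 : ℕ) : ℚ_[ω.1]) ^ γ * (σ : ℚ_[ω.1]))) (addc ω t)) := by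
  classical
  let ev : ∀ ω : (BB m q S).Ω, MvPolynomial (Fin m) ℤ →+* ℚ_[(BB m q S).pr ω] := fun ω => mev ω.2.1
  have hev : ∀ a, (BB m q S).RVT (fun ω => ev ω a) := fun a => RVT.coord (B := BB m q S) (Sum.inl a)
  let E' : Set (MvPolynomial (Fin m) ℤ)[X] := MvPolynomial.finSuccEquiv ℤ m '' E
  have hE' : E'.Finite := hE.image _
  obtain ⟨D, hD⟩ := (hE'.image natDegree).bddAbove
  have hD : ∀ h ∈ E', h.natDegree ≤ D := fun h hh => hD ⟨h, hh, rfl⟩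
  let H : Set (MvPolynomial (Fin m) ℤ)[X] := (fun x : ℕ × (MvPolynomial (Fin m) ℤ)[X] => hasseDeriv x.1 x.2) ''
    (Set.Iic D ×ˢ E')
  have hH : H.Finite := ((Set.finite_Iic _).prod hE').image _
  obtain ⟨ι, hι, hι', c0, hC0⟩ := hasCtr ev hev H H hH hH
  obtain ⟨N, ⟨e⟩⟩ := Finite.exists_equiv_fin ι
  have hN : 0 < N := Fin.pos (e hι'.some)
  let c : Fin N → (ω : (BB m q S).Ω) → ℚ_[(BB m q S).pr ω] := fun a => c0 (e.symm a)
  have hC : Ctr ev c H H := ⟨fun h hh ω hne ξ hξ => by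
    obtain ⟨a, ha⟩ := hC0.root h hh ω hne ξ hξ
    exact ⟨e a, by simpa [c] using ha⟩, fun a b => hC0.diff _ _, fun g hg a => hC0.val g hg _⟩
  have hhasse : ∀ h ∈ E', ∀ i ω, D < i → hasseDeriv i (h.map (ev ω)) = 0 := fun h hh i ω hi =>
    hasseDeriv_eq_zero_of_lt_natDegree _ _ (lt_of_le_of_lt (natDegree_map_le.trans (hD h hh)) hi)
  have hval : ∀ h ∈ E', ∀ i a, (BB m q S).RVT (fun ω => (hasseDeriv i (h.map (ev ω))).eval (c a ω)) := by
    intro h hh i a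
    by_cases hi : i ≤ D
    · simpa only [hasse_map] using hC.val _ ⟨(i, h), ⟨hi, hh⟩, rfl⟩ a
    · simp only [hhasse h hh i _ (not_le.1 hi), eval_zero]; exact RVT.zero
  have hcov : ∀ h ∈ E', ∀ ω a s, Near c a ω s → ∀ i, hasseDeriv i (h.map (ev ω)) ≠ 0 →
      ∀ ξ, (hasseDeriv i (h.map (ev ω))).eval ξ = 0 → ‖s‖ ≤ ‖c a ω + s - ξ‖ := by
    intro h hh ω a s hnear i hne ξ hξ
    have hi : i ≤ D := by
      by_contra hi; exact hne (hhasse h hh i ω (not_le.1 hi))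
    rw [hasse_map] at hne hξ
    obtain ⟨b, rfl⟩ := hC.root _ ⟨(i, h), ⟨hi, hh⟩, rfl⟩ ω hne ξ hξ
    have := hnear b
    rwa [show s + (c a ω - c b ω) = c a ω + s - c b ω by ring] at this
  let L := ncM D * n
  have hL : L ≠ 0 := mul_ne_zero (ncM_ne D) hn
  let B' := BB m (q + 1) (S × ℕ)
  let valid : B'.Ω → Prop := fun ω => ω.2.2.2.2 < (ω.1 : ℕ) ^ lev ω.1 L ∧ ‖((ω.2.2.2.2 : ℕ) : ℚ_[ω.1])‖ = 1
  have hvalid : B'.TameT valid :=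
    (TameT.pr (B := B')).map₂ (TameT.label (B := B')) (fun p s => s.2 < (p : ℕ) ^ lev p L ∧ ‖((s.2 : ℕ) : ℚ_[p])‖ = 1)
  let σ' : B'.Ω → ℕ := fun ω => if valid ω then ω.2.2.2.2 else 1
  have hσ' : B'.TameT σ' := TameT.ite hvalid ((TameT.label (B := B')).map Prod.snd) (TameT.const 1)
  have hσ1 : ∀ ω : B'.Ω, ‖((σ' ω : ℕ) : ℚ_[B'.pr ω])‖ = 1 := by
    intro ω
    simp only [σ']
    split_ifs with hx
    · exact hx.2
    · simp
  let s : (ω : B'.Ω) → ℚ_[B'.pr ω] := fun ω => ((ω.1 : ℕ) : ℚ_[ω.1]) ^ ω.2.2.1 0 * (σ' ω : ℚ_[ω.1])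
  have hs : B'.RVT s := (RVT.zpow_p (B := B') (gam_tameZ (m := m) (S := S × ℕ) (0 : Fin (q + 1)))).mul (RVT.unit_nat hσ' hσ1)
  have hsv : ∀ ω, valid ω → s ω = ((ω.1 : ℕ) : ℚ_[ω.1]) ^ ω.2.2.1 0 * (ω.2.2.2.2 : ℚ_[ω.1]) := by
    intro ω hω; simp only [s, σ', if_pos hω]
  have hown : ∀ a, B'.TameT (OwnP c L a) := by
    intro a
    have h1 := hvalid.and ((Near.tame (B := B') (c := fun b ω => c b (fg ω)) (fun a b => fg_rvt (hC.diff a b)) a hs).and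
      (TameT.all (ι := {b // b < a}) fun b => RVT.norm_lt (B := B') hs (fg_rvt (hC.diff a b.1))))
    refine (congrArg B'.TameT ?_).mp h1
    funext ω
    apply propext
    constructor
    · rintro ⟨h1, h2, h3⟩
      rw [hsv ω h1] at h2 h3
      exact ⟨h1, h2, fun b hb => h3 ⟨b, hb⟩⟩
    · rintro ⟨h1, h2, h3⟩
      refine ⟨h1, ?_⟩
      rw [hsv ω h1]
      exact ⟨h2, fun b => h3 b.1 b.2⟩
  refine ⟨N, c, L, hN, hL, hown, ?_, ?_⟩
  · rintro a i (⟨f, hf, rfl⟩ | ⟨j, rfl⟩)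
    · have hh : MvPolynomial.finSuccEquiv ℤ m f ∈ E' := ⟨f, hf, rfl⟩
      have h1 := RVT.eval (B := B') (f := fun ω => (MvPolynomial.finSuccEquiv ℤ m f).map (ev (fg ω))) (D := D)
        (fun ω => natDegree_map_le.trans (hD _ hh)) (c := fun ω => c a (fg ω)) (s := s) hs
        (fun i => fg_rvt (hval _ hh i a)) (hown a) (by
          intro ω hω i hne ξ hξ
          refine hcov _ hh (fg ω) a _ ?_ i hne ξ hξ
          rw [hsv ω hω.1]; exact hω.2.1)
      have h2 := h1.sub (P := OwnP c L a)
      refine (congrArg ((BB m (q + 1) (S × ℕ)).sub (OwnP c L a)).RVT ?_).mp h2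
      funext ω
      rw [if_pos ω.2, hsv ω.1 ω.2.1]
      exact (mev_cons _ _ _).symm
    · exact (RVT.coord (B := B') (Sum.inr j.succ)).sub
  · intro a ω γ σ ho t ht
    refine ⟨rfl, rfl, ?_⟩
    rintro i (⟨f, hf, rfl⟩ | ⟨j, rfl⟩)
    · have hh : MvPolynomial.finSuccEquiv ℤ m f ∈ E' := ⟨f, hf, rfl⟩
      have := cell_const (f := (MvPolynomial.finSuccEquiv ℤ m f).map (ev ω)) (natDegree_map_le.trans (hD _ hh))
        (c := c a ω) ho.ne (hcov _ hh ω a _ ho.2.1) hn ht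
      simp only [Sum.elim_inl, mev_cons]
      rw [add_sub_cancel] at this
      exact this
    · exact ⟨rfl, fun k _ => rfl⟩

end Base
end LSZ

/-! ### Part 12 -/
namespace LSZ
open Polynomial

namespace Base
variable {m q : ℕ} {S : Type}

theorem cells_tame {pred : (BB (m + 1) q S).Ω → Prop} {e g : (BB (m + 1) q S).Ω → ℤ}
    (hpred : (BB (m + 1) q S).TameT pred) (he : (BB (m + 1) q S).TameZ e) (hg : (BB (m + 1) q S).TameZ g) :
    ∃ (N : ℕ) (c : Fin N → (ω : (BB m q S).Ω) → ℚ_[ω.1]) (L : ℕ)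
      (pred' : Fin N → (BB m (q + 1) (S × ℕ)).Ω → Prop) (e' g' : Fin N → (BB m (q + 1) (S × ℕ)).Ω → ℤ),
      0 < N ∧ L ≠ 0 ∧ (∀ a, (BB m (q + 1) (S × ℕ)).TameT (pred' a)) ∧
      (∀ a, (BB m (q + 1) (S × ℕ)).TameZ (e' a)) ∧ (∀ a, (BB m (q + 1) (S × ℕ)).TameZ (g' a)) ∧
      (∀ a ω, pred' a ω ↔ OwnP c L a ω ∧ pred (pt c a ω)) ∧
      (∀ a ω, OwnP c L a ω → g' a ω = g (pt c a ω) ∧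
        e' a ω = e (pt c a ω) + (ω.2.2.1 0 + (lev ω.1 L : ℤ))) ∧
      (∀ a ω γ σ, Own (B := BB m q S) c L a ω γ σ → ∀ t : ℚ_[ω.1],
        ‖((ω.1 : ℕ) : ℚ_[ω.1]) ^ γ * (σ : ℚ_[ω.1]) - (t - c a ω)‖ <
          ‖(L : ℚ_[ω.1])‖ * ‖((ω.1 : ℕ) : ℚ_[ω.1]) ^ γ * (σ : ℚ_[ω.1])‖ →
        pred (addc ω t) = pred (addc ω (c a ω + ((ω.1 : ℕ) : ℚ_[ω.1]) ^ γ * (σ : ℚ_[ω.1]))) ∧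
        e (addc ω t) = e (addc ω (c a ω + ((ω.1 : ℕ) : ℚ_[ω.1]) ^ γ * (σ : ℚ_[ω.1]))) ∧
        g (addc ω t) = g (addc ω (c a ω + ((ω.1 : ℕ) : ℚ_[ω.1]) ^ γ * (σ : ℚ_[ω.1])))) := by
  classical
  obtain ⟨E1, hE1, h1⟩ := hpred.restrict
  obtain ⟨E2, hE2, h2⟩ := he.restrict
  obtain ⟨E3, hE3, h3⟩ := hg.restrict
  let E : Set (MvPolynomial (Fin (m + 1)) ℤ) := Sum.inl ⁻¹' (E1 ∪ E2 ∪ E3)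
  have hE : E.Finite := ((hE1.union hE2).union hE3).preimage Sum.inl_injective.injOn
  have hsub : E1 ∪ E2 ∪ E3 ⊆ Sum.inl '' E ∪ Set.range Sum.inr := by
    rintro (f | j) hx
    · exact Or.inl ⟨f, hx, rfl⟩
    · exact Or.inr ⟨j, rfl⟩
  have h1 := TameT.restrict_mono ((Set.subset_union_left.trans Set.subset_union_left).trans hsub) h1
  have h2 := TameZ.restrict_mono ((Set.subset_union_right.trans Set.subset_union_left).trans hsub) h2
  have h3 := TameZ.restrict_mono (Set.subset_union_right.trans hsub) h3
  obtain ⟨n1, hn1, l1⟩ := h1.local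
  obtain ⟨n2, hn2, l2⟩ := h2.local
  obtain ⟨n3, hn3, l3⟩ := h3.local
  obtain ⟨N, c, L, hN, hL, hown, hu, hloc⟩ := cells (q := q) (S := S) E hE (n1 * n2 * n3)
    (mul_ne_zero (mul_ne_zero hn1 hn2) hn3)
  have compT : ∀ a {T : Type} {f : (BB (m + 1) q S).Ω → T},
      ((BB (m + 1) q S).restrict (Sum.inl '' E ∪ Set.range Sum.inr)).TameT f →
      ((BB m (q + 1) (S × ℕ)).sub (OwnP c L a)).TameT (fun ω => f (pt c a ω.1)) := by
    intro a T f hf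
    refine TameT.comp (B₁ := (BB m (q + 1) (S × ℕ)).sub (OwnP c L a))
      (B₂ := (BB (m + 1) q S).restrict (Sum.inl '' E ∪ Set.range Sum.inr)) (fun ω => pt c a ω.1) TameT.pr
      ((TameT.label (B := (BB m (q + 1) (S × ℕ)).sub (OwnP c L a))).map Prod.fst)
      (fun i => (hu a i.1 i.2).1) (fun i => (hu a i.1 i.2).2) hf
  have compZ : ∀ a {f : (BB (m + 1) q S).Ω → ℤ},
      ((BB (m + 1) q S).restrict (Sum.inl '' E ∪ Set.range Sum.inr)).TameZ f →
      ((BB m (q + 1) (S × ℕ)).sub (OwnP c L a)).TameZ (fun ω => f (pt c a ω.1)) := by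
    intro a f hf
    refine TameZ.comp (B₁ := (BB m (q + 1) (S × ℕ)).sub (OwnP c L a))
      (B₂ := (BB (m + 1) q S).restrict (Sum.inl '' E ∪ Set.range Sum.inr)) (fun ω => pt c a ω.1) TameT.pr
      ((TameT.label (B := (BB m (q + 1) (S × ℕ)).sub (OwnP c L a))).map Prod.fst)
      (fun i => (hu a i.1 i.2).1) (fun i => (hu a i.1 i.2).2) hf
  have hlev : (BB m (q + 1) (S × ℕ)).TameZ (fun ω => (lev ω.1 L : ℤ)) := by
    refine TameZ.of_tameT ((TameT.pr (B := BB m (q + 1) (S × ℕ))).map (fun p => (lev p L : ℤ))) (b := L + 1) ?_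
    intro ω
    rw [Nat.abs_cast]
    have : padicValNat (ω.1 : ℕ) L ≤ L := by
      have hp : Fact ((ω.1 : ℕ)).Prime := ⟨ω.1.2⟩
      by_contra hcon
      have h1 := padicValNat_le_nat_log (p := (ω.1 : ℕ)) L
      have h2 := Nat.log_le_self (ω.1 : ℕ) L
      omega
    simp only [lev]
    exact_mod_cast Nat.succ_le_succ this
  refine ⟨N, c, L, fun a ω => if h : OwnP c L a ω then pred (pt c a ω) else False,
    fun a ω => (if h : OwnP c L a ω then e (pt c a ω) else 0) + (ω.2.2.1 0 + (lev ω.1 L : ℤ)),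
    fun a ω => if h : OwnP c L a ω then g (pt c a ω) else 0, hN, hL, ?_, ?_, ?_, ?_, ?_, ?_⟩
  · intro a
    exact TameT.extend (hown a) (compT a h1) False
  · intro a
    exact (TameZ.extend (hown a) (compZ a h2)).add ((gam_tameZ (m := m) (S := S × ℕ) (0 : Fin (q + 1))).add hlev)
  · intro a
    exact TameZ.extend (hown a) (compZ a h3)
  · intro a ω
    by_cases ho : OwnP c L a ω <;> simp [ho]
  · intro a ω ho
    simp [ho]
  · intro a ω γ σ ho t ht
    have hl := hloc a ω γ σ ho t ht
    exact ⟨(l1 _ _ (hl.of_dvd ⟨n2 * n3, by ring⟩)).symm, (l2 _ _ (hl.of_dvd ⟨n1 * n3, by ring⟩)).symm,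
      (l3 _ _ (hl.of_dvd ⟨n1 * n2, by ring⟩)).symm⟩

end Base
end LSZ

/-! ### Part 13 -/
namespace LSZ
open MeasureTheory

section meas
variable {p : ℕ} [Fact p.Prime]

noncomputable instance instMSPadic : MeasurableSpace ℚ_[p] := borel _
instance instBSPadic : BorelSpace ℚ_[p] := ⟨rfl⟩

noncomputable def unitBall (p : ℕ) [Fact p.Prime] : TopologicalSpace.PositiveCompacts ℚ_[p] where
  carrier := Metric.closedBall 0 1
  isCompact' := isCompact_closedBall _ _
  interior_nonempty' := ⟨0, Metric.ball_subset_interior_closedBall (by simp)⟩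

noncomputable instance instMeasPadic : MeasureSpace ℚ_[p] := ⟨Measure.addHaarMeasure (unitBall p)⟩

instance instHaarPadic : Measure.IsAddHaarMeasure (volume : Measure ℚ_[p]) :=
  inferInstanceAs (Measure.IsAddHaarMeasure (Measure.addHaarMeasure (unitBall p)))

instance instSFPadic : SigmaFinite (volume : Measure ℚ_[p]) := inferInstance
instance instNAPadic : NullSingletonClass (volume : Measure ℚ_[p]) := inferInstance

/-- the ball of valuation radius k -/
def Dk (x : ℚ_[p]) (k : ℤ) : Set ℚ_[p] := {y | ‖y - x‖ ≤ (p : ℝ) ^ (-k)}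

lemma Dk_eq (x : ℚ_[p]) (k : ℤ) : Dk x k = Metric.closedBall x ((p : ℝ) ^ (-k)) := by
  ext y; simp [Dk, dist_eq_norm]

lemma Dk_meas (x : ℚ_[p]) (k : ℤ) : MeasurableSet (Dk x k) := by
  rw [Dk_eq]; exact Metric.isClosed_closedBall.measurableSet

lemma Dk_trans (x : ℚ_[p]) (k : ℤ) : volume (Dk x k) = volume (Dk (0 : ℚ_[p]) k) := by
  have : Dk x k = (fun y => -x + y) ⁻¹' Dk 0 k := by
    ext y; simp [Dk, neg_add_eq_sub]
  rw [this, measure_preimage_add]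

lemma Dk_split (k : ℤ) : Dk (0 : ℚ_[p]) k = ⋃ j ∈ Finset.range p, Dk ((p : ℚ_[p]) ^ k * (j : ℚ_[p])) (k + 1) := by
  have hpz : ‖(p : ℚ_[p]) ^ k‖ = (p : ℝ) ^ (-k) := Padic.norm_p_zpow k
  have h1 : lev p 1 = 1 := by simp [lev]
  ext y
  simp only [Dk, sub_zero, Finset.mem_range, Set.mem_iUnion, exists_prop, Set.mem_ofPred_eq]
  constructor
  · intro hy
    set z := y * (p : ℚ_[p]) ^ (-k) with hz
    have hyz : y = (p : ℚ_[p]) ^ k * z := by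
      rw [hz, mul_left_comm, ← zpow_add₀ p_ne]; simp
    have hz1 : ‖z‖ ≤ 1 := by
      rw [hz, norm_mul, Padic.norm_p_zpow, neg_neg]
      calc _ ≤ (p : ℝ) ^ (-k) * (p : ℝ) ^ k := by
            gcongr
        _ = 1 := by rw [← zpow_add₀ p_pos.ne']; simp
    refine ⟨res 1 z, by simpa [h1] using res_lt 1 z, ?_⟩
    rw [← norm_lt_zpow_iff, hyz, ← mul_sub, norm_mul, hpz]
    have := res_spec one_ne_zero hz1
    simp only [Nat.cast_one, norm_one] at this
    exact mul_lt_of_lt_one_right (zpow_pos p_pos _) this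
  · rintro ⟨j, hj, hy⟩
    rw [← norm_lt_zpow_iff] at hy
    have : y = (y - (p : ℚ_[p]) ^ k * (j : ℚ_[p])) + (p : ℚ_[p]) ^ k * (j : ℚ_[p]) := by ring
    rw [this]
    refine um_add_le hy.le ?_
    rw [norm_mul, hpz]
    exact mul_le_of_le_one_right (zpow_nonneg p_pos.le _) (nat_norm_le j)

lemma Dk_step (k : ℤ) : volume (Dk (0 : ℚ_[p]) k) = p * volume (Dk (0 : ℚ_[p]) (k + 1)) := by
  have h1 : lev p 1 = 1 := by simp [lev]
  rw [Dk_split, measure_biUnion_finset]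
  · simp [Dk_trans ((p : ℚ_[p]) ^ k * _)]
  · intro a ha b hb hab
    refine Set.disjoint_left.2 fun y hy hy' => hab ?_
    simp only [Dk, Set.mem_ofPred_eq, ← norm_lt_zpow_iff] at hy hy'
    refine nat_eq_of_close (p := p) one_ne_zero (by simpa [h1] using ha) (by simpa [h1] using hb) ?_
    have h2 := um_sub_lt hy' hy
    have h3 : y - (p : ℚ_[p]) ^ k * (b : ℚ_[p]) - (y - (p : ℚ_[p]) ^ k * (a : ℚ_[p])) =
      (p : ℚ_[p]) ^ k * ((a : ℚ_[p]) - b) := by ring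
    rw [h3, norm_mul, Padic.norm_p_zpow] at h2
    simpa using (mul_lt_iff_lt_one_right (zpow_pos p_pos _)).1 h2
  · intro j _; exact Dk_meas _ _

lemma pE_ne : (p : ENNReal) ≠ 0 := by simpa using (Fact.out : p.Prime).ne_zero
lemma pE_ne' {p : ℕ} : (p : ENNReal) ≠ ⊤ := by simp

lemma vol_Dk (x : ℚ_[p]) (k : ℤ) : volume (Dk x k) = (p : ENNReal) ^ (-k) := by
  rw [Dk_trans]
  induction k with
  | zero =>
    have : Dk (0 : ℚ_[p]) 0 = unitBall p := by rw [Dk_eq]; simp [unitBall]; rfl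
    rw [this]
    exact (Measure.addHaarMeasure_self).trans (by simp)
  | succ k ih =>
    rw [Dk_step] at ih
    rw [neg_add, ENNReal.zpow_add pE_ne pE_ne', ← ih, mul_comm, ← mul_assoc]
    rw [zpow_neg_one, ENNReal.inv_mul_cancel (pE_ne (p := p)) pE_ne', one_mul]
  | pred k ih =>
    rw [Dk_step, sub_add_cancel, ih, neg_sub, sub_eq_add_neg, ENNReal.zpow_add pE_ne pE_ne']
    simp

lemma lc_meas {T : Type*} (f : ℚ_[p] → T) (hf : ∀ x ≠ 0, ∃ n : ℕ, n ≠ 0 ∧ ∀ y : ℚ_[p], ‖x - y‖ < ‖(n : ℚ_[p])‖ * ‖x‖ → f x = f y) (A : Set T) :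
    MeasurableSet (f ⁻¹' A) := by
  have h1 : IsOpen (f ⁻¹' A \ {0}) := by
    rw [Metric.isOpen_iff]
    rintro x ⟨hx, hx0⟩
    obtain ⟨n, hn, h⟩ := hf x hx0
    refine ⟨‖(n : ℚ_[p])‖ * ‖x‖, mul_pos (nat_norm_pos hn) (norm_pos_iff.2 hx0), fun y hy => ?_⟩
    rw [Metric.mem_ball', dist_eq_norm] at hy
    refine ⟨?_, ?_⟩
    · change f y ∈ A; rw [← h y hy]; exact hx
    · rintro rfl
      rw [sub_zero] at hy
      exact absurd hy (not_lt.2 (mul_le_of_le_one_left (norm_nonneg _) (nat_norm_le n)))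
  by_cases h0 : (0 : ℚ_[p]) ∈ f ⁻¹' A
  · rw [← Set.insert_sdiff_self_of_mem h0]
    exact h1.measurableSet.insert 0
  · rw [← Set.sdiff_singleton_eq_self h0]
    exact h1.measurableSet

lemma meas_acr (k : ℕ) (hk : k ≠ 0) : Measurable (fun x : ℚ_[p] => (acr k x : ℤ)) := by
  intro A _
  exact lc_meas _ (fun x hx => ⟨k, hk, fun y hy => by rw [(close_rv hk hy).2]⟩) A

lemma meas_val : Measurable (fun x : ℚ_[p] => x.valuation) := by
  intro A _
  exact lc_meas _ (fun x hx => ⟨1, one_ne_zero, fun y hy => (close_rv one_ne_zero hy).1⟩) A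

end meas
end LSZ

/-! ### Part 14 -/
namespace LSZ
open MeasureTheory

namespace Base
variable {m q : ℕ} {S : Type}

noncomputable def uu (i : (BB m q S).I) (p : Nat.Primes) (y : (Fin q → ℤ) × S) (x : Fin m → ℚ_[p]) : ℚ_[p] :=
  (BB m q S).u i ⟨p, x, y⟩

lemma meas_u (i : (BB m q S).I) (p : Nat.Primes) (y : (Fin q → ℤ) × S) :
    Measurable (uu i p y) := by
  rcases i with f | j
  · change Measurable (fun x : Fin m → ℚ_[p] => MvPolynomial.eval₂ (Int.castRingHom ℚ_[p]) x f)
    refine Continuous.measurable ?_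
    induction f using MvPolynomial.induction_on with
    | C a => simp only [MvPolynomial.eval₂_C]; exact continuous_const
    | add f g hf hg => simp only [MvPolynomial.eval₂_add]; exact hf.add hg
    | mul_X f i hf => simp only [MvPolynomial.eval₂_mul, MvPolynomial.eval₂_X]; exact hf.mul (continuous_apply i)
  · exact (measurable_const : Measurable (fun _ : Fin m → ℚ_[p] => ((p : ℕ) : ℚ_[p]) ^ y.1 j))

lemma meas_Aff {l : (BB m q S).Ω → ℤ} (hl : l ∈ (BB m q S).Aff) (p : Nat.Primes) (y : (Fin q → ℤ) × S) :
    Measurable (fun x : Fin m → ℚ_[p] => l ⟨p, x, y⟩) := by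
  induction hl using AddSubgroup.closure_induction with
  | mem l hl =>
    rcases hl with rfl | ⟨i, rfl⟩
    · exact measurable_const
    · exact (meas_val.comp (meas_u i p y) : Measurable (fun x => (uu i p y x).valuation))
  | zero => exact measurable_const
  | add a b _ _ ha hb => exact ha.add hb
  | neg a _ ha => exact ha.neg

lemma meas_basic {ψ : (BB m q S).Ω → ℤ} (h : (BB m q S).Basic ψ) (p : Nat.Primes) (y : (Fin q → ℤ) × S) :
    Measurable (fun x : Fin m → ℚ_[p] => ψ ⟨p, x, y⟩) := by
  rcases h with ⟨i, k, hk⟩ | ⟨l, hl, k, hk⟩ | ⟨l, hl⟩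
  · exact ((meas_acr k hk).comp (meas_u i p y) : Measurable (fun x => (acr k (uu i p y x) : ℤ)))
  · exact (measurable_from_top (f := fun z : ℤ => z % k)).comp (meas_Aff hl p y)
  · exact (measurable_from_top (f := fun z : ℤ => if 0 ≤ z then (1 : ℤ) else 0)).comp (meas_Aff hl p y)

lemma meas_tameT {T : Type*} {f : (BB m q S).Ω → T} (h : (BB m q S).TameT f) (p : Nat.Primes)
    (y : (Fin q → ℤ) × S) (A : Set T) : MeasurableSet ((fun x : Fin m → ℚ_[p] => f ⟨p, x, y⟩) ⁻¹' A) := by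
  obtain ⟨F, hF, hb, h⟩ := h
  have : Finite F := hF
  let Φ : (Fin m → ℚ_[p]) → (F → ℤ) := fun x ψ => ψ.1 ⟨p, x, y⟩
  have hΦ : Measurable Φ := measurable_pi_lambda _ fun ψ => meas_basic (hb _ ψ.2) p y
  have : (fun x : Fin m → ℚ_[p] => f ⟨p, x, y⟩) ⁻¹' A = Φ ⁻¹' (Φ '' ((fun x : Fin m → ℚ_[p] => f ⟨p, x, y⟩) ⁻¹' A)) := by
    refine Set.Subset.antisymm (Set.subset_preimage_image _ _) ?_
    rintro x ⟨x', hx', hxx⟩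
    have : f ⟨p, x', y⟩ = f ⟨p, x, y⟩ := h _ _ ⟨rfl, rfl, fun ψ hψ => congrFun hxx ⟨ψ, hψ⟩⟩
    simpa [← this] using hx'
  rw [this]
  exact hΦ (Set.to_countable _).measurableSet

lemma meas_tameZ {f : (BB m q S).Ω → ℤ} (h : (BB m q S).TameZ f) (p : Nat.Primes)
    (y : (Fin q → ℤ) × S) : Measurable (fun x : Fin m → ℚ_[p] => f ⟨p, x, y⟩) := by
  obtain ⟨n, κ, l, D, hD, hκ, hl, h⟩ := h
  have h' : ∀ x : Fin m → ℚ_[p], f ⟨p, x, y⟩ = ∑ k, if κ ⟨p, x, y⟩ = k then (l k ⟨p, x, y⟩) / D else 0 := by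
    intro x
    rw [Finset.sum_ite_eq]
    simp [← h, hD.ne']
  simp_rw [h']
  refine Finset.measurable_sum _ fun k _ => Measurable.ite ?_ ?_ measurable_const
  · exact meas_tameT hκ p y {k}
  · exact (measurable_from_top (f := fun z : ℤ => z / D)).comp (meas_Aff (hl k) p y)

open Classical in
/-- the integrand -/
noncomputable def W (pred : (BB m q S).Ω → Prop) (e g : (BB m q S).Ω → ℤ) (i : ℕ) (ω : (BB m q S).Ω) : ENNReal :=
  if pred ω ∧ g ω = i then ((ω.1 : ℕ) : ENNReal) ^ (-e ω) else 0

lemma meas_W {pred : (BB m q S).Ω → Prop} {e g : (BB m q S).Ω → ℤ} (hpred : (BB m q S).TameT pred)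
    (he : (BB m q S).TameZ e) (hg : (BB m q S).TameZ g) (i : ℕ) (p : Nat.Primes) (y : (Fin q → ℤ) × S) :
    Measurable (fun x : Fin m → ℚ_[p] => W pred e g i ⟨p, x, y⟩) := by
  classical
  unfold W
  refine Measurable.ite ?_ ?_ measurable_const
  · refine MeasurableSet.inter ?_ ?_
    · have h := meas_tameT hpred p y {True}
      have h' : ((fun x : Fin m → ℚ_[p] => pred ⟨p, x, y⟩) ⁻¹' {True}) = {x | pred ⟨p, x, y⟩} := by
        ext x; simp
      rw [h'] at h; exact h
    · exact meas_tameZ hg p y (measurableSet_singleton (i : ℤ))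
  · exact (measurable_from_top (f := fun z : ℤ => ((p : ℕ) : ENNReal) ^ (-z))).comp (meas_tameZ he p y)

/-- the generating coefficients -/
noncomputable def coef (pred : (BB m q S).Ω → Prop) (e g : (BB m q S).Ω → ℤ) (p : Nat.Primes) (i : ℕ) : ENNReal :=
  ∑' y : (Fin q → ℤ) × S, ∫⁻ x : Fin m → ℚ_[p], W pred e g i ⟨p, x, y⟩

lemma own_ball {N : ℕ} {c : Fin N → (ω : (BB m q S).Ω) → ℚ_[ω.1]} {L : ℕ} (hL : L ≠ 0) {a : Fin N}
    {ω : (BB m q S).Ω} {γ : ℤ} {σ : ℕ} (h : Own (B := BB m q S) c L a ω γ σ) (t : ℚ_[ω.1]) :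
    t ∈ Dk (c a ω + ((ω.1 : ℕ) : ℚ_[ω.1]) ^ γ * (σ : ℚ_[ω.1])) (γ + lev ω.1 L) ↔
    ‖((ω.1 : ℕ) : ℚ_[ω.1]) ^ γ * (σ : ℚ_[ω.1]) - (t - c a ω)‖ <
          ‖(L : ℚ_[ω.1])‖ * ‖((ω.1 : ℕ) : ℚ_[ω.1]) ^ γ * (σ : ℚ_[ω.1])‖ := by
  have h1 : ‖(σ : ℚ_[ω.1])‖ = 1 := h.1.2
  rw [norm_mul, h1, mul_one, Padic.norm_p_zpow, nat_norm hL, ← zpow_add₀ p_pos.ne', ← neg_add, norm_lt_zpow_iff,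
    ← norm_neg]
  simp only [Dk, Set.mem_ofPred_eq, lev]
  rw [show -(((ω.1 : ℕ) : ℚ_[ω.1]) ^ γ * (σ : ℚ_[ω.1]) - (t - c a ω)) = t - (c a ω + ((ω.1 : ℕ) : ℚ_[ω.1]) ^ γ * (σ : ℚ_[ω.1])) by ring]
  rw [show -((padicValNat ω.1 L : ℤ) + γ + 1) = -(γ + ((padicValNat ω.1 L + 1 : ℕ) : ℤ)) by push_cast; ring]

lemma fubini {p : ℕ} [Fact p.Prime] (f : (Fin (m + 1) → ℚ_[p]) → ENNReal) (hf : Measurable f) :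
    ∫⁻ x, f x = ∫⁻ x : Fin m → ℚ_[p], ∫⁻ t : ℚ_[p], f (Fin.cons t x) := by
  have h := volume_preserving_piFinSuccAbove (fun _ : Fin (m + 1) => ℚ_[p]) 0
  rw [← h.symm.lintegral_comp hf]
  have hm : Measurable (fun z => f ((MeasurableEquiv.piFinSuccAbove (fun _ : Fin (m + 1) => ℚ_[p]) 0).symm z)) :=
    hf.comp (MeasurableEquiv.measurable _)
  rw [Measure.volume_eq_prod, lintegral_prod_symm' _ hm]
  refine lintegral_congr fun x => lintegral_congr fun t => ?_
  congr 1
  simp [MeasurableEquiv.piFinSuccAbove, Fin.insertNthEquiv]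

theorem inner_int {pred : (BB (m + 1) q S).Ω → Prop} {e g : (BB (m + 1) q S).Ω → ℤ}
    {N : ℕ} {c : Fin N → (ω : (BB m q S).Ω) → ℚ_[ω.1]} {L : ℕ}
    {pred' : Fin N → (BB m (q + 1) (S × ℕ)).Ω → Prop} {e' g' : Fin N → (BB m (q + 1) (S × ℕ)).Ω → ℤ}
    (hN : 0 < N) (hL : L ≠ 0)
    (h1 : ∀ a ω, pred' a ω ↔ OwnP c L a ω ∧ pred (pt c a ω))
    (h2 : ∀ a ω, OwnP c L a ω → g' a ω = g (pt c a ω) ∧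
        e' a ω = e (pt c a ω) + (ω.2.2.1 0 + (lev ω.1 L : ℤ)))
    (h3 : ∀ a ω γ σ, Own (B := BB m q S) c L a ω γ σ → ∀ t : ℚ_[ω.1],
        ‖((ω.1 : ℕ) : ℚ_[ω.1]) ^ γ * (σ : ℚ_[ω.1]) - (t - c a ω)‖ <
          ‖(L : ℚ_[ω.1])‖ * ‖((ω.1 : ℕ) : ℚ_[ω.1]) ^ γ * (σ : ℚ_[ω.1])‖ →
        pred (addc ω t) = pred (addc ω (c a ω + ((ω.1 : ℕ) : ℚ_[ω.1]) ^ γ * (σ : ℚ_[ω.1]))) ∧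
        e (addc ω t) = e (addc ω (c a ω + ((ω.1 : ℕ) : ℚ_[ω.1]) ^ γ * (σ : ℚ_[ω.1]))) ∧
        g (addc ω t) = g (addc ω (c a ω + ((ω.1 : ℕ) : ℚ_[ω.1]) ^ γ * (σ : ℚ_[ω.1]))))
    (i : ℕ) (ω : (BB m q S).Ω) :
    ∫⁻ t, W pred e g i (addc ω t) = ∑' x : Fin N × ℤ × ℕ,
      W (pred' x.1) (e' x.1) (g' x.1) i ⟨ω.1, ω.2.1, Fin.cons x.2.1 ω.2.2.1, (ω.2.2.2, x.2.2)⟩ := by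
  classical
  let P : Fin N × ℤ × ℕ → ℚ_[ω.1] := fun x => c x.1 ω + ((ω.1 : ℕ) : ℚ_[ω.1]) ^ x.2.1 * (x.2.2 : ℚ_[ω.1])
  let O : Fin N × ℤ × ℕ → Prop := fun x => Own (B := BB m q S) c L x.1 ω x.2.1 x.2.2
  let F : Fin N × ℤ × ℕ → ℚ_[ω.1] → ENNReal := fun x => if O x then
    (Dk (P x) (x.2.1 + lev ω.1 L)).indicator (fun _ => W pred e g i (addc ω (P x))) else 0
  have hF : ∀ x, Measurable (F x) := by
    intro x
    simp only [F]
    split_ifs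
    · exact measurable_const.indicator (Dk_meas _ _)
    · exact measurable_const
  have hae : ∀ᵐ t : ℚ_[ω.1], W pred e g i (addc ω t) = ∑' x, F x t := by
    have : ∀ᵐ t : ℚ_[ω.1], t ∉ Set.range (fun a => c a ω) := by
      rw [ae_iff]
      simp only [not_not, Set.ofPred_mem_eq]
      exact (Set.finite_range _).measure_zero _
    filter_upwards [this] with t ht
    obtain ⟨a, γ, σ, ho, hb⟩ := own_exists (B := BB m q S) (c := c) hL hN ω t (fun a h => ht ⟨a, h.symm⟩)
    rw [tsum_eq_single (a, γ, σ)]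
    · have hO : O (a, γ, σ) := ho
      have hmem : t ∈ Dk (P (a, γ, σ)) (γ + lev ω.1 L) := (own_ball hL ho t).2 hb
      simp only [F, if_pos hO, Set.indicator_of_mem hmem]
      obtain ⟨e1, e2, e3⟩ := h3 a ω γ σ ho t hb
      simp only [W, P, e1, e2, e3]
    · rintro ⟨a', γ', σ'⟩ hne
      by_cases hO : O (a', γ', σ')
      · simp only [F, if_pos hO]
        refine Set.indicator_of_notMem (fun hm => hne ?_) _
        obtain ⟨r1, r2, r3⟩ := own_unique (B := BB m q S) hL hO ho ((own_ball hL hO t).1 hm) hb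
        exact Prod.ext r1 (Prod.ext r2 r3)
      · simp only [F, if_neg hO]; rfl
  rw [lintegral_congr_ae hae, lintegral_tsum (fun x => (hF x).aemeasurable)]
  congr 1
  funext x
  obtain ⟨a, γ, σ⟩ := x
  let ω' : (BB m (q + 1) (S × ℕ)).Ω := ⟨ω.1, ω.2.1, Fin.cons γ ω.2.2.1, (ω.2.2.2, σ)⟩
  have hfg : fg ω' = ω := by
    simp only [fg, ω', Fin.tail_cons]
  have hOP : OwnP c L a ω' ↔ O (a, γ, σ) := by
    simp only [OwnP, O, ω', fg, Fin.tail_cons, Fin.cons_zero]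
  have hpt : pt c a ω' = addc ω (P (a, γ, σ)) := rfl
  by_cases hO : O (a, γ, σ)
  · simp only [F, if_pos hO]
    rw [lintegral_indicator (Dk_meas _ _), lintegral_const, Measure.restrict_apply_univ, vol_Dk]
    have k1 := h1 a ω'
    obtain ⟨k2, k3⟩ := h2 a ω' (hOP.2 hO)
    rw [hpt] at k1 k2 k3
    change _ = W (pred' a) (e' a) (g' a) i ω'
    simp only [W, k1, hOP, hO, true_and, k2, k3]
    split_ifs
    · change _ = ((ω.1 : ℕ) : ENNReal) ^ (-(e (addc ω (P (a, γ, σ))) + (γ + (lev ω.1 L : ℤ))))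
      rw [← ENNReal.zpow_add pE_ne pE_ne', ← neg_add]
    · simp
  · simp only [F, if_neg hO]
    have k1 := h1 a ω'
    change _ = W (pred' a) (e' a) (g' a) i ω'
    simp only [W, k1, hOP, hO, false_and, if_false]
    simp

theorem coef_step [Countable S] {pred : (BB (m + 1) q S).Ω → Prop} {e g : (BB (m + 1) q S).Ω → ℤ}
    (hpred : (BB (m + 1) q S).TameT pred) (he : (BB (m + 1) q S).TameZ e) (hg : (BB (m + 1) q S).TameZ g) :
    ∃ (N : ℕ) (pred' : Fin N → (BB m (q + 1) (S × ℕ)).Ω → Prop) (e' g' : Fin N → (BB m (q + 1) (S × ℕ)).Ω → ℤ),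
      (∀ a, (BB m (q + 1) (S × ℕ)).TameT (pred' a)) ∧
      (∀ a, (BB m (q + 1) (S × ℕ)).TameZ (e' a)) ∧ (∀ a, (BB m (q + 1) (S × ℕ)).TameZ (g' a)) ∧
      ∀ p i, coef pred e g p i = ∑ a, coef (pred' a) (e' a) (g' a) p i := by
  obtain ⟨N, c, L, pred', e', g', hN, hL, hp', he', hg', h1, h2, h3⟩ := cells_tame hpred he hg
  refine ⟨N, pred', e', g', hp', he', hg', fun p i => ?_⟩
  unfold coef
  have : ∀ y : (Fin q → ℤ) × S, ∫⁻ x : Fin (m + 1) → ℚ_[p], W pred e g i ⟨p, x, y⟩ =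
      ∑' x : Fin N × ℤ × ℕ, ∫⁻ z : Fin m → ℚ_[p],
        W (pred' x.1) (e' x.1) (g' x.1) i ⟨p, z, Fin.cons x.2.1 y.1, (y.2, x.2.2)⟩ := by
    intro y
    rw [fubini _ (meas_W hpred he hg i p y)]
    refine Eq.trans ?_ (lintegral_tsum (f := fun (x : Fin N × ℤ × ℕ) (z : Fin m → ℚ_[p]) => 
        W (pred' x.1) (e' x.1) (g' x.1) i ⟨p, z, Fin.cons x.2.1 y.1, (y.2, x.2.2)⟩)
      (fun x => (meas_W (hp' x.1) (he' x.1) (hg' x.1) i p (Fin.cons x.2.1 y.1, (y.2, x.2.2))).aemeasurable))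
    refine lintegral_congr fun z => ?_
    exact inner_int hN hL h1 h2 h3 i ⟨p, z, y⟩
  simp_rw [this]
  rw [← tsum_fintype (L := SummationFilter.unconditional _), ← ENNReal.tsum_prod, ← ENNReal.tsum_prod]
  let E : ((Fin q → ℤ) × S) × (Fin N × ℤ × ℕ) ≃ Fin N × ((Fin (q + 1) → ℤ) × (S × ℕ)) :=
    { toFun := fun x => (x.2.1, (Fin.cons x.2.2.1 x.1.1, (x.1.2, x.2.2.2)))
      invFun := fun x => ((Fin.tail x.2.1, x.2.2.1), (x.1, x.2.1 0, x.2.2.2))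
      left_inv := fun x => by simp
      right_inv := fun x => by simp }
  rw [← E.tsum_eq]
  rfl

end Base
end LSZ

/-! ### Part 15 -/
namespace LSZ

/-- additive-affine maps -/
def IsAff {A B : Type*} [AddCommMonoid A] [AddCommMonoid B] (f : A → B) : Prop :=
  ∀ n m, f (n + m) + f 0 = f n + f m

lemma IsAff.comp {A B C : Type*} [AddCommMonoid A] [AddCommMonoid B] [AddCommMonoid C] {f : B → C} {g : A → B}
    (hf : IsAff f) (hg : IsAff g) : IsAff (fun x => f (g x)) := by
  intro n m
  rw [← hf, hg, hf]

lemma IsAff.formula {ι : Type*} [Fintype ι] [DecidableEq ι] {f : (ι → ℕ) → ℤ} (hf : IsAff f) (n : ι → ℕ) :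
    f n = f 0 + ∑ j, (n j : ℤ) * (f (Pi.single j 1) - f 0) := by
  let F : (ι → ℕ) →+ ℤ :=
    { toFun := fun n => f n - f 0, map_zero' := by simp, map_add' := fun a b => by have := hf a b; linarith }
  have h : F n = ∑ j, (n j : ℤ) * F (Pi.single j 1) := by
    conv_lhs => rw [← Finset.univ_sum_single n]
    rw [map_sum]
    refine Finset.sum_congr rfl fun j _ => ?_
    have : (Pi.single j (n j) : ι → ℕ) = n j • Pi.single j 1 := by
      rw [← Pi.single_smul]; simp
    rw [this, map_nsmul]; simp
  have h' : f n - f 0 = ∑ j, (n j : ℤ) * (f (Pi.single j 1) - f 0) := h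
  linarith

section
variable {X : Type} [AddCommGroup X]

/-- sets which are finite disjoint unions of injective affine images of `ℕ^ι`, each with property `Pr` -/
inductive Good (Pr : Set X → Prop) : Set X → Prop
  | empty : Good Pr ∅
  | piece (k : ℕ) (φ : (Fin k → ℕ) → X) (ha : IsAff φ) (hi : Function.Injective φ)
      (h : Pr (Set.range φ)) : Good Pr (Set.range φ)
  | union (A B : Set X) : Good Pr A → Good Pr B → Disjoint A B → Good Pr (A ∪ B)

variable {Pr Pr' : Set X → Prop}

lemma Good.piece' {ι : Type} [Finite ι] (φ : (ι → ℕ) → X) (ha : IsAff φ) (hi : Function.Injective φ)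
    (h : Pr (Set.range φ)) : Good Pr (Set.range φ) := by
  obtain ⟨k, ⟨e⟩⟩ := Finite.exists_equiv_fin ι
  let E : (Fin k → ℕ) ≃ (ι → ℕ) := e.symm.arrowCongr (Equiv.refl _)
  have hr : Set.range φ = Set.range (fun n => φ (E n)) := by
    rw [← Function.comp_def, E.surjective.range_comp]
  rw [hr] at h ⊢
  refine Good.piece k _ (ha.comp (fun n m => ?_)) (hi.comp E.injective) h
  funext j; simp [E]

lemma Good.refine {A : Set X} (h : Good Pr A)
    (H : ∀ (k : ℕ) (φ : (Fin k → ℕ) → X), IsAff φ → Function.Injective φ → Pr (Set.range φ) → Good Pr' (Set.range φ)) :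
    Good Pr' A := by
  induction h with
  | empty => exact Good.empty
  | piece k φ ha hi h => exact H k φ ha hi h
  | union A B _ _ hd h1 h2 => exact Good.union A B h1 h2 hd

lemma Good.iUnion {κ : Type*} [Finite κ] (A : κ → Set X) (h : ∀ i, Good Pr (A i))
    (hd : Pairwise (Function.onFun Disjoint A)) : Good Pr (⋃ i, A i) := by
  classical
  have := Fintype.ofFinite κ
  have : ∀ s : Finset κ, Good Pr (⋃ i ∈ s, A i) := by
    intro s
    induction s using Finset.induction_on with
    | empty => simpa using Good.empty
    | insert a s ha ih =>
      rw [Finset.set_biUnion_insert]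
      refine Good.union _ _ (h a) ih ?_
      rw [Set.disjoint_iUnion₂_right]
      intro i hi
      exact hd (fun h => ha (h ▸ hi))
  simpa using this Finset.univ

def Her (Pr : Set X → Prop) : Prop := ∀ A B, A ⊆ B → Pr B → Pr A

def SgnC (l : X → ℤ) (A : Set X) : Prop := ∀ x ∈ A, ∀ y ∈ A, 0 ≤ l x ↔ 0 ≤ l y

/-- slopes of l along φ -/
noncomputable def slp {ι : Type} [DecidableEq ι] (l : X → ℤ) (φ : (ι → ℕ) → X) (j : ι) : ℤ := l (φ (Pi.single j 1)) - l (φ 0)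

/-- removing a coordinate -/
def ext0 {ι : Type} [DecidableEq ι] (i : ι) (n : {j // j ≠ i} → ℕ) : ι → ℕ := fun j => if h : j = i then 0 else n ⟨j, h⟩

lemma sgn1 (hPr : Her Pr) (l : X → ℤ) (hl : IsAff l) : ∀ (c b : ℕ) (ι : Type) [Fintype ι] [DecidableEq ι] (φ : (ι → ℕ) → X),
    Fintype.card ι ≤ c → -(b : ℤ) ≤ l (φ 0) → IsAff φ → Function.Injective φ → Pr (Set.range φ) → (∀ j, 0 ≤ slp l φ j) →
    Good (fun A => Pr A ∧ SgnC l A) (Set.range φ) := by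
  have key : ∀ (ι : Type) [Fintype ι] [DecidableEq ι] (φ : (ι → ℕ) → X), IsAff φ → Function.Injective φ → Pr (Set.range φ) →
      (∀ j, 0 ≤ slp l φ j) → (0 ≤ l (φ 0) ∨ ∀ j, slp l φ j = 0) →
      Good (fun A => Pr A ∧ SgnC l A) (Set.range φ) := by
    intro ι _ _ φ ha hi hp hs hor
    refine Good.piece' φ ha hi ⟨hp, ?_⟩
    rintro _ ⟨n, rfl⟩ _ ⟨m, rfl⟩
    have hf := (hl.comp ha).formula
    rcases hor with h0 | h0
    · have : ∀ n, 0 ≤ l (φ n) := by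
        intro n; rw [hf n]
        exact add_nonneg h0 (Finset.sum_nonneg fun j _ => mul_nonneg (Int.natCast_nonneg _) (hs j))
      simp [this]
    · have : ∀ n, l (φ n) = l (φ 0) := by
        intro n; rw [hf n]
        rw [Finset.sum_eq_zero, add_zero]
        intro j _
        rw [show l (φ (Pi.single j 1)) - l (φ 0) = 0 from h0 j, mul_zero]
      simp [this n, this m]
  intro c
  induction c with
  | zero =>
    intro b ι _ _ φ hc hb ha hi hp hs
    have : IsEmpty ι := Fintype.card_eq_zero_iff.1 (by omega)
    exact key ι φ ha hi hp hs (Or.inr fun j => isEmptyElim j)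
  | succ c ihc =>
    intro b
    induction b with
    | zero =>
      intro ι _ _ φ hc hb ha hi hp hs
      exact key ι φ ha hi hp hs (Or.inl (by simpa using hb))
    | succ b ihb =>
      intro ι _ _ φ hc hb ha hi hp hs
      by_cases h0 : ∀ j, slp l φ j = 0
      · exact key ι φ ha hi hp hs (Or.inr h0)
      push Not at h0
      obtain ⟨i, hne⟩ := h0
      have hpos : 0 < slp l φ i := lt_of_le_of_ne (hs i) (Ne.symm hne)
      have e1 : IsAff (ext0 i) := by
        intro n m; funext j; simp only [ext0, Pi.add_apply]; split_ifs <;> simp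
      have e2 : Function.Injective (ext0 i) := by
        intro n m h; funext j
        have := congrFun h j.1
        simpa [ext0, j.2] using this
      have e0 : ext0 i 0 = 0 := by funext j; simp [ext0]
      have es : ∀ j : {j // j ≠ i}, ext0 i (Pi.single j 1) = Pi.single j.1 1 := by
        intro j; funext k
        by_cases hk : k = i
        · subst hk; simp [ext0, Ne.symm j.2]
        · by_cases hkj : k = j.1
          · subst hkj; simp [ext0, j.2]
          · have : (⟨k, hk⟩ : {j // j ≠ i}) ≠ j := fun h => hkj (by rw [← h])
            simp [ext0, hk, hkj, this]
      have s1 : IsAff (fun n : ι → ℕ => n + Pi.single i 1) := by intro n m; beta_reduce; rw [zero_add, add_right_comm n, add_assoc (n + _)]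
      have s2 : Function.Injective (fun n : ι → ℕ => n + Pi.single i 1) := add_left_injective _
      have hun : Set.range φ = Set.range (fun n => φ (ext0 i n)) ∪ Set.range (fun n : ι → ℕ => φ (n + Pi.single i 1)) := by
        apply Set.Subset.antisymm
        · rintro _ ⟨n, rfl⟩
          by_cases hn : n i = 0
          · left
            refine ⟨fun j => n j.1, ?_⟩
            beta_reduce; congr 1; funext j
            by_cases hj : j = i
            · subst hj; simp [ext0, hn]
            · simp [ext0, hj]
          · right
            refine ⟨n - Pi.single i 1, ?_⟩
            beta_reduce
            congr 1; funext j
            by_cases hj : j = i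
            · subst hj; simp; omega
            · simp [hj]
        · rintro _ (⟨n, rfl⟩ | ⟨n, rfl⟩) <;> exact ⟨_, rfl⟩
      rw [hun]
      have hsh : ∀ n, l (φ (n + Pi.single i 1)) = l (φ n) + slp l φ i := by
        intro n
        have := (hl.comp ha) n (Pi.single i 1)
        simp only [slp]; linarith
      refine Good.union _ _ ?_ ?_ ?_
      · refine ihc (b + 1) {j // j ≠ i} (fun n => φ (ext0 i n)) ?_ (by simpa [e0] using hb) (ha.comp e1) (hi.comp e2)
          (hPr _ _ (by rintro _ ⟨n, rfl⟩; exact ⟨_, rfl⟩) hp) ?_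
        · rw [Fintype.card_subtype_compl]; simp; omega
        · intro j; simpa [slp, e0, es] using hs j
      · refine ihb ι (fun n => φ (n + Pi.single i 1)) hc ?_ (ha.comp s1) (hi.comp s2)
          (hPr _ _ (by rintro _ ⟨n, rfl⟩; exact ⟨_, rfl⟩) hp) ?_
        · rw [hsh]; push_cast at hb; omega
        · intro j
          have := hs j
          simp only [slp, hsh] at this ⊢; linarith
      · rw [Set.disjoint_left]
        rintro _ ⟨n, rfl⟩ ⟨m, hm⟩
        have := congrFun (hi hm) i
        simp [ext0] at this

lemma sgn1' (hPr : Her Pr) (l : X → ℤ) (hl : IsAff l) (ι : Type) [Fintype ι] [DecidableEq ι] (φ : (ι → ℕ) → X)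
    (ha : IsAff φ) (hi : Function.Injective φ) (hp : Pr (Set.range φ)) (hs : (∀ j, 0 ≤ slp l φ j) ∨ (∀ j, slp l φ j ≤ 0)) :
    Good (fun A => Pr A ∧ SgnC l A) (Set.range φ) := by
  rcases hs with hs | hs
  · exact sgn1 hPr l hl _ (l (φ 0)).natAbs ι φ le_rfl (by omega) ha hi hp hs
  · have hl' : IsAff (fun x => - l x - 1) := by
      intro n m; have := hl n m; linarith
    have := sgn1 hPr _ hl' _ (- l (φ 0) - 1).natAbs ι φ le_rfl (by omega) ha hi hp (by
      intro j; have := hs j; simp only [slp] at this ⊢; linarith)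
    refine this.refine fun k φ ha hi h => Good.piece k φ ha hi ⟨h.1, fun x hx y hy => ?_⟩
    have : 0 ≤ - l x - 1 ↔ 0 ≤ - l y - 1 := h.2 x hx y hy
    omega

lemma sgn2 (hPr : Her Pr) (l : X → ℤ) (hl : IsAff l) (L : ℤ) (hL : 0 < L) (ι : Type) [Fintype ι] [DecidableEq ι] :
    ∀ (c : ℕ) (φ : (ι → ℕ) → X), (Finset.univ.filter fun j => slp l φ j ≠ 0).card ≤ c → IsAff φ → Function.Injective φ →
    Pr (Set.range φ) → (∀ j, slp l φ j = 0 ∨ slp l φ j = L ∨ slp l φ j = -L) →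
    Good (fun A => Pr A ∧ SgnC l A) (Set.range φ) := by
  intro c
  induction c with
  | zero =>
    intro φ hc ha hi hp hs
    refine sgn1' hPr l hl ι φ ha hi hp (Or.inl fun j => ?_)
    by_contra h
    have : j ∈ Finset.univ.filter fun j => slp l φ j ≠ 0 := by simp; omega
    exact absurd (Finset.card_pos.2 ⟨j, this⟩) (by omega)
  | succ c ih =>
    intro φ hc ha hi hp hs
    by_cases h1 : ∀ j, 0 ≤ slp l φ j
    · exact sgn1' hPr l hl ι φ ha hi hp (Or.inl h1)
    by_cases h2 : ∀ j, slp l φ j ≤ 0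
    · exact sgn1' hPr l hl ι φ ha hi hp (Or.inr h2)
    push Not at h1 h2
    obtain ⟨j, hj⟩ := h1
    obtain ⟨i, hi'⟩ := h2
    have hij : i ≠ j := by rintro rfl; omega
    have hci : slp l φ i = L := by rcases hs i with h | h | h <;> omega
    have hcj : slp l φ j = -L := by rcases hs j with h | h | h <;> omega
    -- n_i = n_i' + n_j + w
    have main : ∀ (i j : ι) (w : ℕ), i ≠ j → slp l φ i = - slp l φ j → slp l φ j ≠ 0 →
        Good (fun A => Pr A ∧ SgnC l A) (Set.range (fun n : ι → ℕ => φ (n + Pi.single i (n j + w)))) := by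
      intro i j w hij hc1 hc0
      have s1 : IsAff (fun n : ι → ℕ => n + Pi.single i (n j + w)) := by
        intro n m; funext k
        by_cases hk : k = i
        · subst hk; simp; ring
        · simp [hk]
      have s2 : Function.Injective (fun n : ι → ℕ => n + Pi.single i (n j + w)) := by
        intro n m h
        have hjj : n j = m j := by simpa [hij.symm] using congrFun h j
        funext k
        have := congrFun h k
        beta_reduce at this
        rw [hjj] at this
        simpa using this
      have hslp : ∀ k, slp l (fun n : ι → ℕ => φ (n + Pi.single i (n j + w))) k = slp l φ k + (if k = j then slp l φ i else 0) := by
        have hF := (hl.comp ha).formula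
        have hG := hF
        intro k
        have e1 : ∀ n m : ι → ℕ, l (φ (n + m)) - l (φ m) = l (φ n) - l (φ 0) := by
          intro n m; have := (hl.comp ha) n m; linarith
        by_cases hk : k = j
        · subst hk
          have : (Pi.single k 1 + Pi.single i ((Pi.single k 1 : ι → ℕ) k + w) : ι → ℕ) =
              Pi.single k 1 + (Pi.single i 1 + Pi.single i ((0 : ι → ℕ) k + w)) := by
            rw [← Pi.single_add]; simp
          simp only [slp, this, zero_add]
          have h1 := e1 (Pi.single k 1) (Pi.single i 1 + Pi.single i ((0 : ι → ℕ) k + w))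
          have h2 := e1 (Pi.single i 1) (Pi.single i ((0 : ι → ℕ) k + w))
          simp only [if_true]
          linarith
        · have : (Pi.single k 1 : ι → ℕ) j = 0 := by simp [Ne.symm hk]
          simp only [slp, this, hk, if_false, zero_add, Pi.zero_apply]
          have h1 := e1 (Pi.single k 1) (Pi.single i w)
          linarith
      refine ih _ ?_ (ha.comp s1) (hi.comp s2) (hPr _ _ (by rintro _ ⟨n, rfl⟩; exact ⟨_, rfl⟩) hp) ?_
      · have : (Finset.univ.filter fun k => slp l (fun n : ι → ℕ => φ (n + Pi.single i (n j + w))) k ≠ 0) ⊂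
            (Finset.univ.filter fun k => slp l φ k ≠ 0) := by
          rw [Finset.ssubset_iff_of_subset]
          · refine ⟨j, by simpa using hc0, ?_⟩
            simp [hslp, hc1]
          · intro k hk
            simp only [hslp, Finset.mem_filter, Finset.mem_univ, true_and] at hk ⊢
            by_cases hkj : k = j
            · subst hkj; exact hc0
            · simpa [hkj] using hk
        have := Finset.card_lt_card this
        omega
      · intro k
        rw [hslp]
        by_cases hkj : k = j
        · subst hkj; left; simp [hc1]
        · simpa [hkj] using hs k
    have hun : Set.range φ = Set.range (fun n : ι → ℕ => φ (n + Pi.single i (n j + 0))) ∪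
        Set.range (fun n : ι → ℕ => φ (n + Pi.single j (n i + 1))) := by
      apply Set.Subset.antisymm
      · rintro _ ⟨n, rfl⟩
        by_cases hn : n j ≤ n i
        · left
          refine ⟨n - Pi.single i (n j), ?_⟩
          beta_reduce
          congr 1; funext k
          by_cases hk : k = i
          · subst hk; simp [hij.symm]; omega
          · simp [hk]
        · right
          refine ⟨n - Pi.single j (n i + 1), ?_⟩
          beta_reduce
          congr 1; funext k
          by_cases hk : k = j
          · subst hk; simp [hij]; omega
          · simp [hk]
      · rintro _ (⟨n, rfl⟩ | ⟨n, rfl⟩) <;> exact ⟨_, rfl⟩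
    rw [hun]
    refine Good.union _ _ (main i j 0 hij (by omega) (by omega)) (main j i 1 hij.symm (by omega) (by omega)) ?_
    rw [Set.disjoint_left]
    rintro _ ⟨n, rfl⟩ ⟨m, hm⟩
    have h := hi hm
    have h1 := congrFun h i
    have h2 := congrFun h j
    simp [hij, hij.symm] at h1 h2
    omega

/-- residue splitting -/
lemma split_res {ι : Type} [Fintype ι] (φ : (ι → ℕ) → X) (hi : Function.Injective φ) (d : ι → ℕ) (hd : ∀ j, 0 < d j)
    (H : ∀ ρ : ι → ℕ, (∀ j, ρ j < d j) → Good Pr (Set.range (fun n : ι → ℕ => φ (fun j => d j * n j + ρ j)))) :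
    Good Pr (Set.range φ) := by
  have hun : Set.range φ = ⋃ ρ : (j : ι) → Fin (d j), Set.range (fun n : ι → ℕ => φ (fun j => d j * n j + (ρ j : ℕ))) := by
    apply Set.Subset.antisymm
    · rintro _ ⟨n, rfl⟩
      rw [Set.mem_iUnion]
      refine ⟨fun j => ⟨n j % d j, Nat.mod_lt _ (hd j)⟩, fun j => n j / d j, ?_⟩
      beta_reduce
      congr 1; funext j
      exact Nat.div_add_mod _ _
    · intro x hx
      obtain ⟨ρ, n, rfl⟩ := Set.mem_iUnion.1 hx
      exact ⟨_, rfl⟩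
  rw [hun]
  refine Good.iUnion _ (fun ρ => H _ fun j => (ρ j).2) ?_
  intro ρ ρ' hne
  rw [Function.onFun, Set.disjoint_left]
  rintro _ ⟨n, rfl⟩ ⟨m, hm⟩
  refine hne (funext fun j => Fin.ext ?_)
  have := congrArg (· % d j) (congrFun (hi hm) j)
  simp only [Nat.mul_add_mod, Nat.mod_eq_of_lt (ρ j).2, Nat.mod_eq_of_lt (ρ' j).2] at this
  exact this.symm

lemma res_aff {ι : Type} (d ρ : ι → ℕ) : IsAff (fun (n : ι → ℕ) (j : ι) => d j * n j + ρ j) := by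
  intro n m; funext j; simp; ring

lemma res_inj {ι : Type} (d ρ : ι → ℕ) (hd : ∀ j, 0 < d j) : Function.Injective (fun (n : ι → ℕ) (j : ι) => d j * n j + ρ j) := by
  intro n m h; funext j
  have := congrFun h j
  simp at this
  exact this.resolve_right (hd j).ne'

lemma sgn3 (hPr : Her Pr) (l : X → ℤ) (hl : IsAff l) {ι : Type} [Fintype ι] [DecidableEq ι] (φ : (ι → ℕ) → X)
    (ha : IsAff φ) (hi : Function.Injective φ) (hp : Pr (Set.range φ)) :
    Good (fun A => Pr A ∧ SgnC l A) (Set.range φ) := by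
  let a : ι → ℕ := fun j => if slp l φ j = 0 then 1 else (slp l φ j).natAbs
  have ha0 : ∀ j, a j ≠ 0 := by intro j; simp only [a]; split_ifs <;> simp_all
  let d : ι → ℕ := fun j => ∏ k ∈ Finset.univ.erase j, a k
  have hda : ∀ j, a j * d j = ∏ k, a k := fun j => Finset.mul_prod_erase _ _ (Finset.mem_univ j)
  have hL : 0 < ∏ k, a k := Finset.prod_pos fun k _ => Nat.pos_of_ne_zero (ha0 k)
  have hd : ∀ j, 0 < d j := fun j => Finset.prod_pos fun k _ => Nat.pos_of_ne_zero (ha0 k)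
  refine split_res φ hi d hd fun ρ hρ => ?_
  refine sgn2 hPr l hl ((∏ k, a k : ℕ) : ℤ) (by exact_mod_cast hL) ι _ _ le_rfl (ha.comp (res_aff d ρ)) (hi.comp (res_inj d ρ hd))
    (hPr _ _ (by rintro _ ⟨n, rfl⟩; exact ⟨_, rfl⟩) hp) fun j => ?_
  have hs : slp l (fun n : ι → ℕ => φ (fun j => d j * n j + ρ j)) j = d j * slp l φ j := by
    have hF := (hl.comp ha).formula
    simp only [slp]
    rw [hF (fun k => d k * (Pi.single j 1 : ι → ℕ) k + ρ k), hF (fun k => d k * (0 : ι → ℕ) k + ρ k)]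
    rw [add_sub_add_left_eq_sub, ← Finset.sum_sub_distrib, Finset.sum_eq_single j]
    · simp; ring
    · intro k _ hk; simp [hk]
    · simp
  rw [hs]
  by_cases h0 : slp l φ j = 0
  · left; simp [h0]
  · right
    have h1 : (a j : ℤ) = |slp l φ j| := by simp [a, h0]
    have h2 : (d j : ℤ) * |slp l φ j| = ((∏ k, a k : ℕ) : ℤ) := by rw [← h1, ← hda]; push_cast; ring
    rcases abs_choice (slp l φ j) with h | h
    · left; rw [← h2, h]
    · right; rw [← h2, h]; ring

end

/-- The partition theorem -/
theorem good_univ {q : ℕ} (F : Set ((Fin q → ℤ) → ℤ)) (hF : F.Finite) (hA : ∀ l ∈ F, IsAff l) (M : ℕ) (hM : 0 < M) :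
    Good (fun A : Set (Fin q → ℤ) => (∀ l ∈ F, SgnC l A) ∧ ∀ x ∈ A, ∀ y ∈ A, ∀ j, x j % M = y j % M) Set.univ := by
  classical
  -- base
  have h0 : Good (fun _ : Set (Fin q → ℤ) => True) Set.univ := by
    let φ : (Fin q → Bool) → (Fin q → ℕ) → (Fin q → ℤ) := fun s n j => if s j then (n j : ℤ) else -1 - n j
    have hun : (Set.univ : Set (Fin q → ℤ)) = ⋃ s, Set.range (φ s) := by
      symm; rw [Set.eq_univ_iff_forall]
      intro x
      rw [Set.mem_iUnion]
      refine ⟨fun j => decide (0 ≤ x j), fun j => if 0 ≤ x j then (x j).toNat else (-1 - x j).toNat, ?_⟩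
      funext j
      by_cases h : 0 ≤ x j <;> simp [φ, h]
      omega
    rw [hun]
    refine Good.iUnion _ (fun s => Good.piece q (φ s) ?_ ?_ trivial) ?_
    · intro n m; funext j; simp only [φ, Pi.add_apply]; split_ifs <;> simp <;> ring
    · intro n m h; funext j
      have := congrFun h j
      simp only [φ] at this
      split_ifs at this <;> omega
    · intro s s' hne
      rw [Function.onFun, Set.disjoint_left]
      rintro _ ⟨n, rfl⟩ ⟨m, hm⟩
      refine hne (funext fun j => ?_)
      have := congrFun hm j
      simp only [φ] at this
      cases h : s j <;> cases h' : s' j <;> simp [h, h'] at this ⊢ <;> omega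
  have h1 : Good (fun A : Set (Fin q → ℤ) => ∀ x ∈ A, ∀ y ∈ A, ∀ j, x j % M = y j % M) Set.univ := by
    refine h0.refine fun k φ ha hi _ => ?_
    refine split_res φ hi (fun _ => M) (fun _ => hM) fun ρ _ => ?_
    refine Good.piece k _ (ha.comp (res_aff (fun _ => M) ρ)) (hi.comp (res_inj (fun _ => M) ρ (fun _ => hM))) ?_
    have : ∀ n : Fin k → ℕ, ∀ j, φ (fun i => M * n i + ρ i) j % M = φ ρ j % M := by
      intro n j
      have hj : IsAff (fun x : Fin q → ℤ => x j) := fun x y => by simp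
      have hF := (hj.comp ha).formula
      have : φ (fun i => M * n i + ρ i) j - φ ρ j = M * ∑ i, (n i : ℤ) * (φ (Pi.single i 1) j - φ 0 j) := by
        rw [hF (fun i => M * n i + ρ i), hF ρ, add_sub_add_left_eq_sub, ← Finset.sum_sub_distrib, Finset.mul_sum]
        refine Finset.sum_congr rfl fun i _ => ?_
        push_cast; ring
      rw [eq_add_of_sub_eq this, add_comm, Int.add_mul_emod_self_left]
    rintro _ ⟨n, rfl⟩ _ ⟨m, rfl⟩ j
    rw [this n, this m]
  suffices ∀ G ⊆ F, G.Finite → Good (fun A : Set (Fin q → ℤ) => (∀ l ∈ G, SgnC l A) ∧ ∀ x ∈ A, ∀ y ∈ A, ∀ j, x j % M = y j % M) Set.univ from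
    this F subset_rfl hF
  intro G hG hGf
  induction G, hGf using Set.Finite.induction_on with
  | empty => simpa using h1
  | insert hn hf ih =>
    rename_i l G
    have ih := ih ((Set.subset_insert _ _).trans hG)
    have hh : Her (fun A : Set (Fin q → ℤ) => (∀ l ∈ G, SgnC l A) ∧ ∀ x ∈ A, ∀ y ∈ A, ∀ j, x j % M = y j % M) :=
      fun A B hAB h => ⟨fun l hl x hx y hy => h.1 l hl x (hAB hx) y (hAB hy), fun x hx y hy => h.2 x (hAB hx) y (hAB hy)⟩
    refine ih.refine fun k φ ha hi h => ?_
    refine (sgn3 hh l (hA l (hG (Set.mem_insert _ _))) φ ha hi h).refine fun k φ ha hi h => Good.piece k φ ha hi ?_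
    refine ⟨fun l' hl' => ?_, h.1.2⟩
    rcases hl' with rfl | hl'
    · exact h.2
    · exact h.1.1 l' hl'

end LSZ

/-! ### Part 16 -/
namespace LSZ
open PowerSeries
open scoped NNReal ENNReal

/-- one denominator factor -/
noncomputable def fac (x : ℕ × ℝ) : PowerSeries ℝ := 1 - C x.2 * X ^ x.1

noncomputable def denR (M : Multiset (ℕ × ℝ)) : PowerSeries ℝ := (M.map fac).prod

def wt {T : Type*} (M : Multiset (ℕ × T)) : ℕ := (M.map Prod.fst).sum

lemma wt_add {T : Type*} (M M' : Multiset (ℕ × T)) : wt (M + M') = wt M + wt M' := by simp [wt]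
lemma wt_cons {T : Type*} (x : ℕ × T) (M : Multiset (ℕ × T)) : wt (x ::ₘ M) = x.1 + wt M := by simp [wt]
lemma denR_add (M M' : Multiset (ℕ × ℝ)) : denR (M + M') = denR M * denR M' := by simp [denR]
lemma denR_cons (x : ℕ × ℝ) (M : Multiset (ℕ × ℝ)) : denR (x ::ₘ M) = fac x * denR M := by simp [denR]

lemma coeff_fac (x : ℕ × ℝ) (f : PowerSeries ℝ) (k : ℕ) :
    coeff k (f * fac x) = coeff k f - if x.1 ≤ k then x.2 * coeff (k - x.1) f else 0 := by
  rw [fac, mul_sub, mul_one, map_sub]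
  congr 1
  rw [show f * (C x.2 * X ^ x.1) = C x.2 * (f * X ^ x.1) by ring, coeff_C_mul, coeff_mul_X_pow']
  split_ifs <;> simp

def UniR (M : Multiset (ℕ × ℝ)) (N : ℕ) (f : PowerSeries ℝ) : Prop :=
  ∀ k, N + wt M < k → coeff k (f * denR M) = 0

lemma UniR.cons {M : Multiset (ℕ × ℝ)} {N : ℕ} {f : PowerSeries ℝ} (h : UniR M N f) (x : ℕ × ℝ) :
    UniR (x ::ₘ M) N f := by
  intro k hk
  rw [wt_cons] at hk
  rw [denR_cons, mul_comm (fac x), ← mul_assoc, coeff_fac, h k (by omega)]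
  split_ifs with h1
  · rw [h _ (by omega)]; simp
  · simp

lemma UniR.add_right {M : Multiset (ℕ × ℝ)} {N : ℕ} {f : PowerSeries ℝ} (h : UniR M N f) (M' : Multiset (ℕ × ℝ)) :
    UniR (M' + M) N f := by
  induction M' using Multiset.induction_on with
  | empty => simpa using h
  | cons x M' ih => rw [Multiset.cons_add]; exact ih.cons x

lemma UniR.mono {M M' : Multiset (ℕ × ℝ)} {N N' : ℕ} {f : PowerSeries ℝ} (h : UniR M N f) (hM : M ≤ M') (hN : N ≤ N') :
    UniR M' N' f := by
  obtain ⟨K, rfl⟩ := Multiset.le_iff_exists_add.1 hM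
  have := h.add_right K
  rw [add_comm] at this
  intro k hk
  exact this k (by omega)

/-- finite-cone sums -/
noncomputable def cone {k : ℕ} (g : Fin k → ℕ) (r : Fin k → ℝ≥0) (g0 : ℕ) (w : ℝ≥0) (i : ℕ) : ENNReal :=
  ∑' n : Fin k → ℕ, if g0 + ∑ j, n j * g j = i then ((w * ∏ j, r j ^ n j : ℝ≥0) : ENNReal) else 0

noncomputable def coneM {k : ℕ} (g : Fin k → ℕ) (r : Fin k → ℝ≥0) : Multiset (ℕ × ℝ) :=
  ∑ j, if 0 < g j then {(g j, (r j : ℝ))} else 0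

lemma cone_succ {k : ℕ} (g : Fin (k + 1) → ℕ) (r : Fin (k + 1) → ℝ≥0) (g0 : ℕ) (w : ℝ≥0) (i : ℕ) :
    cone g r g0 w i = ∑' a : ℕ, (r 0 : ENNReal) ^ a * cone (Fin.tail g) (Fin.tail r) (g0 + a * g 0) w i := by
  unfold cone
  rw [← (Fin.consEquiv (fun _ => ℕ)).tsum_eq, ENNReal.tsum_prod']
  refine tsum_congr fun a => ?_
  rw [← ENNReal.tsum_mul_left]
  refine tsum_congr fun n => ?_
  simp only [Fin.consEquiv, Equiv.coe_fn_mk, Fin.sum_univ_succ, Fin.prod_univ_succ, Fin.cons_zero, Fin.cons_succ, Fin.tail, add_assoc]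
  split_ifs
  · push_cast; ring
  · simp

lemma cone_shift {k : ℕ} (g : Fin k → ℕ) (r : Fin k → ℝ≥0) (g0 a : ℕ) (w : ℝ≥0) (i : ℕ) :
    cone g r (g0 + a) w i = if a ≤ i then cone g r g0 w (i - a) else 0 := by
  unfold cone
  split_ifs with h
  · refine tsum_congr fun n => ?_
    congr 1
    apply propext; omega
  · rw [ENNReal.tsum_eq_zero]
    intro n
    rw [if_neg]; omega

lemma cone_uni : ∀ {k : ℕ} (g : Fin k → ℕ) (r : Fin k → ℝ≥0) (g0 : ℕ) (w : ℝ≥0), (∀ i, cone g r g0 w i ≠ ⊤) →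
    UniR (coneM g r) g0 (mk fun i => (cone g r g0 w i).toReal) := by
  intro k
  induction k with
  | zero =>
    intro g r g0 w _ k hk
    simp [coneM, denR, wt] at hk ⊢
    rw [cone, tsum_fintype]
    have : ¬ g0 = k := by omega
    simp [this]
  | succ k ih =>
    intro g r g0 w hfin
    have h0 : ∀ i, cone (Fin.tail g) (Fin.tail r) g0 w i ≤ cone g r g0 w i := by
      intro i
      rw [cone_succ]
      refine le_trans ?_ (ENNReal.le_tsum 0)
      simp
    have hfin0 : ∀ i, cone (Fin.tail g) (Fin.tail r) g0 w i ≠ ⊤ := fun i => ne_top_of_le_ne_top (hfin i) (h0 i)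
    have H := ih (Fin.tail g) (Fin.tail r) g0 w hfin0
    have hM : coneM g r = (if 0 < g 0 then {(g 0, (r 0 : ℝ))} else 0) + coneM (Fin.tail g) (Fin.tail r) := by
      rw [coneM, Fin.sum_univ_succ]; rfl
    by_cases hg : 0 < g 0
    · rw [hM, if_pos hg, Multiset.singleton_add]
      have key : (mk fun i => (cone g r g0 w i).toReal) * fac (g 0, (r 0 : ℝ)) =
          mk fun i => (cone (Fin.tail g) (Fin.tail r) g0 w i).toReal := by
        ext i
        rw [coeff_fac, coeff_mk, coeff_mk]
        have e : cone g r g0 w i = cone (Fin.tail g) (Fin.tail r) g0 w i +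
            if g 0 ≤ i then (r 0 : ENNReal) * cone g r g0 w (i - g 0) else 0 := by
          rw [cone_succ, tsum_eq_zero_add' ENNReal.summable]
          congr 1
          · simp
          · split_ifs with h
            · rw [cone_succ, ← ENNReal.tsum_mul_left]
              refine tsum_congr fun a => ?_
              rw [add_mul, one_mul, ← add_assoc, cone_shift, if_pos h, pow_succ]
              ring
            · rw [ENNReal.tsum_eq_zero]
              intro a
              rw [add_mul, one_mul, ← add_assoc, cone_shift, if_neg h, mul_zero]
        rw [e, ENNReal.toReal_add (hfin0 i)]
        · split_ifs with h
          · simp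
          · simp
        · split_ifs with h
          · exact ENNReal.mul_ne_top ENNReal.coe_ne_top (hfin _)
          · simp
      intro i hi
      rw [denR_cons, ← mul_assoc, key]
      refine H i ?_
      rw [wt_cons] at hi
      omega
    · rw [hM, if_neg hg, zero_add]
      have hg0 : g 0 = 0 := by omega
      have key : (mk fun i => (cone g r g0 w i).toReal) = C (∑' a : ℕ, (r 0 : ENNReal) ^ a).toReal *
          mk fun i => (cone (Fin.tail g) (Fin.tail r) g0 w i).toReal := by
        ext i
        rw [coeff_C_mul, coeff_mk, coeff_mk, cone_succ, hg0]
        simp only [mul_zero, add_zero]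
        rw [ENNReal.tsum_mul_right, ENNReal.toReal_mul]
      intro i hi
      rw [key, mul_assoc, coeff_C_mul, H i hi, mul_zero]

/-- specialization at a prime -/
noncomputable def spM (p : ℕ) (M : Multiset (ℕ × ℤ)) : Multiset (ℕ × ℝ) := M.map fun x => (x.1, (p : ℝ) ^ x.2)

lemma wt_spM (p : ℕ) (M : Multiset (ℕ × ℤ)) : wt (spM p M) = wt M := by
  simp [wt, spM]

def UniE (p : ℕ) (M : Multiset (ℕ × ℤ)) (N : ℕ) (c : ℕ → ENNReal) : Prop :=
  (∀ i, c i ≠ ⊤) → UniR (spM p M) N (mk fun i => (c i).toReal)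

lemma UniE.mono {p : ℕ} {M M' : Multiset (ℕ × ℤ)} {N N' : ℕ} {c : ℕ → ENNReal} (h : UniE p M N c) (hM : M ≤ M') (hN : N ≤ N') :
    UniE p M' N' c := fun hc => (h hc).mono (Multiset.map_le_map hM) hN

lemma UniE.tsum {ι : Type*} {p : ℕ} {M : Multiset (ℕ × ℤ)} {N : ℕ} {c : ι → ℕ → ENNReal} (h : ∀ s, UniE p M N (c s)) :
    UniE p M N (fun i => ∑' s, c s i) := by
  intro hc k hk
  have hcs : ∀ s i, c s i ≠ ⊤ := fun s i => ENNReal.ne_top_of_tsum_ne_top (hc i) s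
  have hsum : ∀ i, Summable fun s => (c s i).toReal := fun i => ENNReal.summable_toReal (hc i)
  have e : ∀ i, (∑' s, c s i).toReal = ∑' s, (c s i).toReal := fun i => ENNReal.tsum_toReal_eq (fun s => hcs s i)
  rw [coeff_mul]
  simp only [coeff_mk, e, ← tsum_mul_right]
  rw [← Summable.tsum_finsetSum (fun x _ => (hsum x.1).mul_right _)]
  have : ∀ s, ∑ x ∈ Finset.HasAntidiagonal.antidiagonal k, (c s x.1).toReal * coeff x.2 (denR (spM p M)) = 0 := by
    intro s
    have := h s (hcs s) k hk
    rw [coeff_mul] at this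
    simpa using this
  simp [this]

lemma UniE.add {p : ℕ} {M : Multiset (ℕ × ℤ)} {N : ℕ} {c c' : ℕ → ENNReal} (h : UniE p M N c) (h' : UniE p M N c') :
    UniE p M N (fun i => c i + c' i) := by
  have := UniE.tsum (c := fun b : Bool => if b then c else c') (p := p) (M := M) (N := N) (by
    intro b; cases b
    · simpa using h'
    · simpa using h)
  convert this using 2 with i
  simp [tsum_fintype]

lemma UniE.zero {p : ℕ} {M : Multiset (ℕ × ℤ)} {N : ℕ} : UniE p M N (fun _ => 0) := by
  intro _ k hk
  have : (mk fun _ : ℕ => (0 : ENNReal).toReal) = 0 := by ext; simp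
  rw [this]; simp

lemma zpow_sum' {ι : Type*} {x : ℝ≥0} (hx : x ≠ 0) (s : Finset ι) (f : ι → ℤ) : x ^ (∑ j ∈ s, f j) = ∏ j ∈ s, x ^ f j := by
  classical
  induction s using Finset.induction_on with
  | empty => simp
  | insert a s ha ih => rw [Finset.sum_insert ha, Finset.prod_insert ha, zpow_add₀ hx, ih]

/-- affine exponents -/
lemma aff_uni (p : ℕ) (hp : p ≠ 0) {k : ℕ} (E G : (Fin k → ℕ) → ℤ) (hE : IsAff E) (hG : IsAff G) (hpos : ∀ n, 0 ≤ G n)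
    (M : Multiset (ℕ × ℤ)) (hM : M = ∑ j, if 0 < G (Pi.single j 1) - G 0 then
      {((G (Pi.single j 1) - G 0).toNat, -(E (Pi.single j 1) - E 0))} else 0) :
    UniE p M (G 0).toNat (fun i => ∑' n, if G n = i then (p : ENNReal) ^ (-E n) else 0) := by
  have hs : ∀ j, 0 ≤ G (Pi.single j 1) - G 0 := by
    intro j
    by_contra hneg
    have h1 := hpos (Pi.single j (G 0 + 1).toNat)
    rw [hG.formula, Finset.sum_eq_single j] at h1
    · have h0 := hpos 0
      simp only [Pi.single_eq_same] at h1
      rw [Int.toNat_of_nonneg (by omega)] at h1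
      nlinarith
    · intro b _ hb; simp [hb]
    · simp
  let g : Fin k → ℕ := fun j => (G (Pi.single j 1) - G 0).toNat
  let r : Fin k → ℝ≥0 := fun j => (p : ℝ≥0) ^ (-(E (Pi.single j 1) - E 0))
  have hp' : (p : ℝ≥0) ≠ 0 := by exact_mod_cast hp
  have e : (fun i : ℕ => ∑' n, if G n = i then (p : ENNReal) ^ (-E n) else 0) =
      cone g r (G 0).toNat ((p : ℝ≥0) ^ (-E 0)) := by
    funext i
    unfold cone
    refine tsum_congr fun n => ?_
    have h1 : G n = i ↔ (G 0).toNat + ∑ j, n j * g j = i := by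
      rw [hG.formula n, ← Int.natCast_inj]
      push_cast
      rw [Int.toNat_of_nonneg (hpos 0)]
      simp only [g, Int.toNat_of_nonneg (hs _)]
    have h2 : (p : ENNReal) ^ (-E n) = (((p : ℝ≥0) ^ (-E 0) * ∏ j, r j ^ n j : ℝ≥0) : ENNReal) := by
      have : (p : ℝ≥0) ^ (-E n) = (p : ℝ≥0) ^ (-E 0) * ∏ j, r j ^ n j := by
        rw [hE.formula n, neg_add, zpow_add₀ hp', ← Finset.sum_neg_distrib]
        congr 1
        rw [zpow_sum' hp']
        refine Finset.prod_congr rfl fun j _ => ?_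
        simp only [r]
        rw [← zpow_natCast, ← zpow_mul]; congr 1; ring
      rw [← this, ENNReal.coe_zpow hp']; simp
    simp only [h1, h2]
  rw [e]
  intro hfin
  have := cone_uni g r _ _ hfin
  convert this using 1
  rw [hM, spM, coneM, ← Multiset.coe_mapAddMonoidHom, map_sum]
  refine Finset.sum_congr rfl fun j _ => ?_
  have : 0 < g j ↔ 0 < G (Pi.single j 1) - G 0 := by simp [g]
  simp only [this]
  split_ifs
  · simp [g, r]
  · simp

end LSZ

/-! ### Part 17 -/
namespace LSZ
open MeasureTheory
open scoped NNReal ENNReal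

namespace Base

variable {q : ℕ} {S : Type}

lemma mev_zero {p : ℕ} [Fact p.Prime] (x : Fin 0 → ℚ_[p]) (f : MvPolynomial (Fin 0) ℤ) :
    mev x f = ((MvPolynomial.isEmptyRingEquiv ℤ (Fin 0) f : ℤ) : ℚ_[p]) := by
  conv_lhs => rw [← (MvPolynomial.isEmptyRingEquiv ℤ (Fin 0)).symm_apply_apply f]
  rw [MvPolynomial.isEmptyRingEquiv_symm_apply]
  simp

lemma pval_le (p : ℕ) (n : ℤ) : padicValInt p n ≤ n.natAbs := by
  rw [padicValInt]
  exact (padicValNat_le_nat_log _).trans (Nat.log_le_self _ _)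

lemma aff_zero {l : (BB 0 q S).Ω → ℤ} (hl : l ∈ (BB 0 q S).Aff) :
    ∃ (L : (Fin q → ℤ) →+ ℤ) (b : Nat.Primes → ℤ), (Set.range b).Finite ∧ ∀ ω, l ω = L ω.2.2.1 + b ω.1 := by
  induction hl using AddSubgroup.closure_induction with
  | mem l hl =>
    rcases hl with rfl | ⟨i, rfl⟩
    · exact ⟨0, fun _ => 1, Set.finite_range_const, fun ω => by simp⟩
    · rcases i with f | j
      · refine ⟨0, fun p => padicValInt p (MvPolynomial.isEmptyRingEquiv ℤ (Fin 0) f), ?_, fun ω => ?_⟩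
        · refine (Set.finite_Icc (0 : ℤ) ((MvPolynomial.isEmptyRingEquiv ℤ (Fin 0) f).natAbs : ℤ)).subset ?_
          rintro _ ⟨p, rfl⟩
          have := pval_le p (MvPolynomial.isEmptyRingEquiv ℤ (Fin 0) f)
          simp only [Set.mem_Icc]
          omega
        · simp only [V, Sum.elim_inl, mev_zero, Padic.valuation_intCast]; simp
      · refine ⟨Pi.evalAddMonoidHom (fun _ => ℤ) j, fun _ => 0, Set.finite_range_const, fun ω => ?_⟩
        simp only [V, Sum.elim_inr, RVT.val_zpow]; simp
  | zero => exact ⟨0, fun _ => 0, Set.finite_range_const, fun ω => by simp⟩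
  | add l l' _ _ h h' =>
    obtain ⟨L, b, hb, h⟩ := h
    obtain ⟨L', b', hb', h'⟩ := h'
    refine ⟨L + L', fun p => b p + b' p, ?_, fun ω => ?_⟩
    · refine (hb.image2 (· + ·) hb').subset ?_
      rintro _ ⟨p, rfl⟩
      exact ⟨_, ⟨p, rfl⟩, _, ⟨p, rfl⟩, rfl⟩
    · simp [h, h']; ring
  | neg l _ h =>
    obtain ⟨L, b, hb, h⟩ := h
    refine ⟨-L, fun p => -b p, ?_, fun ω => ?_⟩
    · refine (hb.image (- ·)).subset ?_
      rintro _ ⟨p, rfl⟩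
      exact ⟨_, ⟨p, rfl⟩, rfl⟩
    · simp [h]; ring

def LocC (F : Set ((Fin q → ℤ) → ℤ)) (M : ℕ) {T : Type*} (f : (BB 0 q S).Ω → T) : Prop :=
  ∀ (p : Nat.Primes) (x x' : Fin 0 → ℚ_[p]) (s : S) (γ γ' : Fin q → ℤ), (∀ l ∈ F, 0 ≤ l γ ↔ 0 ≤ l γ') →
    (∀ j, γ j % M = γ' j % M) → f ⟨p, x, γ, s⟩ = f ⟨p, x', γ', s⟩

lemma modL (L : (Fin q → ℤ) →+ ℤ) (M : ℕ) {γ γ' : Fin q → ℤ} (h : ∀ j, γ j % M = γ' j % M) : L γ % M = L γ' % M := by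
  have e : ∀ γ : Fin q → ℤ, L γ = ∑ j, γ j * L (Pi.single j 1) := by
    intro γ
    conv_lhs => rw [← Finset.univ_sum_single γ]
    rw [map_sum]
    refine Finset.sum_congr rfl fun j _ => ?_
    have : (Pi.single j (γ j) : Fin q → ℤ) = γ j • Pi.single j 1 := by
      rw [← Pi.single_smul]; simp
    rw [this, map_zsmul]; simp
  rw [e, e, Finset.sum_int_mod, Finset.sum_int_mod Finset.univ _ (fun j => γ' j * _)]
  congr 1
  refine Finset.sum_congr rfl fun j _ => ?_
  rw [Int.mul_emod, h, ← Int.mul_emod]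

lemma loc_basic {ψ : (BB 0 q S).Ω → ℤ} (h : (BB 0 q S).Basic ψ) :
    ∃ (F : Set ((Fin q → ℤ) → ℤ)) (M : ℕ), F.Finite ∧ (∀ l ∈ F, IsAff l) ∧ 0 < M ∧ LocC F M ψ := by
  cases h with
  | acr i k hk =>
    refine ⟨∅, 1, Set.finite_empty, by simp, one_pos, ?_⟩
    intro p x x' s γ γ' _ _
    rcases i with f | j
    · rw [Subsingleton.elim x x']; rfl
    · simp only [Sum.elim_inr, acr, RVT.ac_zpow]
  | mod l hl k hk =>
    obtain ⟨L, b, hb, h⟩ := aff_zero hl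
    refine ⟨∅, k, Set.finite_empty, by simp, Nat.pos_of_ne_zero hk, ?_⟩
    intro p x x' s γ γ' _ hm
    simp only [h]
    rw [Int.add_emod, modL L k hm, ← Int.add_emod]
  | sgn l hl =>
    obtain ⟨L, b, hb, h⟩ := aff_zero hl
    refine ⟨(fun c γ => L γ + c) '' Set.range b, 1, hb.image _, ?_, one_pos, ?_⟩
    · rintro _ ⟨c, _, rfl⟩ n m
      simp; ring
    · intro p x x' s γ γ' hs _
      simp only [h]
      have := hs _ ⟨b p, ⟨p, rfl⟩, rfl⟩
      simp only [this]

lemma loc_tame {T : Type*} {f : (BB 0 q S).Ω → T} (h : (BB 0 q S).TameT f) :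
    ∃ (F : Set ((Fin q → ℤ) → ℤ)) (M : ℕ), F.Finite ∧ (∀ l ∈ F, IsAff l) ∧ 0 < M ∧ LocC F M f := by
  obtain ⟨A, hA, hb, h⟩ := h
  have : ∃ (F : Set ((Fin q → ℤ) → ℤ)) (M : ℕ), F.Finite ∧ (∀ l ∈ F, IsAff l) ∧ 0 < M ∧ ∀ ψ ∈ A, LocC F M ψ := by
    clear h
    induction A, hA using Set.Finite.induction_on with
    | empty => exact ⟨∅, 1, Set.finite_empty, by simp, one_pos, by simp⟩
    | insert hn hf ih =>
      rename_i ψ A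
      obtain ⟨F, M, h1, h2, h3, h4⟩ := ih (fun ψ' h => hb _ (Set.mem_insert_of_mem _ h))
      obtain ⟨F', M', h1', h2', h3', h4'⟩ := loc_basic (hb ψ (Set.mem_insert _ _))
      have hd : ∀ (a b c : ℤ) (K : ℤ), c ∣ K → a % K = b % K → a % c = b % c := by
        intro a b c K hc hab
        rw [← Int.emod_emod_of_dvd a hc, hab, Int.emod_emod_of_dvd b hc]
      refine ⟨F ∪ F', M * M', h1.union h1', ?_, Nat.mul_pos h3 h3', ?_⟩
      · rintro l (hl | hl)
        exacts [h2 l hl, h2' l hl]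
      · rintro ψ' (rfl | hψ')
        · intro p x x' s γ γ' hs hm
          exact h4' p x x' s γ γ' (fun l hl => hs l (Or.inr hl)) (fun j => hd _ _ _ _ ⟨M, by push_cast; ring⟩ (hm j))
        · intro p x x' s γ γ' hs hm
          exact h4 _ hψ' p x x' s γ γ' (fun l hl => hs l (Or.inl hl)) (fun j => hd _ _ _ _ ⟨M', by push_cast; ring⟩ (hm j))
  obtain ⟨F, M, h1, h2, h3, h4⟩ := this
  refine ⟨F, M, h1, h2, h3, ?_⟩
  intro p x x' s γ γ' hs hm
  exact h _ _ ⟨rfl, rfl, fun ψ hψ => h4 ψ hψ p x x' s γ γ' hs hm⟩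

/-- uniform rationality of a family of sequences -/
def RatU (c : Nat.Primes → ℕ → ENNReal) : Prop :=
  ∃ (M : Multiset (ℕ × ℤ)) (N : ℕ), (∀ x ∈ M, 1 ≤ x.1) ∧ ∀ p : Nat.Primes, UniE p M N (c p)

lemma RatU.sum {ι : Type*} (s : Finset ι) {c : ι → Nat.Primes → ℕ → ENNReal} (h : ∀ a, RatU (c a)) :
    RatU (fun p i => ∑ a ∈ s, c a p i) := by
  classical
  induction s using Finset.induction_on with
  | empty => exact ⟨0, 0, by simp, fun p => by simpa using UniE.zero⟩
  | insert a s ha ih =>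
    obtain ⟨M, N, h1, h2⟩ := ih
    obtain ⟨M', N', h1', h2'⟩ := h a
    refine ⟨M + M', N + N', ?_, fun p => ?_⟩
    · intro x hx
      rcases Multiset.mem_add.1 hx with hx | hx
      exacts [h1 x hx, h1' x hx]
    · simp only [Finset.sum_insert ha]
      exact ((h2' p).mono (Multiset.le_add_left _ _) (by omega)).add ((h2 p).mono (Multiset.le_add_right _ _) (by omega))

theorem rat_zero {pred : (BB 0 q S).Ω → Prop} {e g : (BB 0 q S).Ω → ℤ} (hpred : (BB 0 q S).TameT pred)
    (he : (BB 0 q S).TameZ e) (hg : (BB 0 q S).TameZ g) (hpos : ∀ ω, pred ω → 0 ≤ g ω) : RatU (coef pred e g) := by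
  classical
  obtain ⟨ne, κe, le, De, hDe, hκe, hle, hfe⟩ := he
  obtain ⟨ng, κg, lg, Dg, hDg, hκg, hlg, hfg⟩ := hg
  choose Le be hbe hLe using fun k => aff_zero (hle k)
  choose Lg bg hbg hLg using fun k => aff_zero (hlg k)
  obtain ⟨F, m, hF, hFa, hm, hloc⟩ := loc_tame (hpred.prod (hκe.prod hκg))
  have hgood := good_univ F hF hFa m hm
  let x0 : (p : Nat.Primes) → Fin 0 → ℚ_[p] := fun p _ => 0
  have claim : ∀ A, Good (fun A : Set (Fin q → ℤ) => (∀ l ∈ F, SgnC l A) ∧ ∀ x ∈ A, ∀ y ∈ A, ∀ j, x j % m = y j % m) A →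
      ∃ (M : Multiset (ℕ × ℤ)) (N : ℕ), (∀ x ∈ M, 1 ≤ x.1) ∧ ∀ (p : Nat.Primes) (s : S),
        UniE p M N (fun i => ∑' γ, A.indicator (fun γ => W pred e g i ⟨p, x0 p, γ, s⟩) γ) := by
    intro A hA
    induction hA with
    | empty => exact ⟨0, 0, by simp, fun p s => by simpa using UniE.zero⟩
    | union A B _ _ hd ihA ihB =>
      obtain ⟨M, N, h1, h2⟩ := ihA
      obtain ⟨M', N', h1', h2'⟩ := ihB
      refine ⟨M + M', N + N', ?_, fun p s => ?_⟩
      · intro x hx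
        rcases Multiset.mem_add.1 hx with hx | hx
        exacts [h1 x hx, h1' x hx]
      · have := ((h2 p s).mono (Multiset.le_add_right M M') (by omega : N ≤ N + N')).add
          ((h2' p s).mono (Multiset.le_add_left M' M) (by omega : N' ≤ N + N'))
        convert this using 2 with i
        rw [Set.indicator_union_of_disjoint hd, ← ENNReal.tsum_add]
    | piece k φ ha hi h =>
      let σe : Fin ne → Fin k → ℤ := fun a j => (Le a (φ (Pi.single j 1)) - Le a (φ 0)) / De
      let σg : Fin ng → Fin k → ℤ := fun b j => (Lg b (φ (Pi.single j 1)) - Lg b (φ 0)) / Dg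
      let M0 : Fin ne → Fin ng → Multiset (ℕ × ℤ) := fun a b => ∑ j, if 0 < σg b j then {((σg b j).toNat, -σe a j)} else 0
      have hN : ∀ b, ∃ N : ℕ, ∀ p, ((Lg b (φ 0) + bg b p) / Dg).toNat ≤ N := by
        intro b
        have : (Set.range fun p => ((Lg b (φ 0) + bg b p) / Dg).toNat).Finite := by
          refine ((hbg b).image (fun y => ((Lg b (φ 0) + y) / Dg).toNat)).subset ?_
          rintro _ ⟨p, rfl⟩
          exact ⟨_, ⟨p, rfl⟩, rfl⟩
        obtain ⟨N, hN⟩ := this.bddAbove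
        exact ⟨N, fun p => hN ⟨p, rfl⟩⟩
      choose N hN using hN
      refine ⟨∑ a, ∑ b, M0 a b, ∑ b, N b, ?_, fun p s => ?_⟩
      · intro x hx
        obtain ⟨a, _, hx⟩ := Multiset.mem_sum.1 hx
        obtain ⟨b, _, hx⟩ := Multiset.mem_sum.1 hx
        obtain ⟨j, _, hx⟩ := Multiset.mem_sum.1 hx
        split_ifs at hx with h
        · rw [Multiset.mem_singleton] at hx
          subst hx; simp only; omega
        · simp at hx
      · have hc : ∀ n, (pred ⟨p, x0 p, φ n, s⟩, κe ⟨p, x0 p, φ n, s⟩, κg ⟨p, x0 p, φ n, s⟩) =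
            (pred ⟨p, x0 p, φ 0, s⟩, κe ⟨p, x0 p, φ 0, s⟩, κg ⟨p, x0 p, φ 0, s⟩) := fun n =>
          hloc p _ _ s (φ n) (φ 0) (fun l hl => h.1 l hl _ ⟨n, rfl⟩ _ ⟨0, rfl⟩) (fun j => h.2 _ ⟨n, rfl⟩ _ ⟨0, rfl⟩ j)
        have hc1 : ∀ n, pred ⟨p, x0 p, φ n, s⟩ = pred ⟨p, x0 p, φ 0, s⟩ := fun n => congrArg Prod.fst (hc n)
        have hc2 : ∀ n, κe ⟨p, x0 p, φ n, s⟩ = κe ⟨p, x0 p, φ 0, s⟩ := fun n => congrArg (fun x => x.2.1) (hc n)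
        have hc3 : ∀ n, κg ⟨p, x0 p, φ n, s⟩ = κg ⟨p, x0 p, φ 0, s⟩ := fun n => congrArg (fun x => x.2.2) (hc n)
        set a := κe ⟨p, x0 p, φ 0, s⟩ with ha'
        set b := κg ⟨p, x0 p, φ 0, s⟩ with hb'
        have hE : ∀ n, De * e ⟨p, x0 p, φ n, s⟩ = Le a (φ n) + be a p := by
          intro n; rw [hfe, hc2, hLe]
        have hG : ∀ n, Dg * g ⟨p, x0 p, φ n, s⟩ = Lg b (φ n) + bg b p := by
          intro n; rw [hfg, hc3, hLg]
        have hsum : (fun i : ℕ => ∑' γ, (Set.range φ).indicator (fun γ => W pred e g i ⟨p, x0 p, γ, s⟩) γ) =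
            fun i => ∑' n, W pred e g i ⟨p, x0 p, φ n, s⟩ := by
          funext i
          rw [← tsum_subtype (Set.range φ) (fun γ => W pred e g i ⟨p, x0 p, γ, s⟩)]
          exact tsum_range (g := φ) (fun γ => W pred e g i ⟨p, x0 p, γ, s⟩) hi
        rw [hsum]
        by_cases hp : pred ⟨p, x0 p, φ 0, s⟩
        · have hW : (fun i : ℕ => ∑' n, W pred e g i ⟨p, x0 p, φ n, s⟩) =
              fun i : ℕ => ∑' n, if (g ⟨p, x0 p, φ n, s⟩) = i then ((p : ℕ) : ENNReal) ^ (-e ⟨p, x0 p, φ n, s⟩) else 0 := by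
            funext i
            refine tsum_congr fun n => ?_
            have : pred ⟨p, x0 p, φ n, s⟩ := by rw [hc1]; exact hp
            simp only [W, this, true_and]
          rw [hW]
          have hEa : IsAff (fun n => e ⟨p, x0 p, φ n, s⟩) := by
            intro n n'
            apply mul_left_cancel₀ hDe.ne'
            simp only [mul_add, hE]
            have := congrArg (Le a) (ha n n')
            rw [map_add, map_add] at this
            linarith
          have hGa : IsAff (fun n => g ⟨p, x0 p, φ n, s⟩) := by
            intro n n'
            apply mul_left_cancel₀ hDg.ne'
            simp only [mul_add, hG]
            have := congrArg (Lg b) (ha n n')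
            rw [map_add, map_add] at this
            linarith
          have hes : ∀ j, e ⟨p, x0 p, φ (Pi.single j 1), s⟩ - e ⟨p, x0 p, φ 0, s⟩ = σe a j := by
            intro j
            have h1 := hE (Pi.single j 1)
            have h2 := hE 0
            symm
            refine Int.ediv_eq_of_eq_mul_right hDe.ne' ?_
            rw [mul_sub, h1, h2]; ring
          have hgs : ∀ j, g ⟨p, x0 p, φ (Pi.single j 1), s⟩ - g ⟨p, x0 p, φ 0, s⟩ = σg b j := by
            intro j
            have h1 := hG (Pi.single j 1)
            have h2 := hG 0
            symm
            refine Int.ediv_eq_of_eq_mul_right hDg.ne' ?_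
            rw [mul_sub, h1, h2]; ring
          have := aff_uni p p.2.ne_zero _ _ hEa hGa (fun n => hpos _ (by rw [hc1]; exact hp)) (M0 a b) (by
            simp only [M0, hes, hgs])
          refine this.mono ?_ ?_
          · exact (Finset.single_le_sum_of_canonicallyOrdered (f := fun b => M0 a b) (Finset.mem_univ b)).trans
              (Finset.single_le_sum_of_canonicallyOrdered (f := fun a => ∑ b, M0 a b) (Finset.mem_univ a))
          · refine le_trans ?_ (Finset.single_le_sum_of_canonicallyOrdered (f := N) (Finset.mem_univ b))
            refine le_trans (le_of_eq ?_) (hN b p)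
            congr 1
            symm
            exact Int.ediv_eq_of_eq_mul_right hDg.ne' (hG 0).symm
        · have hW : (fun i : ℕ => ∑' n, W pred e g i ⟨p, x0 p, φ n, s⟩) = fun _ => 0 := by
            funext i
            rw [ENNReal.tsum_eq_zero]
            intro n
            have : ¬ pred ⟨p, x0 p, φ n, s⟩ := by rw [hc1]; exact hp
            simp only [W, this, false_and, if_false]
          rw [hW]; exact UniE.zero
  obtain ⟨M, N, h1, h2⟩ := claim _ hgood
  refine ⟨M, N, h1, fun p => ?_⟩
  have := UniE.tsum (fun s => h2 p s)
  convert this using 2 with i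
  unfold coef
  rw [ENNReal.tsum_comm, ← ENNReal.tsum_prod]
  refine tsum_congr fun y => ?_
  rw [Measure.volume_pi_eq_dirac (x0 p), lintegral_dirac]
  simp

/-- Denef-type rationality theorem -/
theorem rat_all (m : ℕ) : ∀ {q : ℕ} {S : Type} [Countable S] {pred : (BB m q S).Ω → Prop} {e g : (BB m q S).Ω → ℤ},
    (BB m q S).TameT pred → (BB m q S).TameZ e → (BB m q S).TameZ g → RatU (coef pred e g) := by
  induction m with
  | zero =>
    intro q S _ pred e g hp he hg
    have := rat_zero (hp.and hg.nonneg) he hg (fun ω h => h.2)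
    convert this using 1
    funext p i
    unfold coef W
    refine tsum_congr fun y => ?_
    refine lintegral_congr fun x => ?_
    congr 1
    apply propext
    constructor
    · rintro ⟨h1, h2⟩; exact ⟨⟨h1, by rw [h2]; positivity⟩, h2⟩
    · rintro ⟨h1, h2⟩; exact ⟨h1.1, h2⟩
  | succ m ih =>
    intro q S _ pred e g hp he hg
    obtain ⟨N, pred', e', g', hp', he', hg', h⟩ := coef_step hp he hg
    have := RatU.sum Finset.univ (fun a => ih (hp' a) (he' a) (hg' a))
    convert this using 1
    funext p i
    exact h p i

end Base
end LSZ

/-! ### Part 18 -/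
namespace LSZ
open Matrix

section lat
variable {p : ℕ} [Fact p.Prime] {d : ℕ}

/-- integrality of a vector -/
def OI (y : Fin d → ℚ_[p]) : Prop := ∀ k, ‖y k‖ ≤ 1
/-- integrality of a matrix -/
def Itg (T : Matrix (Fin d) (Fin d) ℚ_[p]) : Prop := ∀ i j, ‖T i j‖ ≤ 1
/-- cast of an integer matrix -/
noncomputable def icast (p : ℕ) [Fact p.Prime] (g : Matrix (Fin d) (Fin d) ℤ) : Matrix (Fin d) (Fin d) ℚ_[p] :=
  g.map (Int.castRingHom ℚ_[p])
/-- cast of an integer vector -/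
noncomputable def vcast (p : ℕ) [Fact p.Prime] (z : Fin d → ℤ) : Fin d → ℚ_[p] := fun k => (z k : ℚ_[p])

lemma OI.add {x y : Fin d → ℚ_[p]} (hx : OI x) (hy : OI y) : OI (x + y) := fun k => um_add_le (hx k) (hy k)
lemma OI.neg {x : Fin d → ℚ_[p]} (hx : OI x) : OI (-x) := fun k => by
  rw [Pi.neg_apply, norm_neg]; exact hx k
lemma OI.smul {x : Fin d → ℚ_[p]} {c : ℚ_[p]} (hc : ‖c‖ ≤ 1) (hx : OI x) : OI (c • x) := fun k => by
  rw [Pi.smul_apply, smul_eq_mul, norm_mul]; exact mul_le_one₀ hc (norm_nonneg _) (hx k)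
lemma OI.sum {ι : Type*} {s : Finset ι} {f : ι → Fin d → ℚ_[p]} (h : ∀ i ∈ s, OI (f i)) : OI (∑ i ∈ s, f i) := by
  intro k
  rw [Finset.sum_apply]
  exact um_sum_le _ _ zero_le_one (fun i hi => h i hi k)
lemma OI_vcast (z : Fin d → ℤ) : OI (vcast p z) := fun _ => Padic.norm_int_le_one _

lemma Itg_icast (g : Matrix (Fin d) (Fin d) ℤ) : Itg (icast p g) := fun _ _ => Padic.norm_int_le_one _

lemma OI.vecMul {y : Fin d → ℚ_[p]} {T : Matrix (Fin d) (Fin d) ℚ_[p]} (hy : OI y) (hT : Itg T) : OI (y ᵥ* T) := by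
  intro k
  simp only [Matrix.vecMul, dotProduct]
  refine um_sum_le _ _ zero_le_one (fun i _ => ?_)
  rw [norm_mul]; exact mul_le_one₀ (hy i) (norm_nonneg _) (hT _ _)

lemma Itg.mul {S T : Matrix (Fin d) (Fin d) ℚ_[p]} (hS : Itg S) (hT : Itg T) : Itg (S * T) := by
  intro i k
  rw [Matrix.mul_apply]
  refine um_sum_le _ _ zero_le_one (fun i _ => ?_)
  rw [norm_mul]; exact mul_le_one₀ (hS _ i) (norm_nonneg _) (hT _ _)

lemma Itg.add {S T : Matrix (Fin d) (Fin d) ℚ_[p]} (hS : Itg S) (hT : Itg T) : Itg (S + T) :=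
  fun i j => um_add_le (hS i j) (hT i j)

lemma Itg.one : Itg (1 : Matrix (Fin d) (Fin d) ℚ_[p]) := by
  intro i j
  rw [Matrix.one_apply]; split_ifs <;> simp

/-- lift to the integers -/
lemma Itg.lift {T : Matrix (Fin d) (Fin d) ℚ_[p]} (hT : Itg T) :
    ∃ T' : Matrix (Fin d) (Fin d) ℤ_[p], T = T'.map (PadicInt.Coe.ringHom) :=
  ⟨fun i j => ⟨T i j, hT i j⟩, by ext i j; rfl⟩

lemma Itg.det {T : Matrix (Fin d) (Fin d) ℚ_[p]} (hT : Itg T) : ‖T.det‖ ≤ 1 := by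
  obtain ⟨T', rfl⟩ := hT.lift
  have : (T'.map (PadicInt.Coe.ringHom)).det = PadicInt.Coe.ringHom T'.det := by
    rw [RingHom.map_det]; rfl
  rw [this]; exact T'.det.2

lemma Itg.adj {T : Matrix (Fin d) (Fin d) ℚ_[p]} (hT : Itg T) : Itg T.adjugate := by
  obtain ⟨T', rfl⟩ := hT.lift
  have : (T'.map (PadicInt.Coe.ringHom)).adjugate = (T'.adjugate).map (PadicInt.Coe.ringHom) := by
    have := (RingHom.map_adjugate (PadicInt.Coe.ringHom (p := p)) T')
    exact this.symm
  rw [this]; intro i j; exact (T'.adjugate i j).2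

lemma inv_eq {T : Matrix (Fin d) (Fin d) ℚ_[p]} : T⁻¹ = T.det⁻¹ • T.adjugate := by
  rw [Matrix.inv_def, Ring.inverse_eq_inv']

def GLO (U : Matrix (Fin d) (Fin d) ℚ_[p]) : Prop := Itg U ∧ ‖U.det‖ = 1

lemma isU {T : Matrix (Fin d) (Fin d) ℚ_[p]} (h : T.det ≠ 0) : IsUnit T.det := isUnit_iff_ne_zero.2 h

lemma GLO.det_ne {U : Matrix (Fin d) (Fin d) ℚ_[p]} (h : GLO U) : U.det ≠ 0 := by
  intro h0; have := h.2; rw [h0, norm_zero] at this; exact zero_ne_one this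

lemma GLO.inv {U : Matrix (Fin d) (Fin d) ℚ_[p]} (h : GLO U) : Itg U⁻¹ := by
  intro i j
  rw [inv_eq, Matrix.smul_apply, smul_eq_mul, norm_mul, norm_inv, h.2, inv_one, one_mul]
  exact h.1.adj i j

/-- the lattice in `ℤ^d` cut out by `T` -/
noncomputable def HT (T : Matrix (Fin d) (Fin d) ℚ_[p]) : AddSubgroup (Fin d → ℤ) where
  carrier := {z | OI (vcast p z ᵥ* T⁻¹)}
  zero_mem' := by
    have : vcast p (0 : Fin d → ℤ) = 0 := by ext; simp [vcast]
    intro k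
    rw [this, Matrix.zero_vecMul]; simp
  add_mem' := by
    intro a b ha hb
    have : vcast p (a + b) = vcast p a + vcast p b := by ext; simp [vcast]
    have h2 := OI.add ha hb
    rwa [← Matrix.add_vecMul, ← this] at h2
  neg_mem' := by
    intro a ha
    have : vcast p (-a) = - vcast p a := by ext; simp [vcast]
    have h2 := OI.neg ha
    rwa [← Matrix.neg_vecMul, ← this] at h2

lemma mem_HT {T : Matrix (Fin d) (Fin d) ℚ_[p]} {z : Fin d → ℤ} : z ∈ HT T ↔ OI (vcast p z ᵥ* T⁻¹) := Iff.rfl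

lemma HT_mul {U T : Matrix (Fin d) (Fin d) ℚ_[p]} (hU : GLO U) : HT (U * T) = HT T := by
  ext z
  rw [mem_HT, mem_HT, Matrix.mul_inv_rev, ← Matrix.vecMul_vecMul]
  constructor
  · intro h
    have := h.vecMul hU.1
    rwa [Matrix.vecMul_vecMul, Matrix.nonsing_inv_mul _ (isU hU.det_ne), Matrix.vecMul_one] at this
  · intro h; exact h.vecMul hU.inv

/-- basis matrices -/
lemma exists_mat (H : AddSubgroup (Fin d → ℤ)) (h : H.index ≠ 0) :
    ∃ g : Matrix (Fin d) (Fin d) ℤ, (∀ z, z ∈ H ↔ ∃ w, z = w ᵥ* g) ∧ g.det.natAbs = H.index := by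
  obtain ⟨e⟩ := Int.addSubgroup_index_ne_zero_iff.1 h
  let bN : Module.Basis (Fin d) ℤ H := Module.Basis.ofEquivFun e.toIntLinearEquiv
  refine ⟨fun i => (bN i : Fin d → ℤ), fun z => ⟨fun hz => ?_, ?_⟩, ?_⟩
  · refine ⟨bN.repr ⟨z, hz⟩, ?_⟩
    have := congrArg (Subtype.val) (bN.sum_repr ⟨z, hz⟩)
    simp only [AddSubgroup.val_finsetSum] at this
    refine this.symm.trans ?_
    ext k
    simp [Matrix.vecMul, dotProduct, Finset.sum_apply]
  · rintro ⟨w, rfl⟩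
    have : w ᵥ* (fun i => (bN i : Fin d → ℤ)) = ((∑ i, w i • bN i : H) : Fin d → ℤ) := by
      ext k
      simp [Matrix.vecMul, dotProduct, Finset.sum_apply]
    rw [this]; exact Subtype.mem _
  · rw [AddSubgroup.index_eq_natAbs_det (Pi.basisFun ℤ (Fin d)) H bN, Module.Basis.det_apply, ← Matrix.det_transpose]
    congr 2

lemma icast_mul (A B : Matrix (Fin d) (Fin d) ℤ) : icast p (A * B) = icast p A * icast p B :=
  Matrix.map_mul
lemma icast_det (A : Matrix (Fin d) (Fin d) ℤ) : (icast p A).det = (A.det : ℚ_[p]) :=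
  ((Int.castRingHom ℚ_[p]).map_det A).symm
lemma vcast_vecMul (w : Fin d → ℤ) (A : Matrix (Fin d) (Fin d) ℤ) : vcast p (w ᵥ* A) = vcast p w ᵥ* icast p A := by
  ext k
  simp [vcast, icast, Matrix.vecMul, dotProduct]

lemma norm_natAbs (n : ℤ) : ‖(n : ℚ_[p])‖ = ‖(n.natAbs : ℚ_[p])‖ := by
  rcases Int.natAbs_eq n with h | h
  · conv_lhs => rw [h]
    simp
  · conv_lhs => rw [h]
    simp

lemma icast_det_norm {g : Matrix (Fin d) (Fin d) ℤ} {i : ℕ} (h : g.det.natAbs = p ^ i) :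
    ‖(icast p g).det‖ = (p : ℝ) ^ (-(i : ℤ)) := by
  rw [icast_det, norm_natAbs, h, Nat.cast_pow, Padic.norm_p_pow]

lemma icast_det_ne {g : Matrix (Fin d) (Fin d) ℤ} {i : ℕ} (h : g.det.natAbs = p ^ i) :
    (icast p g).det ≠ 0 := by
  rw [← norm_ne_zero_iff, icast_det_norm h]
  exact (zpow_pos p_pos _).ne'

lemma HT_icast {H : AddSubgroup (Fin d → ℤ)} {g : Matrix (Fin d) (Fin d) ℤ} {i : ℕ}
    (hg : ∀ z, z ∈ H ↔ ∃ w, z = w ᵥ* g) (hd : g.det.natAbs = H.index) (hi : H.index = p ^ i) :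
    HT (icast p g) = H := by
  have hu := isU (icast_det_ne (p := p) (hd.trans hi))
  ext z
  rw [mem_HT]
  constructor
  · intro h
    obtain ⟨w, hw⟩ := (hg _).1 (H.nsmul_index_mem z)
    rw [hi] at hw
    have h1 : vcast p w = ((p : ℚ_[p]) ^ i) • (vcast p z ᵥ* (icast p g)⁻¹) := by
      have := congrArg (vcast p) hw
      rw [vcast_vecMul] at this
      have h2 := congrArg (fun v => v ᵥ* (icast p g)⁻¹) this
      simp only [Matrix.vecMul_vecMul, Matrix.mul_nonsing_inv _ hu, Matrix.vecMul_one] at h2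
      rw [← h2, ← Matrix.smul_vecMul]
      congr 1
      ext k; simp [vcast]
    have h2 : ∀ k, ∃ c, w k = (p : ℤ) ^ i * c := by
      intro k
      have h3 : ‖(w k : ℚ_[p])‖ ≤ (p : ℝ) ^ (-(i : ℤ)) := by
        have := congrFun h1 k
        change (w k : ℚ_[p]) = _ at this
        rw [this, Pi.smul_apply, smul_eq_mul, norm_mul, Padic.norm_p_pow]
        exact mul_le_of_le_one_right (zpow_pos p_pos _).le (h k)
      rw [Padic.norm_int_le_pow_iff_dvd] at h3
      exact_mod_cast h3
    choose w' hw' using h2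
    refine (hg z).2 ⟨w', ?_⟩
    have hp : ((p : ℤ) ^ i) ≠ 0 := pow_ne_zero _ (by exact_mod_cast (Fact.out : p.Prime).ne_zero)
    have h3 : w = ((p : ℤ) ^ i) • w' := by ext k; simp [hw']
    have h4 : ((p : ℤ) ^ i) • z = ((p : ℤ) ^ i) • (w' ᵥ* g) := by
      rw [← Matrix.smul_vecMul, ← h3, ← hw]
      ext k; simp
    ext k
    have := congrFun h4 k
    simpa [hp] using this
  · intro h
    obtain ⟨w, rfl⟩ := (hg z).1 h
    rw [vcast_vecMul, Matrix.vecMul_vecMul, Matrix.mul_nonsing_inv _ hu, Matrix.vecMul_one]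
    exact OI_vcast w

lemma approx (i : ℕ) {x : ℚ_[p]} (hx : ‖x‖ ≤ 1) : ∃ (n : ℤ) (w : ℚ_[p]), ‖w‖ ≤ 1 ∧ x = n + (p : ℚ_[p]) ^ i * w := by
  have hn : p ^ i ≠ 0 := pow_ne_zero _ (Fact.out : p.Prime).ne_zero
  have hp : (p : ℚ_[p]) ^ i ≠ 0 := pow_ne_zero _ p_ne
  refine ⟨(res (p ^ i) x : ℕ), (x - (res (p ^ i) x : ℕ)) / (p : ℚ_[p]) ^ i, ?_, ?_⟩
  · have := (res_spec hn hx).le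
    rw [norm_div, div_le_one (norm_pos_iff.2 hp)]
    simpa using this
  · field_simp
    push_cast
    ring

lemma mat_row {H : AddSubgroup (Fin d → ℤ)} {g : Matrix (Fin d) (Fin d) ℤ} (hg : ∀ z, z ∈ H ↔ ∃ w, z = w ᵥ* g) (T : Matrix (Fin d) (Fin d) ℤ)
    (h : ∀ k, T k ∈ H) : ∃ A : Matrix (Fin d) (Fin d) ℤ, T = A * g := by
  obtain ⟨A, hA⟩ : ∃ A : Matrix (Fin d) (Fin d) ℤ, ∀ k, T k = A k ᵥ* g := by
    choose A hA using fun k => (hg (T k)).1 (h k)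
    exact ⟨Matrix.of A, hA⟩
  refine ⟨A, ?_⟩
  ext k l
  rw [Matrix.mul_apply]
  have := congrFun (hA k) l
  simpa [Matrix.vecMul, dotProduct] using this

lemma icast_row (T : Matrix (Fin d) (Fin d) ℤ) (k : Fin d) : vcast p (T k) = (icast p T) k := by
  ext l; simp [vcast, icast]

lemma row_mul (S T : Matrix (Fin d) (Fin d) ℚ_[p]) (k : Fin d) : (S k) ᵥ* T = (S * T) k := by
  ext l; simp [Matrix.vecMul, dotProduct, Matrix.mul_apply]

lemma HT_main {T : Matrix (Fin d) (Fin d) ℚ_[p]} {i : ℕ} (hT : Itg T) (hd : ‖T.det‖ = (p : ℝ) ^ (-(i : ℤ))) :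
    (HT T).index = p ^ i ∧ ∀ g : Matrix (Fin d) (Fin d) ℤ, (∀ z, z ∈ HT T ↔ ∃ w, z = w ᵥ* g) →
      g.det.natAbs = (HT T).index → ∃ U, GLO U ∧ T = U * icast p g := by
  have hdn : T.det ≠ 0 := by
    rw [← norm_ne_zero_iff, hd]; exact (zpow_pos p_pos _).ne'
  have hu := isU hdn
  have hpT : Itg (((p : ℚ_[p]) ^ i) • T⁻¹) := by
    intro k l
    rw [inv_eq, smul_smul, Matrix.smul_apply, smul_eq_mul, norm_mul, norm_mul, norm_inv, hd, Padic.norm_p_pow,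
      mul_inv_cancel₀ (zpow_pos p_pos _).ne', one_mul]
    exact hT.adj k l
  have hmem : ∀ z : Fin d → ℤ, (p ^ i : ℤ) • z ∈ HT T := by
    intro z
    rw [mem_HT]
    have : vcast p ((p ^ i : ℤ) • z) ᵥ* T⁻¹ = vcast p z ᵥ* (((p : ℚ_[p]) ^ i) • T⁻¹) := by
      rw [Matrix.vecMul_smul, ← Matrix.smul_vecMul]
      congr 1
      ext k; simp [vcast]
    rw [this]
    exact (OI_vcast z).vecMul hpT
  have hidx : (HT T).index ∣ (p ^ i) ^ d := by
    have hle : AddSubgroup.pi Set.univ (fun _ : Fin d => AddSubgroup.zmultiples ((p : ℤ) ^ i)) ≤ HT T := by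
      intro z hz
      rw [AddSubgroup.mem_pi] at hz
      have h1 : ∀ k, ∃ c, c * (p : ℤ) ^ i = z k := fun k => by
        simpa [Int.mem_zmultiples_iff, Dvd.dvd, eq_comm, mul_comm] using hz k trivial
      choose c hc using h1
      have : z = (p ^ i : ℤ) • c := by ext k; simp [← hc, mul_comm]
      rw [this]; exact hmem c
    have := AddSubgroup.index_dvd_of_le hle
    rw [AddSubgroup.index_pi] at this
    simpa [Int.index_zmultiples, Int.natAbs_pow] using this
  have key : ∀ g : Matrix (Fin d) (Fin d) ℤ, (∀ z, z ∈ HT T ↔ ∃ w, z = w ᵥ* g) → ∃ U, GLO U ∧ T = U * icast p g := by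
    intro g hg
    have hV : Itg (icast p g * T⁻¹) := by
      intro k l
      have : g k ∈ HT T := (hg _).2 ⟨Pi.single k 1, by
        rw [Matrix.single_one_vecMul]; rfl⟩
      have := mem_HT.1 this l
      rwa [icast_row, row_mul] at this
    obtain ⟨T', W, hW, hTW⟩ : ∃ (T' : Matrix (Fin d) (Fin d) ℤ) (W : Matrix (Fin d) (Fin d) ℚ_[p]), Itg W ∧
        ∀ k l, T k l = T' k l + (p : ℚ_[p]) ^ i * W k l := by
      choose T' W hW hTW using fun k l => approx i (hT k l)
      exact ⟨Matrix.of T', Matrix.of W, hW, hTW⟩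
    have hTW' : T = icast p T' + ((p : ℚ_[p]) ^ i) • W := by
      ext k l; simp [icast, hTW k l]
    obtain ⟨A, hA⟩ := mat_row hg T' (fun k => by
      rw [mem_HT, icast_row, row_mul]
      have : icast p T' * T⁻¹ = 1 + (-1 : ℚ_[p]) • (W * (((p : ℚ_[p]) ^ i) • T⁻¹)) := by
        have h5 : T * T⁻¹ = icast p T' * T⁻¹ + W * (((p : ℚ_[p]) ^ i) • T⁻¹) := by
          rw [Matrix.mul_smul, ← Matrix.smul_mul, ← Matrix.add_mul, ← hTW']
        rw [← Matrix.mul_nonsing_inv T hu, h5, neg_one_smul]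
        abel
      rw [this]
      intro l
      have h2 : Itg (W * (((p : ℚ_[p]) ^ i) • T⁻¹)) := Itg.mul hW hpT
      refine um_add_le (Itg.one k l) ?_
      rw [Matrix.smul_apply]
      simpa using h2 k l)
    obtain ⟨B, hB⟩ := mat_row hg (((p ^ i : ℤ)) • (1 : Matrix (Fin d) (Fin d) ℤ)) (fun k => hmem _)
    have hB' : ((p : ℚ_[p]) ^ i) • (1 : Matrix (Fin d) (Fin d) ℚ_[p]) = icast p B * icast p g := by
      rw [← icast_mul, ← hB]
      ext k l
      simp only [icast, Matrix.one_apply, Matrix.smul_apply, Matrix.map_apply]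
      split_ifs <;> simp
    have hTU : T = (icast p A + W * icast p B) * icast p g := by
      rw [Matrix.add_mul, Matrix.mul_assoc, ← hB', ← icast_mul, ← hA, Matrix.mul_smul, Matrix.mul_one]
      exact hTW'
    have hU : Itg (icast p A + W * icast p B) :=
      (Itg_icast A).add (Itg.mul hW (Itg_icast B))
    refine ⟨_, ⟨hU, ?_⟩, hTU⟩
    set U := icast p A + W * icast p B
    have hUV : U * (icast p g * T⁻¹) = 1 := by
      rw [← Matrix.mul_assoc, ← hTU, Matrix.mul_nonsing_inv _ hu]
    have h1 := congrArg (fun M => ‖Matrix.det M‖) hUV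
    simp only [Matrix.det_mul U, norm_mul, Matrix.det_one, norm_one] at h1
    refine le_antisymm hU.det ?_
    rw [← h1]
    exact mul_le_of_le_one_right (norm_nonneg _) hV.det
  refine ⟨?_, fun g hg _ => key g hg⟩
  have hne : (HT T).index ≠ 0 := by
    intro h; rw [h, zero_dvd_iff] at hidx
    exact pow_ne_zero _ (pow_ne_zero _ (Fact.out : p.Prime).ne_zero) hidx
  obtain ⟨g, hg, hgd⟩ := exists_mat (HT T) hne
  obtain ⟨U, hU, hTU⟩ := key g hg
  rw [← pow_mul, Nat.dvd_prime_pow Fact.out] at hidx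
  obtain ⟨j, _, hj⟩ := hidx
  have h1 := icast_det_norm (p := p) (hgd.trans hj)
  have h2 : ‖T.det‖ = ‖(icast p g).det‖ := by
    conv_lhs => rw [hTU]
    rw [Matrix.det_mul, norm_mul, hU.2, one_mul]
  rw [hd, h1] at h2
  have := zpow_right_injective₀ p_pos one_lt_p.ne' h2
  rw [hj]; congr 1; omega

/-- bilinear multiplication with structure constants `C` -/
def mulv {R : Type*} [CommRing R] (C : Fin d → Fin d → Fin d → ℤ) (x y : Fin d → R) : Fin d → R :=
  fun k => ∑ i, ∑ j, x i * y j * (C i j k : R)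

lemma mulv_vcast (C : Fin d → Fin d → Fin d → ℤ) (x y : Fin d → ℤ) :
    vcast p (mulv C x y) = mulv C (vcast p x) (vcast p y) := by
  ext k; simp [vcast, mulv]

lemma mulv_vecMul (C : Fin d → Fin d → Fin d → ℤ) (x y : Fin d → ℚ_[p]) (T : Matrix (Fin d) (Fin d) ℚ_[p]) :
    mulv C (x ᵥ* T) (y ᵥ* T) = ∑ a, ∑ b, (x a * y b) • mulv C (T a) (T b) := by
  ext k
  simp only [mulv, Matrix.vecMul, dotProduct, Finset.sum_apply, Pi.smul_apply, smul_eq_mul, Finset.mul_sum, Finset.sum_mul]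
  have h1 : ∀ i j : Fin d, ∑ b, ∑ a, x a * T a i * (y b * T b j) * (C i j k : ℚ_[p]) =
     ∑ a, ∑ b, x a * T a i * (y b * T b j) * (C i j k : ℚ_[p]) := fun i j => Finset.sum_comm
  simp only [h1]
  calc _ = ∑ i, ∑ a, ∑ j, ∑ b, x a * T a i * (y b * T b j) * (C i j k : ℚ_[p]) :=
        Finset.sum_congr rfl (fun i _ => Finset.sum_comm)
    _ = ∑ a, ∑ i, ∑ j, ∑ b, x a * T a i * (y b * T b j) * (C i j k : ℚ_[p]) := Finset.sum_comm
    _ = ∑ a, ∑ i, ∑ b, ∑ j, x a * T a i * (y b * T b j) * (C i j k : ℚ_[p]) :=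
        Finset.sum_congr rfl (fun a _ => Finset.sum_congr rfl (fun i _ => Finset.sum_comm))
    _ = ∑ a, ∑ b, ∑ i, ∑ j, x a * T a i * (y b * T b j) * (C i j k : ℚ_[p]) :=
        Finset.sum_congr rfl (fun a _ => Finset.sum_comm)
    _ = _ := by
        refine Finset.sum_congr rfl (fun a _ => Finset.sum_congr rfl (fun b _ => Finset.sum_congr rfl (fun i _ =>
          Finset.sum_congr rfl (fun j _ => ?_))))
        ring

lemma mulv_OI (C : Fin d → Fin d → Fin d → ℤ) {x y : Fin d → ℚ_[p]} {T R : Matrix (Fin d) (Fin d) ℚ_[p]}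
    (hx : OI x) (hy : OI y) (h : ∀ a b, OI (mulv C (T a) (T b) ᵥ* R)) : OI (mulv C (x ᵥ* T) (y ᵥ* T) ᵥ* R) := by
  rw [mulv_vecMul, Matrix.sum_vecMul]
  refine OI.sum fun a _ => ?_
  rw [Matrix.sum_vecMul]
  refine OI.sum fun b _ => ?_
  rw [Matrix.smul_vecMul]
  refine OI.smul ?_ (h a b)
  rw [norm_mul]; exact mul_le_one₀ (hx a) (norm_nonneg _) (hy b)

/-- `HT T` is closed under multiplication iff `T` satisfies the polynomial conditions -/
lemma closed_iff (C : Fin d → Fin d → Fin d → ℤ) {T : Matrix (Fin d) (Fin d) ℚ_[p]} {i : ℕ} (hT : Itg T)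
    (hd : ‖T.det‖ = (p : ℝ) ^ (-(i : ℤ))) :
    (∀ x ∈ HT T, ∀ y ∈ HT T, mulv C x y ∈ HT T) ↔ ∀ a b, OI (mulv C (T a) (T b) ᵥ* T⁻¹) := by
  have hdn : T.det ≠ 0 := by
    rw [← norm_ne_zero_iff, hd]; exact (zpow_pos p_pos _).ne'
  have hu := isU hdn
  constructor
  · intro h a b
    obtain ⟨hi, hg⟩ := HT_main hT hd
    obtain ⟨g, hg1, hg2⟩ := exists_mat (HT T) (by rw [hi]; exact pow_ne_zero _ (Fact.out : p.Prime).ne_zero)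
    obtain ⟨U, hU, hTU⟩ := hg g hg1 hg2
    have h1 : ∀ a, T a = U a ᵥ* icast p g := fun a => by rw [row_mul, ← hTU]
    rw [h1 a, h1 b]
    refine mulv_OI C (hU.1 a) (hU.1 b) fun a b => ?_
    rw [← icast_row, ← icast_row, ← mulv_vcast]
    have hrow : ∀ k, g k ∈ HT T := fun k => (hg1 _).2 ⟨Pi.single k 1, by
        rw [Matrix.single_one_vecMul]; rfl⟩
    exact mem_HT.1 (h _ (hrow a) _ (hrow b))
  · intro h x hx y hy
    have h1 : ∀ x, vcast p x = (vcast p x ᵥ* T⁻¹) ᵥ* T := fun x => by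
      rw [Matrix.vecMul_vecMul, Matrix.nonsing_inv_mul _ hu, Matrix.vecMul_one]
    rw [mem_HT, mulv_vcast, h1 x, h1 y]
    exact mulv_OI C hx hy h

end lat
end LSZ

/-! ### Part 19 -/
namespace LSZ
open Matrix MeasureTheory

section meas2
variable {p : ℕ} [Fact p.Prime] {d : ℕ}

/-- vector to matrix -/
def mt {R : Type*} (x : Fin (d * d) → R) : Matrix (Fin d) (Fin d) R := Matrix.of fun i j => x (finProdFinEquiv (i, j))
/-- matrix to vector -/
def vt {R : Type*} (T : Matrix (Fin d) (Fin d) R) : Fin (d * d) → R :=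
  fun k => T (finProdFinEquiv.symm k).1 (finProdFinEquiv.symm k).2

lemma mt_vt {R : Type*} (T : Matrix (Fin d) (Fin d) R) : mt (vt T) = T := by
  ext i j; simp [mt, vt, -finProdFinEquiv_symm_apply]
lemma vt_mt {R : Type*} (x : Fin (d * d) → R) : vt (mt x) = x := by
  ext k; simp [mt, vt, -finProdFinEquiv_symm_apply]

lemma mt_cont : Continuous (mt : (Fin (d * d) → ℚ_[p]) → Matrix (Fin d) (Fin d) ℚ_[p]) :=
  continuous_matrix fun _ _ => continuous_apply _
lemma vt_cont : Continuous (vt : Matrix (Fin d) (Fin d) ℚ_[p] → (Fin (d * d) → ℚ_[p])) :=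
  continuous_pi fun _ => (continuous_id.matrix_elem _ _)

/-- right multiplication by the inverse of an invertible matrix -/
noncomputable def Rm (T : Matrix (Fin d) (Fin d) ℚ_[p]) (hT : IsUnit T.det) :
    (Fin (d * d) → ℚ_[p]) ≃ₜ+ (Fin (d * d) → ℚ_[p]) where
  toFun x := vt (mt x * T⁻¹)
  invFun x := vt (mt x * T)
  left_inv x := by
    beta_reduce
    rw [mt_vt, Matrix.mul_assoc, Matrix.nonsing_inv_mul _ hT, Matrix.mul_one, vt_mt]
  right_inv x := by
    beta_reduce
    rw [mt_vt, Matrix.mul_assoc, Matrix.mul_nonsing_inv _ hT, Matrix.mul_one, vt_mt]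
  map_add' x y := by
    have : mt (x + y) = mt x + mt y := by ext; simp [mt]
    rw [this, Matrix.add_mul]
    ext k; simp [vt]
  continuous_toFun := vt_cont.comp (mt_cont.matrix_mul continuous_const)
  continuous_invFun := vt_cont.comp (mt_cont.matrix_mul continuous_const)

/-- the integral matrices -/
def Oset (p : ℕ) [Fact p.Prime] (d : ℕ) : Set (Fin (d * d) → ℚ_[p]) := {x | Itg (mt x)}
/-- the invertible integral matrices -/
def Gset (p : ℕ) [Fact p.Prime] (d : ℕ) : Set (Fin (d * d) → ℚ_[p]) := {x | GLO (mt x)}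

lemma Oset_eq : Oset p d = Set.pi Set.univ (fun _ => Dk (0 : ℚ_[p]) 0) := by
  ext x
  simp only [Oset, Itg, Dk, Set.mem_pi, Set.mem_univ, true_imp_iff, sub_zero, neg_zero, zpow_zero, Set.mem_ofPred_eq]
  constructor
  · intro h k
    have := h (finProdFinEquiv.symm k).1 (finProdFinEquiv.symm k).2
    simpa [mt, -finProdFinEquiv_symm_apply] using this
  · intro h i j; exact h _

lemma vol_Oset : volume (Oset p d) = 1 := by
  rw [Oset_eq, volume_pi_pi]
  simp [vol_Dk]

lemma Oset_meas : MeasurableSet (Oset p d) := by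
  rw [Oset_eq]; exact MeasurableSet.univ_pi fun _ => Dk_meas _ _

lemma Oset_open : IsOpen (Oset p d) := by
  rw [Oset_eq]
  refine isOpen_set_pi Set.finite_univ fun k _ => ?_
  rw [Dk_eq]
  exact IsUltrametricDist.isOpen_closedBall _ (zpow_pos p_pos _).ne'

lemma Gset_open : IsOpen (Gset p d) := by
  have h1 : Gset p d = Oset p d ∩ (fun x => (mt x).det) ⁻¹' Metric.sphere (0 : ℚ_[p]) 1 := by
    ext x; simp [Gset, Oset, GLO]
  rw [h1]
  exact Oset_open.inter ((IsUltrametricDist.isOpen_sphere _ one_ne_zero).preimage mt_cont.matrix_det)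

lemma Gset_pos : volume (Gset p d) ≠ 0 := by
  refine (Gset_open.measure_pos volume ⟨vt 1, ?_⟩).ne'
  change GLO (mt (vt 1))
  rw [mt_vt]; exact ⟨Itg.one, by simp⟩

lemma Gset_le : volume (Gset p d) ≤ 1 := by
  rw [← vol_Oset (p := p) (d := d)]
  exact measure_mono fun x hx => hx.1

/-- the piece attached to `T` -/
def Pset (T : Matrix (Fin d) (Fin d) ℚ_[p]) : Set (Fin (d * d) → ℚ_[p]) := {x | GLO (mt x * T⁻¹)}
def OT (T : Matrix (Fin d) (Fin d) ℚ_[p]) : Set (Fin (d * d) → ℚ_[p]) := {x | Itg (mt x * T⁻¹)}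

lemma Pset_eq (T : Matrix (Fin d) (Fin d) ℚ_[p]) (hT : IsUnit T.det) : Pset T = Rm T hT ⁻¹' Gset p d := by
  ext x
  change _ ↔ GLO (mt (vt (mt x * T⁻¹)))
  rw [mt_vt]; rfl

lemma OT_eq (T : Matrix (Fin d) (Fin d) ℚ_[p]) (hT : IsUnit T.det) : OT T = Rm T hT ⁻¹' Oset p d := by
  ext x
  change _ ↔ Itg (mt (vt (mt x * T⁻¹)))
  rw [mt_vt]; rfl

lemma Pset_meas (T : Matrix (Fin d) (Fin d) ℚ_[p]) (hT : IsUnit T.det) : MeasurableSet (Pset T) := by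
  rw [Pset_eq T hT]
  exact (Gset_open.preimage (Rm T hT).continuous_toFun).measurableSet

lemma OT_meas (T : Matrix (Fin d) (Fin d) ℚ_[p]) (hT : IsUnit T.det) : MeasurableSet (OT T) := by
  rw [OT_eq T hT]
  exact (Oset_open.preimage (Rm T hT).continuous_toFun).measurableSet

lemma scale (T : Matrix (Fin d) (Fin d) ℚ_[p]) (hT : IsUnit T.det) :
    volume (Pset T) = volume (Gset p d) * volume (OT T) := by
  have h1 := addEquivAddHaarChar_smul_preimage (volume : Measure (Fin (d * d) → ℚ_[p])) (X := Gset p d) (Rm T hT)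
  have h2 := addEquivAddHaarChar_smul_preimage (volume : Measure (Fin (d * d) → ℚ_[p])) (X := Oset p d) (Rm T hT)
  rw [← Pset_eq] at h1
  rw [← OT_eq, vol_Oset] at h2
  rw [← h1]
  simp only [ENNReal.smul_def, smul_eq_mul] at h2 ⊢
  rw [mul_right_comm, h2, one_mul]

lemma OT_vol {H : AddSubgroup (Fin d → ℤ)} {g : Matrix (Fin d) (Fin d) ℤ} {i : ℕ}
    (hg : ∀ z, z ∈ H ↔ ∃ w, z = w ᵥ* g) (hd : g.det.natAbs = H.index) (hi : H.index = p ^ i) :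
    ((p : ENNReal) ^ (i * d)) * volume (OT (icast p g)) = 1 := by
  have hu := isU (icast_det_ne (p := p) (hd.trans hi))
  have hHT := HT_icast hg hd hi
  let K : AddSubgroup (Fin d → Fin d → ℤ) := AddSubgroup.pi Set.univ (fun _ => H)
  have hK : K.index = p ^ (i * d) := by
    rw [AddSubgroup.index_pi]; simp [hi, pow_mul]
  have hKm : ∀ T : Matrix (Fin d) (Fin d) ℤ, (fun a b => T a b) ∈ K ↔ Itg (icast p T * (icast p g)⁻¹) := by
    intro T
    rw [AddSubgroup.mem_pi]
    constructor
    · intro h a b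
      have := h a trivial
      rw [← hHT, mem_HT] at this
      have := this b
      change ‖(vcast p (T a) ᵥ* _) b‖ ≤ 1 at this
      rwa [icast_row, row_mul] at this
    · intro h a _
      rw [← hHT, mem_HT]
      intro b
      change ‖(vcast p (T a) ᵥ* _) b‖ ≤ 1
      rw [icast_row, row_mul]; exact h a b
  have hfin : Finite ((Fin d → Fin d → ℤ) ⧸ K) := by
    have : K.FiniteIndex := ⟨by rw [hK]; exact pow_ne_zero _ (Fact.out : p.Prime).ne_zero⟩
    infer_instance
  let cv : (Fin d → Fin d → ℤ) → (Fin (d * d) → ℚ_[p]) := fun T => vt (icast p (Matrix.of T))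
  have hcv : ∀ (T) (x), x ∈ (fun y => -(cv T) + y) ⁻¹' OT (icast p g) ↔ Itg ((mt x - icast p (Matrix.of T)) * (icast p g)⁻¹) := by
    intro T x
    change Itg (mt (-(cv T) + x) * _) ↔ _
    have : mt (-(cv T) + x) = mt x - icast p (Matrix.of T) := by
      rw [← mt_vt (icast p (Matrix.of T))]
      ext; simp [mt, cv, neg_add_eq_sub]
    rw [this]
  have hU : Oset p d = ⋃ q : (Fin d → Fin d → ℤ) ⧸ K, (fun y => -(cv q.out) + y) ⁻¹' OT (icast p g) := by
    ext x
    rw [Set.mem_iUnion]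
    constructor
    · intro hx
      obtain ⟨T', W, hW, hTW⟩ : ∃ (T' : Matrix (Fin d) (Fin d) ℤ) (W : Matrix (Fin d) (Fin d) ℚ_[p]), Itg W ∧
          ∀ k l, mt x k l = T' k l + (p : ℚ_[p]) ^ i * W k l := by
        choose T' W hW hTW using fun k l => approx i (hx k l)
        exact ⟨Matrix.of T', Matrix.of W, hW, hTW⟩
      refine ⟨QuotientAddGroup.mk (fun a b => T' a b), ?_⟩
      rw [hcv]
      set q : (Fin d → Fin d → ℤ) ⧸ K := QuotientAddGroup.mk (fun a b => T' a b) with hq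
      have h1 : -q.out + (fun a b => T' a b) ∈ K := by
        rw [← QuotientAddGroup.eq, ← hq]; exact Quotient.out_eq q
      have h2 := (hKm (Matrix.of (-q.out + (fun a b => T' a b)))).1 h1
      have h3 : Itg (W * (((p : ℚ_[p]) ^ i) • (icast p g)⁻¹)) := by
        refine Itg.mul hW ?_
        intro k l
        rw [inv_eq, smul_smul, Matrix.smul_apply, smul_eq_mul, norm_mul, norm_mul, norm_inv, icast_det_norm (hd.trans hi), Padic.norm_p_pow,
          mul_inv_cancel₀ (zpow_pos p_pos _).ne', one_mul]
        exact (Itg_icast g).adj k l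
      have h4 : (mt x - icast p (Matrix.of q.out)) * (icast p g)⁻¹ =
          icast p (Matrix.of (-q.out + (fun a b => T' a b))) * (icast p g)⁻¹ + W * (((p : ℚ_[p]) ^ i) • (icast p g)⁻¹) := by
        rw [Matrix.mul_smul, ← Matrix.smul_mul, ← Matrix.add_mul]
        congr 1
        ext a b
        simp only [Matrix.sub_apply, Matrix.add_apply, hTW, icast, Matrix.map_apply, Matrix.of_apply, Matrix.smul_apply, smul_eq_mul, Pi.add_apply, Pi.neg_apply, eq_intCast]
        push_cast; ring
      rw [h4]
      exact h2.add h3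
    · rintro ⟨q, hq⟩
      rw [hcv] at hq
      have h1 := (hq.mul (Itg_icast g)).add (Itg_icast (p := p) (Matrix.of q.out))
      rw [Matrix.mul_assoc, Matrix.nonsing_inv_mul _ hu, Matrix.mul_one, sub_add_cancel] at h1
      exact h1
  have hdis : Pairwise (Function.onFun Disjoint fun q : (Fin d → Fin d → ℤ) ⧸ K => (fun y => -(cv q.out) + y) ⁻¹' OT (icast p g)) := by
    intro q r hqr
    rw [Function.onFun, Set.disjoint_left]
    intro x hx hx'
    rw [hcv] at hx hx'
    apply hqr
    rw [← Quotient.out_eq q, ← Quotient.out_eq r]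
    refine QuotientAddGroup.eq.2 ((hKm (Matrix.of (-q.out + r.out))).2 ?_)
    have h4 : icast p (Matrix.of (-q.out + r.out)) * (icast p g)⁻¹ = (mt x - icast p (Matrix.of q.out)) * (icast p g)⁻¹
      - (mt x - icast p (Matrix.of r.out)) * (icast p g)⁻¹ := by
      rw [← Matrix.sub_mul]
      congr 1
      ext a b
      simp [icast, neg_add_eq_sub]
    rw [h4]
    intro a b
    exact um_sub_le (hx a b) (hx' a b)
  have h1 := vol_Oset (p := p) (d := d)
  rw [hU, measure_iUnion hdis (fun q => (OT_meas _ hu).preimage (measurable_const_add _))] at h1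
  simp only [measure_preimage_add] at h1
  rw [ENNReal.tsum_const, ENat.card_eq_coe_natCard] at h1
  change ((K.index : ENat) : ENNReal) * _ = 1 at h1
  rw [hK] at h1
  simpa using h1

/-- finite-index additive subgroups of `ℤ^d` closed under multiplication -/
abbrev HH (C : Fin d → Fin d → Fin d → ℤ) (n : ℕ) : Type :=
  {H : AddSubgroup (Fin d → ℤ) // H.index = n ∧ ∀ x ∈ H, ∀ y ∈ H, mulv C x y ∈ H}

/-- the set of matrices whose rows generate a subring of index `p^i` -/
def Xset (p : ℕ) [Fact p.Prime] (C : Fin d → Fin d → Fin d → ℤ) (i : ℕ) : Set (Fin (d * d) → ℚ_[p]) :=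
  {x | Itg (mt x) ∧ ‖(mt x).det‖ = (p : ℝ) ^ (-(i : ℤ)) ∧
    ∀ a b k, ‖(mulv C (mt x a) (mt x b) ᵥ* (mt x).adjugate) k‖ ≤ ‖(mt x).det‖}

lemma adj_iff {T : Matrix (Fin d) (Fin d) ℚ_[p]} (h : T.det ≠ 0) (v : Fin d → ℚ_[p]) :
    OI (v ᵥ* T⁻¹) ↔ ∀ k, ‖(v ᵥ* T.adjugate) k‖ ≤ ‖T.det‖ := by
  refine forall_congr' fun k => ?_
  rw [inv_eq, Matrix.vecMul_smul, Pi.smul_apply, smul_eq_mul, norm_mul, norm_inv, inv_mul_le_iff₀ (norm_pos_iff.2 h), mul_one]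

lemma hh_ne {C : Fin d → Fin d → Fin d → ℤ} {i : ℕ} (H : HH C (p ^ i)) : H.1.index ≠ 0 := by
  rw [H.2.1]; exact pow_ne_zero _ (Fact.out : p.Prime).ne_zero

/-- a chosen basis matrix -/
noncomputable def gm {C : Fin d → Fin d → Fin d → ℤ} {i : ℕ} (H : HH C (p ^ i)) : Matrix (Fin d) (Fin d) ℤ :=
  (exists_mat H.1 (hh_ne H)).choose

lemma gm_mem {C : Fin d → Fin d → Fin d → ℤ} {i : ℕ} (H : HH C (p ^ i)) : ∀ z, z ∈ H.1 ↔ ∃ w, z = w ᵥ* gm H :=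
  (exists_mat H.1 (hh_ne H)).choose_spec.1

lemma gm_det {C : Fin d → Fin d → Fin d → ℤ} {i : ℕ} (H : HH C (p ^ i)) : (gm H).det.natAbs = H.1.index :=
  (exists_mat H.1 (hh_ne H)).choose_spec.2

lemma gm_u {C : Fin d → Fin d → Fin d → ℤ} {i : ℕ} (H : HH C (p ^ i)) : IsUnit (icast p (gm H)).det :=
  isU (icast_det_ne ((gm_det H).trans H.2.1))

lemma Pset_HT {C : Fin d → Fin d → Fin d → ℤ} {i : ℕ} (H : HH C (p ^ i)) {x : Fin (d * d) → ℚ_[p]}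
    (hx : x ∈ Pset (icast p (gm H))) : HT (mt x) = H.1 := by
  have h1 : mt x = (mt x * (icast p (gm H))⁻¹) * icast p (gm H) := by
    rw [Matrix.mul_assoc, Matrix.nonsing_inv_mul _ (gm_u H), Matrix.mul_one]
  rw [h1, HT_mul hx, HT_icast (gm_mem H) (gm_det H) H.2.1]

lemma Xset_eq (C : Fin d → Fin d → Fin d → ℤ) (i : ℕ) :
    Xset p C i = ⋃ H : HH C (p ^ i), Pset (icast p (gm H)) := by
  ext x
  rw [Set.mem_iUnion]
  constructor
  · rintro ⟨h1, h2, h3⟩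
    have hdn : (mt x).det ≠ 0 := by
      rw [← norm_ne_zero_iff, h2]; exact (zpow_pos p_pos _).ne'
    obtain ⟨h4, h5⟩ := HT_main h1 h2
    have h6 := (closed_iff C h1 h2).2 fun a b => (adj_iff hdn _).2 (h3 a b)
    let H : HH C (p ^ i) := ⟨HT (mt x), h4, h6⟩
    obtain ⟨U, hU, hTU⟩ := h5 (gm H) (gm_mem H) (gm_det H)
    refine ⟨H, ?_⟩
    change GLO (mt x * _)
    rw [hTU, Matrix.mul_assoc, Matrix.mul_nonsing_inv _ (gm_u H), Matrix.mul_one]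
    exact hU
  · rintro ⟨H, hx⟩
    have h0 : mt x = (mt x * (icast p (gm H))⁻¹) * icast p (gm H) := by
      rw [Matrix.mul_assoc, Matrix.nonsing_inv_mul _ (gm_u H), Matrix.mul_one]
    have h1 : Itg (mt x) := by rw [h0]; exact Itg.mul hx.1 (Itg_icast _)
    have h2 : ‖(mt x).det‖ = (p : ℝ) ^ (-(i : ℤ)) := by
      rw [h0, Matrix.det_mul, norm_mul, hx.2, one_mul, icast_det_norm ((gm_det H).trans H.2.1)]
    have hdn : (mt x).det ≠ 0 := by
      rw [← norm_ne_zero_iff, h2]; exact (zpow_pos p_pos _).ne'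
    refine ⟨h1, h2, fun a b => (adj_iff hdn _).1 ((closed_iff C h1 h2).1 ?_ a b)⟩
    rw [Pset_HT H hx]; exact H.2.2

lemma Pset_dis (C : Fin d → Fin d → Fin d → ℤ) (i : ℕ) :
    Pairwise (Function.onFun Disjoint fun H : HH C (p ^ i) => Pset (icast p (gm H))) := by
  intro H H' hne
  rw [Function.onFun, Set.disjoint_left]
  intro x hx hx'
  exact hne (Subtype.ext ((Pset_HT H hx).symm.trans (Pset_HT H' hx')))

lemma Pset_vol {C : Fin d → Fin d → Fin d → ℤ} {i : ℕ} (H : HH C (p ^ i)) :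
    ((p : ENNReal) ^ (i * d)) * volume (Pset (icast p (gm H))) = volume (Gset p d) := by
  rw [scale _ (gm_u H), mul_left_comm, OT_vol (gm_mem H) (gm_det H) H.2.1, mul_one]

lemma HH_finite (C : Fin d → Fin d → Fin d → ℤ) (i : ℕ) : Finite (HH C (p ^ i)) := by
  by_contra hinf
  rw [not_finite_iff_infinite] at hinf
  have h1 := tsum_meas_le_meas_iUnion_of_disjoint (volume : Measure (Fin (d * d) → ℚ_[p]))
    (fun H : HH C (p ^ i) => Pset_meas _ (gm_u H)) (Pset_dis C i)
  rw [← Xset_eq] at h1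
  have h2 : volume (Xset p C i) ≤ 1 := by
    rw [← vol_Oset (p := p) (d := d)]
    exact measure_mono fun x hx => hx.1
  have hp : ((p : ENNReal) ^ (i * d)) ≠ 0 := pow_ne_zero _ (by exact_mod_cast (Fact.out : p.Prime).ne_zero)
  have hp' : ((p : ENNReal) ^ (i * d)) ≠ ⊤ := ENNReal.pow_ne_top (ENNReal.natCast_ne_top p)
  have h3 : ∀ H : HH C (p ^ i), volume (Pset (icast p (gm H))) = volume (Gset p d) / (p : ENNReal) ^ (i * d) := by
    intro H
    rw [ENNReal.eq_div_iff hp hp', Pset_vol H]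
  simp only [h3] at h1
  rw [ENNReal.tsum_const_eq_top_of_ne_zero (ENNReal.div_ne_zero.2 ⟨Gset_pos, hp'⟩)] at h1
  exact absurd (h1.trans h2) (by simp)

lemma Xset_vol (C : Fin d → Fin d → Fin d → ℤ) (i : ℕ) :
    ((p : ENNReal) ^ (i * d)) * volume (Xset p C i) = (Nat.card (HH C (p ^ i)) : ENNReal) * volume (Gset p d) := by
  have := HH_finite (p := p) C i
  rw [Xset_eq, measure_iUnion (Pset_dis C i) (fun H => Pset_meas _ (gm_u H)), ← ENNReal.tsum_mul_left]
  simp only [Pset_vol]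
  rw [ENNReal.tsum_const, ENat.card_eq_coe_natCard]
  simp

end meas2
end LSZ

/-! ### Part 20 -/
namespace LSZ
open Matrix MeasureTheory

namespace Base

section asm
variable {d : ℕ}

/-- generic matrix -/
noncomputable def XM (d : ℕ) : Matrix (Fin d) (Fin d) (MvPolynomial (Fin (d * d)) ℤ) := mt fun k => MvPolynomial.X k

lemma XM_apply {p : ℕ} [Fact p.Prime] (x : Fin (d * d) → ℚ_[p]) (a b : Fin d) : mev x (XM d a b) = mt x a b := by
  simp [XM, mt]

lemma XM_map {p : ℕ} [Fact p.Prime] (x : Fin (d * d) → ℚ_[p]) : (mev x).mapMatrix (XM d) = mt x := by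
  ext a b; exact XM_apply x a b

lemma XM_det {p : ℕ} [Fact p.Prime] (x : Fin (d * d) → ℚ_[p]) : mev x (XM d).det = (mt x).det := by
  rw [RingHom.map_det, XM_map]

lemma XM_adj {p : ℕ} [Fact p.Prime] (x : Fin (d * d) → ℚ_[p]) (a b : Fin d) :
    mev x ((XM d).adjugate a b) = (mt x).adjugate a b := by
  rw [← XM_map, ← RingHom.map_adjugate]; rfl

/-- the polynomial closure conditions -/
noncomputable def PC (C : Fin d → Fin d → Fin d → ℤ) (a b k : Fin d) : MvPolynomial (Fin (d * d)) ℤ :=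
  (mulv C (XM d a) (XM d b) ᵥ* (XM d).adjugate) k

lemma PC_apply {p : ℕ} [Fact p.Prime] (C : Fin d → Fin d → Fin d → ℤ) (a b k : Fin d) (x : Fin (d * d) → ℚ_[p]) :
    mev x (PC C a b k) = (mulv C (mt x a) (mt x b) ᵥ* (mt x).adjugate) k := by
  simp only [PC, Matrix.vecMul, dotProduct, mulv, map_sum, map_mul, XM_adj, XM_apply, map_intCast]

noncomputable abbrev BD (d : ℕ) : Base := BB (d * d) 0 Unit

/-- the predicate -/
def prd (C : Fin d → Fin d → Fin d → ℤ) (ω : (BD d).Ω) : Prop :=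
  ¬ (mt ω.2.1).det = 0 ∧ Itg (mt ω.2.1) ∧
    ∀ a b k, ‖(mulv C (mt ω.2.1 a) (mt ω.2.1 b) ᵥ* (mt ω.2.1).adjugate) k‖ ≤ ‖(mt ω.2.1).det‖

noncomputable def gv (ω : (BD d).Ω) : ℤ := ((mt ω.2.1).det).valuation

lemma rvt_poly (f : MvPolynomial (Fin (d * d)) ℤ) : (BD d).RVT (fun ω => mev ω.2.1 f) :=
  RVT.coord (B := BD d) (Sum.inl f)

lemma prd_tame (C : Fin d → Fin d → Fin d → ℤ) : (BD d).TameT (prd C) := by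
  have hdet : (BD d).RVT (fun ω => (mt ω.2.1).det) := by
    have := rvt_poly (XM d).det
    simpa only [XM_det] using this
  refine (hdet.eq_zero.not).and (TameT.and ?_ ?_)
  · refine TameT.all fun a => TameT.all fun b => ?_
    have h1 := (rvt_poly (XM d a b)).norm_le (RVT.one (B := BD d))
    simpa only [XM_apply, norm_one] using h1
  · refine TameT.all fun a => TameT.all fun b => TameT.all fun k => ?_
    have h1 := (rvt_poly (PC C a b k)).norm_le hdet
    simpa only [PC_apply] using h1

lemma gv_tame : (BD d).TameZ (gv (d := d)) := by
  have hdet : (BD d).RVT (fun ω => (mt ω.2.1).det) := by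
    have := rvt_poly (XM d).det
    simpa only [XM_det] using this
  exact hdet.1

lemma coef_eq (C : Fin d → Fin d → Fin d → ℤ) (p : Nat.Primes) (i : ℕ) :
    coef (prd C) (fun ω => (-(d : ℤ)) * gv ω) gv p i =
      (Nat.card (HH C ((p : ℕ) ^ i)) : ENNReal) * volume (Gset p d) := by
  rw [← Xset_vol]
  have hmeas : MeasurableSet (Xset p C i) := by
    rw [Xset_eq]
    have := HH_finite (p := p) C i
    exact MeasurableSet.iUnion fun H => Pset_meas _ (gm_u H)
  have h1 : ∀ (y : (Fin 0 → ℤ) × Unit) (x : Fin (d * d) → ℚ_[p]),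
      W (prd C) (fun ω => (-(d : ℤ)) * gv ω) gv i ⟨p, x, y⟩ =
      (Xset p C i).indicator (fun _ => ((p : ℕ) : ENNReal) ^ (i * d)) x := by
    intro y x
    have h2 : (prd C (⟨p, x, y⟩ : (BD d).Ω) ∧ gv (⟨p, x, y⟩ : (BD d).Ω) = i) ↔ x ∈ Xset p C i := by
      simp only [prd, gv, Xset, Set.mem_ofPred_eq]
      constructor
      · rintro ⟨⟨h1, h2, h3⟩, h4⟩
        refine ⟨h2, ?_, h3⟩
        rw [Padic.norm_eq_zpow_neg_valuation h1, h4]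
      · rintro ⟨h1, h2, h3⟩
        have hdn : (mt x).det ≠ 0 := by
          rw [← norm_ne_zero_iff, h2]; exact (zpow_pos p_pos _).ne'
        refine ⟨⟨hdn, h1, h3⟩, ?_⟩
        rw [Padic.norm_eq_zpow_neg_valuation hdn] at h2
        have := zpow_right_injective₀ p_pos one_lt_p.ne' h2
        omega
    classical
    by_cases hx : x ∈ Xset p C i
    · rw [Set.indicator_of_mem hx, W, if_pos (h2.2 hx), (h2.2 hx).2, ← zpow_natCast]
      congr 1
      push_cast; ring
    · rw [Set.indicator_of_notMem hx, W, if_neg (fun h => hx (h2.1 h))]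
  simp only [coef, h1]
  rw [tsum_fintype]
  simp only [lintegral_indicator_const hmeas]
  simp

lemma main_rat (C : Fin d → Fin d → Fin d → ℤ) : ∃ (M : Multiset (ℕ × ℤ)) (N : ℕ), (∀ x ∈ M, 1 ≤ x.1) ∧ ∀ p : Nat.Primes,
    UniR (spM p M) N (PowerSeries.mk fun i => (Nat.card (HH C ((p : ℕ) ^ i)) : ℝ)) := by
  obtain ⟨M, N, hM, h⟩ := rat_all (d * d) (S := Unit) (q := 0) (prd_tame C) (gv_tame.smul (-(d : ℤ))) (gv_tame (d := d))
  refine ⟨M, N, hM, fun p => ?_⟩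
  have hc : volume (Gset p d) ≠ ⊤ := (Gset_le.trans_lt ENNReal.one_lt_top).ne
  have h1 := h p (fun i => by
    rw [coef_eq]; exact ENNReal.mul_ne_top (ENNReal.natCast_ne_top _) hc)
  intro k hk
  have h2 := h1 k hk
  have h3 : (PowerSeries.mk fun i => (coef (prd C) (fun ω => (-(d : ℤ)) * gv ω) gv p i).toReal) =
      PowerSeries.C (volume (Gset p d)).toReal * (PowerSeries.mk fun i => (Nat.card (HH C ((p : ℕ) ^ i)) : ℝ)) := by
    ext i
    rw [PowerSeries.coeff_C_mul, PowerSeries.coeff_mk, PowerSeries.coeff_mk, coef_eq, ENNReal.toReal_mul, mul_comm]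
    simp
  rw [h3, mul_assoc, PowerSeries.coeff_C_mul] at h2
  refine (mul_eq_zero.1 h2).resolve_left ?_
  exact (ENNReal.toReal_pos Gset_pos hc).ne'

end asm
end Base

/-- the rational denominator -/
noncomputable def denQ (p : ℕ) (M : Multiset (ℕ × ℤ)) : Polynomial ℚ :=
  (M.map fun x => 1 - Polynomial.C ((p : ℚ) ^ x.2) * Polynomial.X ^ x.1).prod

lemma denQ_cons (p : ℕ) (x : ℕ × ℤ) (M : Multiset (ℕ × ℤ)) :
    denQ p (x ::ₘ M) = (1 - Polynomial.C ((p : ℚ) ^ x.2) * Polynomial.X ^ x.1) * denQ p M := by simp [denQ]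

lemma denQ_map (p : ℕ) (M : Multiset (ℕ × ℤ)) :
    PowerSeries.map (algebraMap ℚ ℝ) (denQ p M : PowerSeries ℚ) = denR (spM p M) := by
  induction M using Multiset.induction_on with
  | empty => simp [denQ, denR, spM]
  | cons x M ih =>
    have : spM p (x ::ₘ M) = (x.1, (p : ℝ) ^ x.2) ::ₘ spM p M := by simp [spM]
    rw [this, denR_cons, ← ih, denQ_cons, Polynomial.coe_mul, map_mul]
    congr 1
    simp [fac]

lemma denQ_deg (p : ℕ) (M : Multiset (ℕ × ℤ)) : (denQ p M).natDegree ≤ wt M := by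
  induction M using Multiset.induction_on with
  | empty => simp [denQ]
  | cons x M ih =>
    rw [denQ_cons, wt_cons]
    refine Polynomial.natDegree_mul_le.trans (add_le_add ?_ ih)
    refine (Polynomial.natDegree_sub_le _ _).trans (max_le (by simp) ?_)
    exact Polynomial.natDegree_C_mul_X_pow_le _ _

lemma denQ_zero (p : ℕ) (M : Multiset (ℕ × ℤ)) (hM : ∀ x ∈ M, 1 ≤ x.1) : (denQ p M).coeff 0 = 1 := by
  induction M using Multiset.induction_on with
  | empty => simp [denQ]
  | cons x M ih =>
    rw [denQ_cons, Polynomial.mul_coeff_zero, ih (fun y hy => hM y (Multiset.mem_cons_of_mem hy))]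
    have := hM x (Multiset.mem_cons_self x M)
    simp [Polynomial.coeff_X_pow, show (0 : ℕ) ≠ x.1 by omega]

lemma rat_Q {p : ℕ} {M : Multiset (ℕ × ℤ)} {N : ℕ} (hM : ∀ x ∈ M, 1 ≤ x.1) (c : ℕ → ℕ)
    (h : UniR (spM p M) N (PowerSeries.mk fun i => (c i : ℝ))) :
    ∃ P Q : Polynomial ℚ, Q.coeff 0 = 1 ∧ P.natDegree ≤ N + wt M ∧ Q.natDegree ≤ N + wt M ∧
      (PowerSeries.mk fun i => (c i : ℚ)) * (Q : PowerSeries ℚ) = (P : PowerSeries ℚ) := by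
  set F : PowerSeries ℚ := (PowerSeries.mk fun i => (c i : ℚ)) * (denQ p M : PowerSeries ℚ) with hF
  refine ⟨PowerSeries.trunc (N + wt M + 1) F, denQ p M, denQ_zero p M hM, ?_, (denQ_deg p M).trans (by omega), ?_⟩
  · exact Nat.lt_succ_iff.1 (PowerSeries.natDegree_trunc_lt F _)
  · rw [← hF]
    ext k
    rw [Polynomial.coeff_coe, PowerSeries.coeff_trunc]
    split_ifs with hk
    · rfl
    · have h1 := h k (by rw [wt_spM]; omega)
      have h2 : PowerSeries.map (algebraMap ℚ ℝ) F = (PowerSeries.mk fun i => (c i : ℝ)) * denR (spM p M) := by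
        rw [hF, map_mul, denQ_map]
        congr 1

      rw [← h2, PowerSeries.coeff_map] at h1
      exact (algebraMap ℚ ℝ).injective (h1.trans (map_zero _).symm)

lemma mulv_phi {d : ℕ} {Λ : Type*} [NonUnitalNonAssocRing Λ] (φ : Λ ≃+ (Fin d → ℤ)) (a b : Λ) :
    mulv (fun i j k => φ (φ.symm (Pi.single i 1) * φ.symm (Pi.single j 1)) k) (φ a) (φ b) = φ (a * b) := by
  have h : ∀ a : Λ, a = ∑ i, φ a i • φ.symm (Pi.single i 1) := by
    intro a
    apply φ.injective
    rw [map_sum]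
    ext k
    simp [Finset.sum_apply, Pi.single_apply]
  conv_rhs => rw [h a, h b]
  rw [Finset.sum_mul_sum, map_sum]
  ext k
  simp only [mulv, Finset.sum_apply, map_sum, smul_mul_assoc, mul_smul_comm, map_zsmul, Pi.smul_apply, smul_eq_mul]
  refine Finset.sum_congr rfl fun i _ => Finset.sum_congr rfl fun j _ => ?_
  push_cast
  ring

/-- subrings of `Λ` correspond to closed subgroups of `ℤ^d` -/
def subEquiv {d : ℕ} {Λ : Type*} [NonUnitalNonAssocRing Λ] (φ : Λ ≃+ (Fin d → ℤ)) (n : ℕ) :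
    {S : NonUnitalSubring Λ // S.toAddSubgroup.index = n} ≃
      HH (fun i j k => φ (φ.symm (Pi.single i 1) * φ.symm (Pi.single j 1)) k) n where
  toFun S := ⟨S.1.toAddSubgroup.comap φ.symm.toAddMonoidHom, by
    rw [AddSubgroup.index_comap_of_surjective _ φ.symm.surjective]; exact S.2, by
    intro x hx y hy
    obtain ⟨a, rfl⟩ := φ.surjective x
    obtain ⟨b, rfl⟩ := φ.surjective y
    rw [mulv_phi]
    simp only [AddSubgroup.mem_comap, AddEquiv.toAddMonoidHom_eq_coe, AddMonoidHom.coe_coe, AddEquiv.symm_apply_apply] at hx hy ⊢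
    exact S.1.mul_mem hx hy⟩
  invFun H := ⟨{ H.1.comap φ.toAddMonoidHom with
      mul_mem' := by
        intro a b ha hb
        change φ (a * b) ∈ H.1
        rw [← mulv_phi]
        exact H.2.2 _ ha _ hb }, by
    change (H.1.comap φ.toAddMonoidHom).index = n
    rw [AddSubgroup.index_comap_of_surjective _ φ.surjective]; exact H.2.1⟩
  left_inv S := by
    ext a
    change φ.symm (φ a) ∈ S.1 ↔ a ∈ S.1
    rw [AddEquiv.symm_apply_apply]
  right_inv H := by
    ext z
    change φ (φ.symm z) ∈ H.1 ↔ z ∈ H.1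
    rw [AddEquiv.apply_symm_apply]

theorem final (d : ℕ) (Λ : Type*) [NonUnitalNonAssocRing Λ] (hΛ : Nonempty (Λ ≃+ (Fin d → ℤ))) :
    ∃ N : ℕ, ∀ p : ℕ, p.Prime → ∃ P Q : Polynomial ℚ, Q.coeff 0 = 1 ∧ P.natDegree ≤ N ∧ Q.natDegree ≤ N ∧
      (PowerSeries.mk fun i => (Nat.card {S : NonUnitalSubring Λ // S.toAddSubgroup.index = p ^ i} : ℚ)) * (Q : PowerSeries ℚ)
        = (P : PowerSeries ℚ) := by
  obtain ⟨φ⟩ := hΛ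
  obtain ⟨M, N, hM, h⟩ := Base.main_rat (fun i j k => φ (φ.symm (Pi.single i 1) * φ.symm (Pi.single j 1)) k)
  refine ⟨N + wt M, fun p hp => ?_⟩
  have h1 := rat_Q hM _ (h ⟨p, hp⟩)
  have h2 : ∀ i, Nat.card {S : NonUnitalSubring Λ // S.toAddSubgroup.index = p ^ i} =
    Nat.card (HH (fun i j k => φ (φ.symm (Pi.single i 1) * φ.symm (Pi.single j 1)) k) (p ^ i)) :=
    fun i => Nat.card_congr (subEquiv φ _)
  simp only [h2]
  exact h1

end LSZ

/-- **Rationality of local subring zeta functions** (Grunewald–Segal–Smith). Let `Λ` be a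
ring (not necessarily associative, commutative or unital) whose additive group is `ℤ^d`.
For every prime `p` the local subring zeta function `∑_{i ≥ 0} a_{p^i}(Λ) Y^i` is a rational
function `P_p/Q_p` with `Q_p(0) = 1`, with degrees bounded independently of `p`. -/
theorem local_subring_zeta_rational
    (d : ℕ) (Λ : Type*) [NonUnitalNonAssocRing Λ] (hΛ : Nonempty (Λ ≃+ (Fin d → ℤ))) :
    ∃ N : ℕ, ∀ p : ℕ, p.Prime →
      ∃ P Q : Polynomial ℚ, Q.coeff 0 = 1 ∧ P.natDegree ≤ N ∧ Q.natDegree ≤ N ∧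
        (PowerSeries.mk fun i => (subringCount Λ (p ^ i) : ℚ)) * (Q : PowerSeries ℚ)
          = (P : PowerSeries ℚ) := by
  simpa only [subringCount] using LSZ.final d Λ hΛ
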